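/- Splitting for tensor: let G, A, B be graphs. If G ⅋ (A ⊗ B) is provable in GS, then there exist a context C[·]_R and graphs K_A and K_B such that: there is a GS derivation from C[K_A ⅋ K_B]_R to G; K_A ⅋ A is provable in GS; K_B ⅋ B is provable in GS; and the graph C (that is, C[∅]_R) is provable in GS. -/

import Mathlib

namespace GSP

/-- Atoms: a propositional variable (coded by a natural number) with a polarity. -/
abbrev Atom := ℕ × Bool

/-- The dual atom. -/
def dualAtom (a : Atom) : Atom := (a.1, !a.2)

/-- A finite, simple, undirected graph whose vertices are labelled by atoms. -/
structure LGraph where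
  V : Type
  [fintype : Fintype V]
  adj : V → V → Prop
  symm : ∀ {v w : V}, adj v w → adj w v
  irrefl : ∀ v : V, ¬ adj v v
  label : V → Atom

attribute [instance] LGraph.fintype

namespace LGraph

/-- An isomorphism of labelled graphs: a vertex bijection preserving labels and
preserving and reflecting edges. -/
structure Iso (G H : LGraph) where
  toEquiv : G.V ≃ H.V
  adj_iff : ∀ v w : G.V, G.adj v w ↔ H.adj (toEquiv v) (toEquiv w)
  label_eq : ∀ v : G.V, H.label (toEquiv v) = G.label v

/-- `G ≅ H` : the graphs `G` and `H` are isomorphic. -/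
def iso (G H : LGraph) : Prop := Nonempty (Iso G H)

/-- The empty graph. -/
def empty : LGraph where
  V := Empty
  adj _ _ := False
  symm h := h.elim
  irrefl v := v.elim
  label v := v.elim

/-- The single-vertex graph labelled by the atom `a`. -/
def single (a : Atom) : LGraph where
  V := Unit
  adj _ _ := False
  symm h := h.elim
  irrefl _ h := h
  label _ := a

def parAdj (G H : LGraph) : G.V ⊕ H.V → G.V ⊕ H.V → Prop
  | .inl a, .inl b => G.adj a b
  | .inr a, .inr b => H.adj a b
  | _, _ => False

/-- The par `G ⅋ H` : disjoint union of `G` and `H`. -/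
def par (G H : LGraph) : LGraph where
  V := G.V ⊕ H.V
  adj := parAdj G H
  symm := by
    rintro (a | a) (b | b) h
    · exact G.symm h
    · exact h.elim
    · exact h.elim
    · exact H.symm h
  irrefl := by
    rintro (a | a) h
    · exact G.irrefl a h
    · exact H.irrefl a h
  label := Sum.elim G.label H.label

def tensorAdj (G H : LGraph) : G.V ⊕ H.V → G.V ⊕ H.V → Prop
  | .inl a, .inl b => G.adj a b
  | .inr a, .inr b => H.adj a b
  | .inl _, .inr _ => True
  | .inr _, .inl _ => True

/-- The tensor `G ⊗ H` : join of `G` and `H` (disjoint union plus all edges in between). -/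
def tensor (G H : LGraph) : LGraph where
  V := G.V ⊕ H.V
  adj := tensorAdj G H
  symm := by
    rintro (a | a) (b | b) h
    · exact G.symm h
    · exact trivial
    · exact trivial
    · exact H.symm h
  irrefl := by
    rintro (a | a) h
    · exact G.irrefl a h
    · exact H.irrefl a h
  label := Sum.elim G.label H.label

/-- The dual graph `Ḡ` : same vertices, complemented edges, dualized labels. -/
def dual (G : LGraph) : LGraph where
  V := G.V
  adj v w := v ≠ w ∧ ¬ G.adj v w
  symm h := ⟨fun e => h.1 e.symm, fun h' => h.2 (G.symm h')⟩
  irrefl _ h := h.1 rfl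
  label v := dualAtom (G.label v)

def plugAdj (C : LGraph) (R : Set C.V) (X : LGraph) : C.V ⊕ X.V → C.V ⊕ X.V → Prop
  | .inl a, .inl b => C.adj a b
  | .inr a, .inr b => X.adj a b
  | .inl a, .inr _ => a ∈ R
  | .inr _, .inl b => b ∈ R

/-- `C[X]_R` : the graph obtained from the context `C[·]_R` by inserting the graph `X`
as a module whose vertices are adjacent exactly to the vertices in `R`. -/
def plug (C : LGraph) (R : Set C.V) (X : LGraph) : LGraph where
  V := C.V ⊕ X.V
  adj := plugAdj C R X
  symm := by
    rintro (a | a) (b | b) h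
    · exact C.symm h
    · exact h
    · exact h
    · exact X.symm h
  irrefl := by
    rintro (a | a) h
    · exact C.irrefl a h
    · exact X.irrefl a h
  label := Sum.elim C.label X.label

def compAdj (G : LGraph) (H : G.V → LGraph) :
    (Σ v : G.V, (H v).V) → (Σ v : G.V, (H v).V) → Prop := fun x y =>
  (∃ (v : G.V) (a b : (H v).V), x = ⟨v, a⟩ ∧ y = ⟨v, b⟩ ∧ (H v).adj a b) ∨
    (x.1 ≠ y.1 ∧ G.adj x.1 y.1)

/-- The composition `G⟨H v₁, …, H vₙ⟩` of the family `H` via the graph `G`: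
replace each vertex `v` of `G` by the graph `H v`. -/
def comp (G : LGraph) (H : G.V → LGraph) : LGraph where
  V := Σ v : G.V, (H v).V
  adj := compAdj G H
  symm := by
    rintro x y (⟨v, a, b, hx, hy, hab⟩ | ⟨hne, hadj⟩)
    · exact Or.inl ⟨v, b, a, hy, hx, (H v).symm hab⟩
    · exact Or.inr ⟨hne.symm, G.symm hadj⟩
  irrefl := by
    rintro ⟨v, a⟩ (⟨w, x, y, hx, hy, hxy⟩ | ⟨hne, _⟩)
    · have h := hx.symm.trans hy
      obtain rfl : x = y := by simpa using h
      exact (H w).irrefl x hxy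
    · exact hne rfl
  label x := (H x.1).label x.2

/-- A module of `G` : a set `M` of vertices such that every vertex outside `M`
is adjacent either to all vertices of `M` or to none of them. -/
def IsModule (G : LGraph) (M : Set G.V) : Prop :=
  ∀ v ∉ M, ∀ x ∈ M, ∀ y ∈ M, (G.adj v x ↔ G.adj v y)

/-- A prime graph: at least 2 vertices and only trivial modules. -/
def Prime (G : LGraph) : Prop :=
  2 ≤ Fintype.card G.V ∧
    ∀ M : Set G.V, G.IsModule M → M = ∅ ∨ (∃ v, M = {v}) ∨ M = Set.univ

/-- `G` is `P₄`-free: no four distinct vertices induce a path on 4 vertices. -/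
def P4Free (G : LGraph) : Prop :=
  ¬ ∃ v₁ v₂ v₃ v₄ : G.V,
      v₁ ≠ v₂ ∧ v₁ ≠ v₃ ∧ v₁ ≠ v₄ ∧ v₂ ≠ v₃ ∧ v₂ ≠ v₄ ∧ v₃ ≠ v₄ ∧
      G.adj v₁ v₂ ∧ G.adj v₂ v₃ ∧ G.adj v₃ v₄ ∧
      ¬ G.adj v₁ v₃ ∧ ¬ G.adj v₁ v₄ ∧ ¬ G.adj v₂ v₄

end LGraph

open LGraph

/-- The `n`-fold tensor `X₁ ⊗ ⋯ ⊗ Xₙ`. -/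
def bigTensor : (n : ℕ) → (Fin n → LGraph) → LGraph
  | 0, _ => LGraph.empty
  | n + 1, F => (F 0).tensor (bigTensor n fun i => F i.succ)

/-- The `n`-fold par `X₁ ⅋ ⋯ ⅋ Xₙ`. -/
def bigPar : (n : ℕ) → (Fin n → LGraph) → LGraph
  | 0, _ => LGraph.empty
  | n + 1, F => (F 0).par (bigPar n fun i => F i.succ)

/-- The inference rules of system GS (premise, conclusion). -/
inductive GSRule : LGraph → LGraph → Prop
  /-- ai↓ : premise `∅`, conclusion `ā ⅋ a`. -/
  | ai (a : Atom) : GSRule LGraph.empty ((single (dualAtom a)).par (single a))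
  /-- ss↓ : premise `B[A]_S`, conclusion `B ⅋ A`, for `A ≠ ∅` and `S ≠ ∅`. -/
  | ss (A B : LGraph) (S : Set B.V) :
      Nonempty A.V → S ≠ ∅ → GSRule (B.plug S A) (B.par A)
  /-- p↓ : premise `(M₁ ⅋ N₁) ⊗ ⋯ ⊗ (Mₙ ⅋ Nₙ)`, conclusion `P̄⟨M₁,…,Mₙ⟩ ⅋ P⟨N₁,…,Nₙ⟩`,
  for `P` prime with `n = |V(P)| ≥ 4` and all `Mᵢ ≠ ∅`. -/
  | p (n : ℕ) (P : LGraph) (e : P.V ≃ Fin n) (M N : Fin n → LGraph) :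
      P.Prime → 4 ≤ n → (∀ i, Nonempty (M i).V) →
      GSRule (bigTensor n fun i => (M i).par (N i))
        ((P.dual.comp fun v => M (e v)).par (P.comp fun v => N (e v)))

/-- The "up" rules ai↑, ss↑, p↑ (premise, conclusion). -/
inductive UpRule : LGraph → LGraph → Prop
  /-- ai↑ : premise `a ⊗ ā`, conclusion `∅`. -/
  | ai (a : Atom) : UpRule ((single a).tensor (single (dualAtom a))) LGraph.empty
  /-- ss↑ : premise `B ⊗ A`, conclusion `B[A]_S`, for `A ≠ ∅` and `S ≠ V(B)`. -/
  | ss (A B : LGraph) (S : Set B.V) :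
      Nonempty A.V → S ≠ Set.univ → UpRule (B.tensor A) (B.plug S A)
  /-- p↑ : premise `P⟨M₁,…,Mₙ⟩ ⊗ P̄⟨N₁,…,Nₙ⟩`, conclusion `(M₁ ⊗ N₁) ⅋ ⋯ ⅋ (Mₙ ⊗ Nₙ)`,
  for `P` prime with `n = |V(P)| ≥ 4` and all `Mᵢ ≠ ∅`. -/
  | p (n : ℕ) (P : LGraph) (e : P.V ≃ Fin n) (M N : Fin n → LGraph) :
      P.Prime → 4 ≤ n → (∀ i, Nonempty (M i).V) →
      UpRule ((P.comp fun v => M (e v)).tensor (P.dual.comp fun v => N (e v)))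
        (bigPar n fun i => (M i).tensor (N i))

/-- The rules of system SGS : the rules of GS together with their duals. -/
def SGSRule (G H : LGraph) : Prop := GSRule G H ∨ UpRule G H

/-- A single inference step in a system: inside some context, replace a module
isomorphic to the premise of a rule by the corresponding conclusion. -/
def Step (Rules : LGraph → LGraph → Prop) (G H : LGraph) : Prop :=
  ∃ (C : LGraph) (R : Set C.V) (p c : LGraph),
    Rules p c ∧ G.iso (C.plug R p) ∧ H.iso (C.plug R c)

/-- A derivation in a system from `G` to `H` : a finite sequence of inference steps
and isomorphisms leading from `G` to `H`. -/
def Deriv (Rules : LGraph → LGraph → Prop) (G H : LGraph) : Prop :=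
  Relation.ReflTransGen (fun X Y => X.iso Y ∨ Step Rules X Y) G H

/-- A graph is provable in a system if there is a derivation from `∅` to it. -/
def Provable (Rules : LGraph → LGraph → Prop) (G : LGraph) : Prop :=
  Deriv Rules LGraph.empty G

/-- Formulas: unit, positive and negative atoms, par and tensor. -/
inductive Formula where
  | unit : Formula
  | pos (a : ℕ) : Formula
  | neg (a : ℕ) : Formula
  | par (φ ψ : Formula) : Formula
  | tens (φ ψ : Formula) : Formula

/-- The graph `[φ]` of a formula `φ`. -/
def Formula.graph : Formula → LGraph
  | .unit => LGraph.empty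
  | .pos a => single (a, true)
  | .neg a => single (a, false)
  | .par φ ψ => φ.graph.par ψ.graph
  | .tens φ ψ => φ.graph.tensor ψ.graph

/-- Structural equivalence of formulas: the smallest congruence making `⅋` and `⊗`
associative and commutative with unit `∘`. -/
inductive Formula.equiv : Formula → Formula → Prop
  | refl (φ) : Formula.equiv φ φ
  | symm {φ ψ} : Formula.equiv φ ψ → Formula.equiv ψ φ
  | trans {φ ψ χ} : Formula.equiv φ ψ → Formula.equiv ψ χ → Formula.equiv φ χ
  | parComm (φ ψ) : Formula.equiv (.par φ ψ) (.par ψ φ)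
  | parAssoc (φ ψ χ) : Formula.equiv (.par φ (.par ψ χ)) (.par (.par φ ψ) χ)
  | parUnit (φ) : Formula.equiv (.par φ .unit) φ
  | tensComm (φ ψ) : Formula.equiv (.tens φ ψ) (.tens ψ φ)
  | tensAssoc (φ ψ χ) : Formula.equiv (.tens φ (.tens ψ χ)) (.tens (.tens φ ψ) χ)
  | tensUnit (φ) : Formula.equiv (.tens φ .unit) φ
  | parCongr {φ φ' ψ ψ'} : Formula.equiv φ φ' → Formula.equiv ψ ψ' →
      Formula.equiv (.par φ ψ) (.par φ' ψ')
  | tensCongr {φ φ' ψ ψ'} : Formula.equiv φ φ' → Formula.equiv ψ ψ' →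
      Formula.equiv (.tens φ ψ) (.tens φ' ψ')

/-- A formula is unit-free if it contains no occurrence of the unit `∘`. -/
def Formula.UnitFree : Formula → Prop
  | .unit => False
  | .pos _ => True
  | .neg _ => True
  | .par φ ψ => φ.UnitFree ∧ ψ.UnitFree
  | .tens φ ψ => φ.UnitFree ∧ ψ.UnitFree

/-- The sequent calculus MLL° (multiplicative linear logic with mix) on multisets
of formulas. -/
inductive MLL : Multiset Formula → Prop
  | ax (a : ℕ) : MLL {Formula.pos a, Formula.neg a}
  | tens {Γ Δ : Multiset Formula} (φ ψ : Formula) :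
      MLL (φ ::ₘ Γ) → MLL (ψ ::ₘ Δ) → MLL (Formula.tens φ ψ ::ₘ (Γ + Δ))
  | par {Γ : Multiset Formula} (φ ψ : Formula) :
      MLL (φ ::ₘ ψ ::ₘ Γ) → MLL (Formula.par φ ψ ::ₘ Γ)
  | mix {Γ Δ : Multiset Formula} : MLL Γ → MLL Δ → MLL (Γ + Δ)

section
/-- Graphs living on subsets of a fixed universe `α`. -/
structure SG (α : Type) where
  V : Set α
  adj : α → α → Prop
  symm : ∀ {x y : α}, adj x y → adj y x
  irrefl : ∀ x : α, ¬ adj x x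
  mem : ∀ {x y : α}, adj x y → x ∈ V

namespace SG

variable {α : Type}

theorem ext' {G H : SG α} (h1 : ∀ x, x ∈ G.V ↔ x ∈ H.V)
    (h2 : ∀ x y, G.adj x y ↔ H.adj x y) : G = H := by
  obtain ⟨V, adj, _, _, _⟩ := G
  obtain ⟨V', adj', _, _, _⟩ := H
  have e1 : V = V' := Set.ext h1
  have e2 : adj = adj' := by
    funext x y
    exact propext (h2 x y)
  subst e1 e2
  rfl

theorem mem' (G : SG α) {x y : α} (h : G.adj x y) : y ∈ G.V := G.mem (G.symm h)

def emp : SG α where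
  V := ∅
  adj _ _ := False
  symm h := h
  irrefl _ h := h
  mem h := h.elim

def pair (a b : α) : SG α where
  V := {x | x = a ∨ x = b}
  adj _ _ := False
  symm h := h
  irrefl _ h := h
  mem h := h.elim

def ind (G : SG α) (S : Set α) : SG α where
  V := {x | x ∈ G.V ∧ x ∈ S}
  adj x y := G.adj x y ∧ x ∈ S ∧ y ∈ S
  symm h := ⟨G.symm h.1, h.2.2, h.2.1⟩
  irrefl x h := G.irrefl x h.1
  mem h := ⟨G.mem h.1, h.2.1⟩

def par (G H : SG α) : SG α where
  V := {x | x ∈ G.V ∨ x ∈ H.V}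
  adj x y := G.adj x y ∨ H.adj x y
  symm h := h.imp G.symm H.symm
  irrefl x h := h.elim (G.irrefl x) (H.irrefl x)
  mem h := h.imp G.mem H.mem

def plug (C : SG α) (R : Set α) (X : SG α) : SG α where
  V := {x | x ∈ C.V ∨ x ∈ X.V}
  adj x y := C.adj x y ∨ X.adj x y ∨ (x ∈ C.V ∧ x ∈ R ∧ y ∈ X.V ∧ y ∉ C.V) ∨
    (y ∈ C.V ∧ y ∈ R ∧ x ∈ X.V ∧ x ∉ C.V)
  symm := by
    intro x y h
    rcases h with h | h | h | h
    · exact Or.inl (C.symm h)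
    · exact Or.inr (Or.inl (X.symm h))
    · exact Or.inr (Or.inr (Or.inr h))
    · exact Or.inr (Or.inr (Or.inl h))
  irrefl := by
    intro x h
    rcases h with h | h | h | h
    · exact C.irrefl x h
    · exact X.irrefl x h
    · exact h.2.2.2 h.1
    · exact h.2.2.2 h.1
  mem := by
    intro x y h
    rcases h with h | h | h | h
    · exact Or.inl (C.mem h)
    · exact Or.inr (X.mem h)
    · exact Or.inl h.1
    · exact Or.inr h.2.2.1

/-- The premise of the rule `p↓`. -/
def pprem (X Y : SG α) (h : α → α) : SG α where
  V := {x | x ∈ X.V ∨ x ∈ Y.V}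
  adj x y := X.adj x y ∨ Y.adj x y ∨
    (h x ≠ h y ∧ (x ∈ X.V ∨ x ∈ Y.V) ∧ (y ∈ X.V ∨ y ∈ Y.V))
  symm := by
    intro x y hh
    rcases hh with hh | hh | hh
    · exact Or.inl (X.symm hh)
    · exact Or.inr (Or.inl (Y.symm hh))
    · exact Or.inr (Or.inr ⟨hh.1.symm, hh.2.2, hh.2.1⟩)
  irrefl := by
    intro x hh
    rcases hh with hh | hh | hh
    · exact X.irrefl x hh
    · exact Y.irrefl x hh
    · exact hh.1 rfl
  mem := by
    intro x y hh
    rcases hh with hh | hh | hh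
    · exact Or.inl (X.mem hh)
    · exact Or.inr (Y.mem hh)
    · exact hh.2.1

/-- The complement graph. -/
def compl (G : SG α) : SG α where
  V := G.V
  adj x y := x ≠ y ∧ x ∈ G.V ∧ y ∈ G.V ∧ ¬ G.adj x y
  symm h := ⟨h.1.symm, h.2.2.1, h.2.1, fun h' => h.2.2.2 (G.symm h')⟩
  irrefl _ h := h.1 rfl
  mem h := h.2.1

theorem mem_emp (x : α) : x ∈ (emp : SG α).V ↔ False := Iff.rfl
theorem adj_emp (x y : α) : (emp : SG α).adj x y ↔ False := Iff.rfl
theorem mem_pair (a b x : α) : x ∈ (pair a b).V ↔ (x = a ∨ x = b) := Iff.rfl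
theorem adj_pair (a b x y : α) : (pair a b).adj x y ↔ False := Iff.rfl
theorem mem_ind (G : SG α) (S : Set α) (x : α) : x ∈ (G.ind S).V ↔ x ∈ G.V ∧ x ∈ S := Iff.rfl
theorem adj_ind (G : SG α) (S : Set α) (x y : α) :
    (G.ind S).adj x y ↔ G.adj x y ∧ x ∈ S ∧ y ∈ S := Iff.rfl
theorem mem_par (G H : SG α) (x : α) : x ∈ (G.par H).V ↔ x ∈ G.V ∨ x ∈ H.V := Iff.rfl
theorem adj_par (G H : SG α) (x y : α) : (G.par H).adj x y ↔ G.adj x y ∨ H.adj x y := Iff.rfl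
theorem mem_plug (C : SG α) (R : Set α) (X : SG α) (x : α) :
    x ∈ (C.plug R X).V ↔ x ∈ C.V ∨ x ∈ X.V := Iff.rfl
theorem adj_plug (C : SG α) (R : Set α) (X : SG α) (x y : α) :
    (C.plug R X).adj x y ↔ C.adj x y ∨ X.adj x y ∨ (x ∈ C.V ∧ x ∈ R ∧ y ∈ X.V ∧ y ∉ C.V) ∨
    (y ∈ C.V ∧ y ∈ R ∧ x ∈ X.V ∧ x ∉ C.V) := Iff.rfl
theorem mem_pprem (X Y : SG α) (h : α → α) (x : α) :
    x ∈ (pprem X Y h).V ↔ x ∈ X.V ∨ x ∈ Y.V := Iff.rfl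
theorem adj_pprem (X Y : SG α) (h : α → α) (x y : α) :
    (pprem X Y h).adj x y ↔ X.adj x y ∨ Y.adj x y ∨
    (h x ≠ h y ∧ (x ∈ X.V ∨ x ∈ Y.V) ∧ (y ∈ X.V ∨ y ∈ Y.V)) := Iff.rfl
theorem mem_compl (G : SG α) (x : α) : x ∈ G.compl.V ↔ x ∈ G.V := Iff.rfl
theorem adj_compl (G : SG α) (x y : α) :
    G.compl.adj x y ↔ (x ≠ y ∧ x ∈ G.V ∧ y ∈ G.V ∧ ¬ G.adj x y) := Iff.rfl

/-- Disjointness of vertex sets. -/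
def Dj (G H : SG α) : Prop := ∀ x, x ∈ G.V → x ∉ H.V

theorem Dj.symm {G H : SG α} (h : Dj G H) : Dj H G := fun x hx hx' => h x hx' hx

/-- Modules (assumed to be sets of vertices, possibly with junk outside). -/
def Mod (G : SG α) (M : Set α) : Prop :=
  ∀ v, v ∈ G.V → v ∉ M → ∀ x, x ∈ G.V → x ∈ M → ∀ y, y ∈ G.V → y ∈ M → G.adj v x → G.adj v y

/-- Prime graphs. -/
def Pri (G : SG α) : Prop :=
  ∀ M : Set α, (∀ x ∈ M, x ∈ G.V) → G.Mod M →
    (∀ x, x ∉ M) ∨ (∃ v, ∀ x ∈ M, x = v) ∨ (∀ x ∈ G.V, x ∈ M)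

def Cm (Y Q : SG α) (h : α → α) : Prop :=
  ∀ x y, x ∈ Y.V → y ∈ Y.V → h x ≠ h y → (Y.adj x y ↔ Q.adj (h x) (h y))

def CoC (X Q : SG α) (h : α → α) : Prop :=
  ∀ x y, x ∈ X.V → y ∈ X.V → h x ≠ h y → (X.adj x y ↔ ¬ Q.adj (h x) (h y))

/-- The rules of GS inside the universe. -/
inductive Rule (lab : α → Atom) : SG α → SG α → Prop
  | ai (x y : α) : x ≠ y → lab x = dualAtom (lab y) → Rule lab emp (pair x y)
  | ss (A B : SG α) (S : Set α) : Dj B A → (∃ a, a ∈ A.V) → (∃ b, b ∈ B.V ∧ b ∈ S) →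
      Rule lab (plug B S A) (par B A)
  | p (P X Y : SG α) (h : α → α) : P.Pri → 4 ≤ P.V.ncard → Dj X Y →
      (∀ x, x ∈ X.V → h x ∈ P.V) → (∀ x, x ∈ Y.V → h x ∈ P.V) →
      (∀ i, i ∈ P.V → ∃ x, x ∈ X.V ∧ h x = i) → CoC X P h → Cm Y P h →
      Rule lab (pprem X Y h) (par X Y)

def Stp (lab : α → Atom) (H' H : SG α) : Prop :=
  ∃ (C : SG α) (R : Set α) (p c : SG α), Rule lab p c ∧ Dj C c ∧
    H' = C.plug R p ∧ H = C.plug R c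

def Drv (lab : α → Atom) : SG α → SG α → Prop := Relation.ReflTransGen (Stp lab)

def Prov (lab : α → Atom) (H : SG α) : Prop := Drv lab emp H

variable {lab : α → Atom}

theorem Rule.sub {p c : SG α} (h : Rule lab p c) : ∀ x, x ∈ p.V → x ∈ c.V := by
  cases h <;> intro x hx <;> simp only [mem_emp, mem_plug, mem_par, mem_pprem] at * <;> tauto

theorem Stp.sub {p c : SG α} (h : Stp lab p c) : ∀ x, x ∈ p.V → x ∈ c.V := by
  obtain ⟨C, R, p, c, hr, _, rfl, rfl⟩ := h
  intro x hx
  have := hr.sub x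
  simp only [mem_plug] at *
  tauto

theorem Drv.sub {p c : SG α} (h : Drv lab p c) : ∀ x, x ∈ p.V → x ∈ c.V := by
  induction h with
  | refl => exact fun _ h => h
  | tail _ h2 ih => exact fun x hx => h2.sub x (ih x hx)

theorem Drv.refl (G : SG α) : Drv lab G G := Relation.ReflTransGen.refl
theorem Drv.trans {G H K : SG α} (h : Drv lab G H) (h' : Drv lab H K) : Drv lab G K :=
  Relation.ReflTransGen.trans h h'
theorem Drv.of_eq {G H : SG α} (h : G = H) : Drv lab G H := h ▸ Drv.refl G

theorem plug_emp (C : SG α) (R : Set α) : C.plug R emp = C := by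
  apply ext' <;> simp only [mem_plug, adj_plug, mem_emp, adj_emp] <;> tauto

theorem emp_plug (R : Set α) (X : SG α) : emp.plug R X = X := by
  apply ext' <;> simp only [mem_plug, adj_plug, mem_emp, adj_emp] <;> tauto

theorem plug_par (C X : SG α) : C.plug ∅ X = C.par X := by
  apply ext' <;> simp only [mem_plug, adj_plug, mem_par, adj_par, Set.mem_empty_iff_false] <;> tauto

theorem plug_assoc {C D X : SG α} {R R' : Set α} (h1 : Dj C D) (h2 : Dj C X) (h3 : Dj D X) :
    C.plug R (D.plug R' X) = (C.plug R D).plug {x | (x ∈ C.V ∧ x ∈ R) ∨ (x ∈ D.V ∧ x ∈ R')} X := by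
  unfold Dj at *
  apply ext' <;> simp only [mem_plug, adj_plug, Set.mem_ofPred_eq]
  · tauto
  · intro x y
    grind

theorem Stp.rule {p c : SG α} (h : Rule lab p c) : Stp lab p c :=
  ⟨emp, ∅, p, c, h, fun _ h => h.elim, (emp_plug _ _).symm, (emp_plug _ _).symm⟩

theorem Drv.rule {p c : SG α} (h : Rule lab p c) : Drv lab p c :=
  Relation.ReflTransGen.single (Stp.rule h)

theorem Stp.ctx {X X' C : SG α} (R : Set α) (h : Stp lab X X') (hd : Dj C X') :
    Stp lab (C.plug R X) (C.plug R X') := by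
  obtain ⟨D, R', p, c, hr, hd', rfl, rfl⟩ := h
  have h1 : Dj C D := fun x hx hx' => hd x hx (Or.inl hx')
  have h2 : Dj C c := fun x hx hx' => hd x hx (Or.inr hx')
  refine ⟨_, _, p, c, hr, ?_, plug_assoc h1 (fun x hx hx' => h2 x hx (hr.sub x hx'))
    (fun x hx hx' => hd' x hx (hr.sub x hx')), plug_assoc h1 h2 hd'⟩
  intro x hx hx'
  rcases hx with hx | hx
  · exact h2 x hx hx'
  · exact hd' x hx hx'

theorem Drv.ctx {X X' C : SG α} (R : Set α) (h : Drv lab X X') (hd : Dj C X') :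
    Drv lab (C.plug R X) (C.plug R X') := by
  induction h with
  | refl => exact Drv.refl _
  | tail _ h2 ih =>
    exact (ih fun x hx hx' => hd x hx (h2.sub x hx')).tail (h2.ctx R hd)

theorem Prov.drv {X Y : SG α} (h : Prov lab X) (h' : Drv lab X Y) : Prov lab Y := Drv.trans h h'

theorem Prov.emp : Prov lab (emp : SG α) := Drv.refl _

theorem Prov.insert {C X : SG α} (R : Set α) (h : Prov lab X) (hd : Dj C X) :
    Drv lab C (C.plug R X) := by
  have := Drv.ctx (C := C) R h hd
  rwa [plug_emp] at this

theorem Prov.plug {C X : SG α} (R : Set α) (h : Prov lab X) (hC : Prov lab C) (hd : Dj C X) :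
    Prov lab (C.plug R X) := hC.drv (h.insert R hd)

/-- A graph with a module is a plugged context. -/
theorem plug_of_mod {T : SG α} {M : Set α} (h : T.Mod M) :
    (T.ind {x | x ∉ M}).plug {x | ∃ m, m ∈ M ∧ T.adj x m} (T.ind M) = T := by
  apply ext' <;> simp only [mem_plug, adj_plug, mem_ind, adj_ind, Set.mem_ofPred_eq]
  · intro x; tauto
  · intro x y
    constructor
    · rintro (hh | hh | ⟨⟨hx, hx'⟩, ⟨m, hm, hxm⟩, ⟨hy, hy'⟩, _⟩ | ⟨⟨hx, hx'⟩, ⟨m, hm, hxm⟩, ⟨hy, hy'⟩, _⟩)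
      · exact hh.1
      · exact hh.1
      · exact h x hx hx' m (T.mem' hxm) hm y hy hy' hxm
      · exact T.symm (h y hx hx' m (T.mem' hxm) hm x hy hy' hxm)
    · intro hh
      have h1 := T.mem hh
      have h2 := T.mem' hh
      by_cases hx : x ∈ M <;> by_cases hy : y ∈ M
      · tauto
      · exact Or.inr (Or.inr (Or.inr ⟨⟨h2, hy⟩, ⟨x, hx, T.symm hh⟩, ⟨h1, hx⟩, fun h => h.2 hx⟩))
      · exact Or.inr (Or.inr (Or.inl ⟨⟨h1, hx⟩, ⟨y, hy, hh⟩, ⟨h2, hy⟩, fun h => h.2 hy⟩))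
      · tauto

theorem Prov.insMod {T : SG α} {M : Set α} (h : T.Mod M) (hp : Prov lab (T.ind M)) :
    Drv lab (T.ind {x | x ∉ M}) T := by
  have := hp.insert (C := T.ind {x | x ∉ M}) {x | ∃ m, m ∈ M ∧ T.adj x m}
    (fun x hx hx' => hx.2 hx'.2)
  rwa [plug_of_mod h] at this

/-- Replace a module. -/
theorem Drv.mod {T : SG α} {M : Set α} {X : SG α} (h : T.Mod M) (hX : Drv lab X (T.ind M)) :
    Drv lab ((T.ind {x | x ∉ M}).plug {x | ∃ m, m ∈ M ∧ T.adj x m} X) T := by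
  have := hX.ctx (C := T.ind {x | x ∉ M}) {x | ∃ m, m ∈ M ∧ T.adj x m}
    (fun x hx hx' => hx.2 hx'.2)
  rwa [plug_of_mod h] at this

/-- `ss` at top level, without side conditions. -/
theorem ssPlug (C X : SG α) (R : Set α) (h : Dj C X) : Drv lab (C.plug R X) (C.par X) := by
  by_cases h1 : ∃ a, a ∈ X.V
  · by_cases h2 : ∃ b, b ∈ C.V ∧ b ∈ R
    · exact Drv.rule (Rule.ss X C R h h1 h2)
    · apply Drv.of_eq
      push Not at h2
      apply ext' <;> simp only [mem_plug, adj_plug, mem_par, adj_par]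
      · tauto
      · intro x y
        have := h2 x; have := h2 y
        tauto
  · apply Drv.of_eq
    push Not at h1
    apply ext' <;> simp only [mem_plug, adj_plug, mem_par, adj_par]
    · tauto
    · intro x y
      have := h1 x; have := h1 y
      tauto

theorem ssOut {T : SG α} {M : Set α} (h : T.Mod M) :
    Drv lab T ((T.ind {x | x ∉ M}).par (T.ind M)) := by
  have := ssPlug (lab := lab) (T.ind {x | x ∉ M}) (T.ind M) {x | ∃ m, m ∈ M ∧ T.adj x m}
    (fun x hx hx' => hx.2 hx'.2)
  rwa [plug_of_mod h] at this

theorem par_comm (G H : SG α) : G.par H = H.par G := by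
  apply ext' <;> simp only [mem_par, adj_par] <;> tauto

theorem par_assoc (G H K : SG α) : (G.par H).par K = G.par (H.par K) := by
  apply ext' <;> simp only [mem_par, adj_par] <;> tauto

theorem par_emp (G : SG α) : G.par emp = G := by
  apply ext' <;> simp only [mem_par, adj_par, mem_emp, adj_emp] <;> tauto

theorem emp_par (G : SG α) : emp.par G = G := by
  apply ext' <;> simp only [mem_par, adj_par, mem_emp, adj_emp] <;> tauto

theorem Drv.parR {X X' : SG α} (h : Drv lab X X') (C : SG α) (hd : Dj C X') :
    Drv lab (C.par X) (C.par X') := by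
  have := h.ctx (C := C) ∅ hd
  rwa [plug_par, plug_par] at this

theorem Drv.parL {X X' : SG α} (h : Drv lab X X') (C : SG α) (hd : Dj C X') :
    Drv lab (X.par C) (X'.par C) := by
  rw [par_comm X, par_comm X']
  exact h.parR C hd

/-- `K` reduces `G`: inside a provable context, `K` derives `G`. -/
def Red (lab : α → Atom) (K G : SG α) : Prop :=
  ∃ (C : SG α) (R : Set α), Dj C K ∧ Prov lab C ∧ Drv lab (C.plug R K) G

theorem Red.sub {K G : SG α} (h : Red lab K G) : ∀ x, x ∈ K.V → x ∈ G.V := by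
  obtain ⟨C, R, _, _, h⟩ := h
  exact fun x hx => h.sub x (Or.inr hx)

theorem Drv.red {K G : SG α} (h : Drv lab K G) : Red lab K G :=
  ⟨SG.emp, ∅, fun _ h => h.elim, Prov.emp, by rwa [emp_plug]⟩

theorem Red.refl (G : SG α) : Red lab G G := (Drv.refl G).red

theorem Red.trans {K G H : SG α} (h : Red lab K G) (h' : Red lab G H) : Red lab K H := by
  obtain ⟨C, R, hd, hp, hh⟩ := h
  obtain ⟨C', R', hd', hp', hh'⟩ := h'
  have hs := hh.sub
  have e1 : Dj C' C := fun x hx hx' => hd' x hx (hs x (Or.inl hx'))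
  have e2 : Dj C' K := fun x hx hx' => hd' x hx (hs x (Or.inr hx'))
  refine ⟨C'.plug R' C, {x | (x ∈ C'.V ∧ x ∈ R') ∨ (x ∈ C.V ∧ x ∈ R)}, ?_, hp.plug R' hp' e1, ?_⟩
  · rintro x (hx | hx) hx'
    · exact e2 x hx hx'
    · exact hd x hx hx'
  · rw [← plug_assoc e1 e2 hd]
    exact (hh.ctx R' hd').trans hh'

theorem Red.ctx {C K : SG α} (R : Set α) (hp : Prov lab C) (hd : Dj C K) : Red lab K (C.plug R K) :=
  ⟨C, R, hd, hp, Drv.refl _⟩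

theorem plug_par_mod (C K X : SG α) (R : Set α) (h1 : Dj C K) (h2 : Dj C X) (h3 : Dj K X) :
    Drv lab (C.plug R (K.par X)) ((C.plug R K).par X) := by
  have e : C.plug R (K.par X) = (C.plug R K).plug {x | x ∈ C.V ∧ x ∈ R} X := by
    unfold Dj at *
    apply ext' <;> simp only [mem_plug, adj_plug, mem_par, adj_par, Set.mem_ofPred_eq]
    · tauto
    · intro x y
      grind
  rw [e]
  apply ssPlug
  rintro x (hx | hx) hx'
  · exact h2 x hx hx'
  · exact h3 x hx hx'

theorem Red.par {K G : SG α} (h : Red lab K G) (X : SG α) (hd : Dj G X) :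
    Red lab (K.par X) (G.par X) := by
  obtain ⟨C, R, hd', hp, hh⟩ := h
  have hs := hh.sub
  have e1 : Dj C X := fun x hx hx' => hd x (hs x (Or.inl hx)) hx'
  have e2 : Dj K X := fun x hx hx' => hd x (hs x (Or.inr hx)) hx'
  refine ⟨C, R, ?_, hp, (plug_par_mod C K X R hd' e1 e2).trans (hh.parL X hd.symm)⟩
  rintro x hx (hx' | hx')
  · exact hd' x hx hx'
  · exact e1 x hx hx'

theorem Red.par' {K G : SG α} (h : Red lab K G) (X : SG α) (hd : Dj G X) :
    Red lab (X.par K) (X.par G) := by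
  rw [par_comm X, par_comm X]
  exact h.par X hd

end SG
end

section
namespace SG

variable {α : Type} {lab : α → Atom}

attribute [grind =] mem_emp adj_emp mem_pair adj_pair mem_ind adj_ind mem_par adj_par mem_plug
  adj_plug mem_pprem adj_pprem mem_compl adj_compl
attribute [grind →] SG.mem SG.mem'

theorem mergeIns {T KX : SG α} {M : Set α} (hM : T.Mod M) (hd : Dj KX T)
    (hp : Prov lab (KX.par (T.ind M))) : Drv lab (T.ind {x | x ∉ M}) (KX.par T) := by
  unfold Dj at hd
  have h1 := hp.insert (C := T.ind {x | x ∉ M}) {x | ∃ m, m ∈ M ∧ T.adj x m}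
    (by intro x; grind)
  refine h1.trans ?_
  rw [par_comm KX (T.ind M)]
  refine (plug_par_mod _ _ _ _ ?_ ?_ ?_).trans ?_
  · intro x; grind
  · intro x; grind
  · intro x; grind
  · rw [plug_of_mod hM, par_comm]
    exact Drv.refl _

theorem mergeCtx {T KX KY : SG α} {M : Set α} (hM : T.Mod M) (hd : Dj KX T) (hd2 : Dj KY T)
    (hd3 : Dj KX KY)
    (hp : Prov lab (KY.par (T.ind {x | x ∉ M}))) :
    Red lab (KX.par (T.ind M)) ((KX.par KY).par T) := by
  unfold Dj at hd hd2 hd3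
  have h1 := Red.ctx (K := KX.par (T.ind M)) {x | ∃ m, m ∈ M ∧ T.adj x m} hp
    (by intro x; grind)
  refine h1.trans ?_
  rw [par_comm KX (T.ind M)]
  refine Drv.red ((plug_par_mod _ _ _ _ ?_ ?_ ?_).trans (Drv.of_eq ?_))
  · intro x; grind
  · intro x; grind
  · intro x; grind
  · have e : (KY.par (T.ind {x | x ∉ M})).plug {x | ∃ m, m ∈ M ∧ T.adj x m} (T.ind M) =
      KY.par T := by
      have key := plug_of_mod hM
      have hR : ∀ x, x ∈ {x | ∃ m, m ∈ M ∧ T.adj x m} → x ∈ T.V := by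
        rintro x ⟨m, _, hm⟩
        exact T.mem hm
      generalize {x | ∃ m, m ∈ M ∧ T.adj x m} = R at *
      have k1 : ∀ x y, ((T.ind {x | x ∉ M}).plug R (T.ind M)).adj x y ↔ T.adj x y := by
        rw [key]
        exact fun _ _ => Iff.rfl
      apply ext' <;> intro x <;> grind
    rw [e, par_comm, par_assoc]

/-- Merging two provable pieces of a graph along a module. -/
theorem provMerge {T KX KY : SG α} {M : Set α} (hM : T.Mod M) (hd : Dj KX T) (hd2 : Dj KY T)
    (hd3 : Dj KX KY) (hp : Prov lab (KX.par (T.ind M)))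
    (hp2 : Prov lab (KY.par (T.ind {x | x ∉ M}))) :
    Prov lab ((KX.par KY).par T) := by
  have h1 := (mergeIns hM hd hp).parR KY (by
    unfold Dj at *; intro x; grind)
  have := hp2.drv h1
  rwa [← par_assoc, par_comm KY KX] at this

theorem insMany [Finite α] (t : α → α) (J : Set α) : ∀ (T : SG α),
    (∀ j ∈ J, T.Mod {x | t x = j}) → (∀ j ∈ J, Prov lab (T.ind {x | t x = j})) →
    Drv lab (T.ind {x | t x ∉ J}) T := by
  induction J, J.toFinite using Set.Finite.induction_on with
  | empty =>
    intro T _ _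
    apply Drv.of_eq
    apply ext' <;> grind -funext -ext
  | @insert j J hj _ ih =>
    intro T h1 h2
    have e1 := ih (T.ind {x | t x ≠ j}) (by
      intro i hi
      have := h1 i (by grind)
      unfold Mod at *
      grind) (by
      intro i hi
      have := h2 i (by grind)
      have e : (T.ind {x | t x ≠ j}).ind {x | t x = i} = T.ind {x | t x = i} := by
        apply ext' <;> grind -funext -ext
      rwa [e])
    have e2 : (T.ind {x | t x ≠ j}).ind {x | t x ∉ J} = T.ind {x | t x ∉ insert j J} := by
      apply ext' <;> intro x <;> simp only [mem_ind, adj_ind, Set.mem_ofPred_eq, Set.mem_insert_iff, not_or, ne_eq]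
      · tauto
      · intro y
        tauto
    rw [e2] at e1
    refine e1.trans ?_
    exact (h2 j (by grind)).insMod (h1 j (by grind))

theorem Pri.ne3 {Q : SG α} (h : Q.Pri) : Q.V.ncard ≠ 3 := by
  intro h3
  obtain ⟨a, b, c, hab, hac, hbc, hV⟩ := Set.ncard_eq_three.1 h3
  have hs := fun x y => Q.symm (x := x) (y := y)
  have key : ∀ a b c : α, a ≠ b → a ≠ c → b ≠ c → Q.V = {a, b, c} → ¬ (Q.adj a b ↔ Q.adj a c) := by
    intro a b c hab hac hbc hV he
    rcases h {b, c} (by grind) (by unfold Mod; grind) with h | ⟨v, h⟩ | h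
    · grind
    · grind
    · grind
  have k1 := key a b c hab hac hbc hV
  have k2 := key b a c hab.symm hbc hac (by grind)
  have k3 := key c a b hac.symm hbc.symm hab (by grind)
  grind

theorem Pri.compl {Q : SG α} (h : Q.Pri) : Q.compl.Pri := by
  intro M hM hm
  refine h M hM ?_
  unfold Mod at *
  have hs := fun x y => Q.symm (x := x) (y := y)
  grind

theorem two_aux {Q X Y : SG α} {h : α → α} {i j : α} (hd : Dj X Y)
    (hX : ∀ x, x ∈ X.V → h x = i ∨ h x = j) (hY : ∀ x, x ∈ Y.V → h x = i ∨ h x = j)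
    (hij : i ≠ j) (hQ : Q.adj i j) (cX : CoC X Q h) (cY : Cm Y Q h)
    (hp : Prov lab ((X.par Y).ind {x | h x = i})) :
    Drv lab ((X.par Y).ind {x | h x = j}) (X.par Y) := by
  unfold Dj at hd
  unfold CoC at cX
  unfold Cm at cY
  have hQ' := Q.symm hQ
  have h1 := hp.insert (C := (X.par Y).ind {x | h x = j}) Set.univ (by intro x; grind)
  refine h1.trans ?_
  set W := ((X.par Y).ind {x | h x = j}).plug Set.univ ((X.par Y).ind {x | h x = i}) with hW
  have WV : ∀ x, x ∈ W.V ↔ x ∈ X.V ∨ x ∈ Y.V := by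
    intro x
    rw [hW]
    grind
  have WA : ∀ x y, W.adj x y ↔ ((h x ≠ h y ∧ x ∈ W.V ∧ y ∈ W.V) ∨
      (h x = h y ∧ (X.adj x y ∨ Y.adj x y))) := by
    intro x y
    rw [WV, WV]
    have a1 := hX x
    have a2 := hX y
    have a3 := hY x
    have a4 := hY y
    have a5 := cX x y
    have a6 := cY x y
    have a7 := hd x
    have a8 := hd y
    have b1 := fun h => X.mem (x := x) (y := y) h
    have b2 := fun h => X.mem' (x := x) (y := y) h
    have b3 := fun h => Y.mem (x := x) (y := y) h
    have b4 := fun h => Y.mem' (x := x) (y := y) h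
    clear hp h1 WV cX cY hX hY hd
    simp only [hW, adj_plug, mem_ind, adj_ind, mem_par, adj_par, Set.mem_ofPred_eq, Set.mem_univ]
    clear hW
    clear W
    grind -funext -ext
  clear_value W
  have m1 : W.Mod {x | x ∈ X.V ∧ h x = i} := by
    unfold Mod
    grind
  refine (ssOut m1).trans ?_
  have m2 : (W.ind {x | x ∉ {x | x ∈ X.V ∧ h x = i}}).Mod {x | x ∈ X.V ∧ h x = j} := by
    unfold Mod
    grind
  have h2 := (ssOut (lab := lab) m2).parL (W.ind {x | x ∈ X.V ∧ h x = i}) (by intro x; grind)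
  refine h2.trans (Drv.of_eq ?_)
  apply ext' <;> grind -funext -ext

theorem p_aux [Finite α] {Q X Y : SG α} {h : α → α} {j : α} (hd : Dj X Y) (hQ : Q.Pri)
    (h4 : 4 ≤ Q.V.ncard)
    (hX : ∀ x, x ∈ X.V → h x ∈ Q.V) (hY : ∀ x, x ∈ Y.V → h x ∈ Q.V)
    (hXs : ∀ i, i ∈ Q.V → ∃ x, x ∈ X.V ∧ h x = i) (cX : CoC X Q h) (cY : Cm Y Q h)
    (hp : ∀ i, i ∈ Q.V → i ≠ j → Prov lab ((X.par Y).ind {x | h x = i})) :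
    Drv lab ((X.par Y).ind {x | h x = j}) (X.par Y) := by
  refine Drv.trans ?_ (Drv.rule (Rule.p Q X Y h hQ h4 hd hX hY hXs cX cY))
  have := insMany (lab := lab) h {i | i ∈ Q.V ∧ i ≠ j} (pprem X Y h) (by
    intro i hi
    unfold Mod
    grind) (by
    intro i hi
    have e : (pprem X Y h).ind {x | h x = i} = (X.par Y).ind {x | h x = i} := by
      apply ext' <;> grind -funext -ext
    rw [e]
    exact hp i hi.1 hi.2)
  refine Drv.trans (Drv.of_eq ?_) this
  apply ext' <;> grind -funext -ext

theorem compl_coc {Q X : SG α} {h : α → α} (hX : ∀ x, x ∈ X.V → h x ∈ Q.V) (c : Cm X Q h) :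
    CoC X Q.compl h := by
  unfold Cm at c
  unfold CoC
  grind

theorem compl_cm {Q X : SG α} {h : α → α} (hX : ∀ x, x ∈ X.V → h x ∈ Q.V) (c : CoC X Q h) :
    Cm X Q.compl h := by
  unfold CoC at c
  unfold Cm
  grind

theorem card_ind_lt [Finite α] {Q : SG α} {S : Set α} {x : α} (h : x ∈ Q.V) (hx : x ∉ S) :
    (Q.ind S).V.ncard < Q.V.ncard := by
  apply Set.ncard_lt_ncard _ Q.V.toFinite
  constructor
  · intro y hy; exact hy.1
  · intro h'; exact hx (h' h).2

set_option maxHeartbeats 4000000 in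
theorem genp_aux [Finite α] : ∀ (n : ℕ) (Q X Y : SG α) (h : α → α) (j : α), Q.V.ncard ≤ n →
    Dj X Y → (∀ x, x ∈ X.V → h x ∈ Q.V) → (∀ x, x ∈ Y.V → h x ∈ Q.V) →
    CoC X Q h → Cm Y Q h → j ∈ Q.V →
    (∀ i, i ∈ Q.V → i ≠ j → Prov lab ((X.par Y).ind {x | h x = i})) →
    Drv lab ((X.par Y).ind {x | h x = j}) (X.par Y) := by
  intro n
  induction n with
  | zero =>
    intro Q X Y h j hn _ _ _ _ _ hj
    have : 0 < Q.V.ncard := (Set.ncard_pos Q.V.toFinite).2 ⟨j, hj⟩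
    omega
  | succ n ih =>
    intro Q X Y h j hn hd hX hY cX cY hj hp
    by_cases hone : ∀ i, i ∈ Q.V → i = j
    · apply Drv.of_eq
      apply ext' <;> grind -funext -ext
    push Not at hone
    obtain ⟨i0, hi0, hi0j⟩ := hone
    have cX' := cX
    have cY' := cY
    have hd' := hd
    unfold CoC at cX
    unfold Cm at cY
    unfold Dj at hd
    -- deletion of an index
    have del : ∀ i, i ∈ Q.V → i ≠ j → ((∀ x, x ∈ X.V → h x ≠ i) ∨ (∀ x, x ∈ Y.V → h x ≠ i)) →
        Drv lab ((X.par Y).ind {x | h x = j}) (X.par Y) := by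
      intro i hi hij hE
      have hlt : (Q.ind {x | x ≠ i}).V.ncard < Q.V.ncard := card_ind_lt hi (by simp)
      have := ih (Q.ind {x | x ≠ i}) (X.ind {x | h x ≠ i}) (Y.ind {x | h x ≠ i}) h j (by omega)
        (by intro x; grind) (by grind) (by grind) (by unfold CoC; grind) (by unfold Cm; grind)
        (by grind) (by
          intro k hk hkj
          have e : ((X.ind {x | h x ≠ i}).par (Y.ind {x | h x ≠ i})).ind {x | h x = k} =
              (X.par Y).ind {x | h x = k} := by
            apply ext' <;> grind -funext -ext
          rw [e]
          exact hp k hk.1 hkj)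
      have e : ((X.ind {x | h x ≠ i}).par (Y.ind {x | h x ≠ i})).ind {x | h x = j} =
              (X.par Y).ind {x | h x = j} := by
            apply ext' <;> grind -funext -ext
      rw [e] at this
      refine this.trans ?_
      have e2 : (X.ind {x | h x ≠ i}).par (Y.ind {x | h x ≠ i}) =
          (X.par Y).ind {x | x ∉ {x | h x = i}} := by
        apply ext' <;> grind -funext -ext
      rw [e2]
      refine Prov.insMod ?_ (hp i hi hij)
      unfold Mod
      rcases hE with hE | hE <;> grind
    by_cases hdel : ∃ i, i ∈ Q.V ∧ i ≠ j ∧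
      ((∀ x, x ∈ X.V → h x ≠ i) ∨ (∀ x, x ∈ Y.V → h x ≠ i))
    · obtain ⟨i, hi, hij, hE⟩ := hdel
      exact del i hi hij hE
    push Not at hdel
    by_cases hjE : ∀ x, x ∈ (X.par Y).V → h x ≠ j
    · have hlt : (Q.ind {x | x ≠ j}).V.ncard < Q.V.ncard := card_ind_lt hj (by simp)
      have := ih (Q.ind {x | x ≠ j}) X Y h i0 (by omega) hd' (by grind) (by grind)
        (by unfold CoC; grind) (by unfold Cm; grind) (by grind) (by
          intro k hk hkj
          exact hp k hk.1 hk.2)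
      have e : (X.par Y).ind {x | h x = j} = emp := by
        apply ext' <;> grind -funext -ext
      rw [e]
      exact (hp i0 hi0 hi0j).drv this
    by_cases hpri : Q.Pri
    · have hc2 : 2 ≤ Q.V.ncard := by
        have : 1 < Q.V.ncard := (Set.one_lt_ncard Q.V.toFinite).2 ⟨i0, hi0, j, hj, hi0j⟩
        omega
      by_cases h4 : 4 ≤ Q.V.ncard
      · by_cases hXj : ∃ x, x ∈ X.V ∧ h x = j
        · refine p_aux hd' hpri h4 hX hY ?_ cX' cY' hp
          intro i hi
          by_cases hij : i = j
          · subst hij; exact hXj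
          · exact (hdel i hi hij).1
        · have := p_aux (lab := lab) (j := j) hd'.symm hpri.compl h4 hY hX (by
            intro i hi
            by_cases hij : i = j
            · grind
            · exact (hdel i hi hij).2) (compl_coc hY cY') (compl_cm hX cX')
            (by rw [par_comm Y X]; exact hp)
          rwa [par_comm Y X] at this
      · have h3 := hpri.ne3
        have h2 : Q.V.ncard = 2 := by omega
        have hV : ∀ i, i ∈ Q.V → i = i0 ∨ i = j := by
          obtain ⟨a, b, hab, hV⟩ := Set.ncard_eq_two.1 h2
          rw [hV] at hi0 hj ⊢
          grind
        by_cases ha : Q.adj i0 j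
        · exact two_aux hd' (fun x hx => hV _ (hX x hx)) (fun x hx => hV _ (hY x hx)) hi0j ha
            cX' cY' (hp i0 hi0 hi0j)
        · have := two_aux (lab := lab) (Q := Q.compl) hd'.symm (fun x hx => hV _ (hY x hx))
            (fun x hx => hV _ (hX x hx)) hi0j (by grind)
            (compl_coc hY cY') (compl_cm hX cX') (by rw [par_comm Y X]; exact hp i0 hi0 hi0j)
          rwa [par_comm Y X] at this
    · unfold Pri at hpri
      push Not at hpri
      obtain ⟨M, hMQ, hM, ⟨m0, hm0⟩, hM2, w, hw, hwM⟩ := hpri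
      obtain ⟨m, hm, hmj⟩ : ∃ m, m ∈ M ∧ (j ∈ M → m = j) := by
        by_cases hjM : j ∈ M
        · exact ⟨j, hjM, fun _ => rfl⟩
        · exact ⟨m0, hm0, fun h => absurd h hjM⟩
      obtain ⟨m', hm', hmm'⟩ := hM2 m
      have hlt1 : (Q.ind M).V.ncard < Q.V.ncard := card_ind_lt hw hwM
      have hlt2 : (Q.ind {x | x ∉ M ∨ x = m}).V.ncard < Q.V.ncard :=
        card_ind_lt (hMQ m' hm') (by grind)
      have e0 : ∀ i, i ∈ M → ((X.ind {x | h x ∈ M}).par (Y.ind {x | h x ∈ M})).ind {x | h x = i} =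
          (X.par Y).ind {x | h x = i} := by
        intro i hi
        apply ext' <;> grind -funext -ext
      have s1 := ih (Q.ind M) (X.ind {x | h x ∈ M}) (Y.ind {x | h x ∈ M}) h m (by omega)
        (by intro x; grind) (by grind) (by grind) (by unfold CoC; grind) (by unfold Cm; grind)
        (by grind) (by
          intro k hk hkj
          rw [e0 k hk.2]
          exact hp k hk.1 (by grind))
      rw [e0 m hm] at s1
      classical
      have hh : ∀ k, k ≠ m → k ∉ M →
          (X.par Y).ind {x | (if h x ∈ M then m else h x) = k} = (X.par Y).ind {x | h x = k} := by
        intro k hk hk'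
        apply ext' <;> grind -funext -ext
      have hh' : (X.par Y).ind {x | (if h x ∈ M then m else h x) = m} =
          (X.ind {x | h x ∈ M}).par (Y.ind {x | h x ∈ M}) := by
        apply ext' <;> grind -funext -ext
      have hs := fun x y => Q.symm (x := x) (y := y)
      unfold Mod at hM
      have s2 := ih (Q.ind {x | x ∉ M ∨ x = m}) X Y (fun x => if h x ∈ M then m else h x)
        (if j ∈ M then m else j) (by omega) hd' (by grind) (by grind)
        (by
          intro x y hx hy hxy
          have c1 := cX x y hx hy (by grind)
          have k1 := hX x hx
          have k2 := hX y hy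
          rw [c1]
          simp only [adj_ind]
          grind)
        (by
          intro x y hx hy hxy
          have c1 := cY x y hx hy (by grind)
          have k1 := hY x hx
          have k2 := hY y hy
          rw [c1]
          simp only [adj_ind]
          grind)
        (by grind) (by
          intro k hk hkj
          by_cases hkm : k = m
          · subst hkm
            rw [hh']
            exact (hp k hk.1 (by grind)).drv s1
          · rw [hh k hkm (by grind)]
            exact hp k hk.1 (by grind))
      by_cases hjM : j ∈ M
      · have := hmj hjM
        subst this
        simp only [hjM, if_true] at s2
        rw [hh'] at s2
        exact s1.trans s2
      · simp only [hjM, if_false] at s2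
        rwa [hh j (by grind) hjM] at s2

theorem genp [Finite α] {Q X Y : SG α} {h : α → α} {j : α}
    (hd : Dj X Y) (hX : ∀ x, x ∈ X.V → h x ∈ Q.V) (hY : ∀ x, x ∈ Y.V → h x ∈ Q.V)
    (cX : CoC X Q h) (cY : Cm Y Q h) (hj : j ∈ Q.V)
    (hp : ∀ i, i ∈ Q.V → i ≠ j → Prov lab ((X.par Y).ind {x | h x = i})) :
    Drv lab ((X.par Y).ind {x | h x = j}) (X.par Y) :=
  genp_aux _ Q X Y h j le_rfl hd hX hY cX cY hj hp

theorem genpProv [Finite α] {Q X Y : SG α} {h : α → α}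
    (hd : Dj X Y) (hX : ∀ x, x ∈ X.V → h x ∈ Q.V) (hY : ∀ x, x ∈ Y.V → h x ∈ Q.V)
    (cX : CoC X Q h) (cY : Cm Y Q h)
    (hp : ∀ i, i ∈ Q.V → Prov lab ((X.par Y).ind {x | h x = i})) :
    Prov lab (X.par Y) := by
  by_cases hj : ∃ j, j ∈ Q.V
  · obtain ⟨j, hj⟩ := hj
    exact (hp j hj).drv (genp hd hX hY cX cY hj fun i hi _ => hp i hi)
  · have e : X.par Y = emp := by
      apply ext' <;> grind -funext -ext
    rw [e]
    exact Prov.emp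

end SG
end

section
namespace SG

variable {α : Type} {lab : α → Atom}

/-- Indices of connected compositions: an edge or a prime graph with at least four vertices. -/
def CP (P : SG α) : Prop :=
  (P.Pri ∧ 4 ≤ P.V.ncard) ∨ ∃ a b, a ≠ b ∧ (∀ x, x ∈ P.V ↔ x = a ∨ x = b) ∧ P.adj a b

/-- `Z` is a composition along `P`. -/
def Comp (Z P : SG α) (h : α → α) : Prop :=
  (∀ x, x ∈ Z.V → h x ∈ P.V) ∧ (∀ i, i ∈ P.V → ∃ x, x ∈ Z.V ∧ h x = i) ∧ Cm Z P h

/-- Connected graphs. -/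
def Conn (Z : SG α) : Prop :=
  ∀ U : Set α, (∃ x, x ∈ Z.V ∧ x ∈ U) → (∃ x, x ∈ Z.V ∧ x ∉ U) →
    ∃ x y, x ∈ U ∧ y ∉ U ∧ Z.adj x y

theorem three_of_card {s : Set α} [Finite α] (h : 4 ≤ s.ncard) :
    ∃ a b c, a ∈ s ∧ b ∈ s ∧ c ∈ s ∧ a ≠ b ∧ a ≠ c ∧ b ≠ c :=
  (Set.two_lt_ncard_iff s.toFinite).1 (by omega)

theorem not_two_of_card {s : Set α} [Finite α] (h : 4 ≤ s.ncard) (a b : α) :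
    ∃ x ∈ s, x ≠ a ∧ x ≠ b := by
  obtain ⟨x, y, z, hx, hy, hz, h1, h2, h3⟩ := three_of_card h
  by_contra hc
  push Not at hc
  have c1 := hc x hx
  have c2 := hc y hy
  have c3 := hc z hz
  by_cases e1 : x = a <;> by_cases e2 : y = a <;> by_cases e3 : z = a <;> grind

theorem primeMod [Finite α] {Z P : SG α} {h : α → α} {c : Set α} (hP : P.Pri) (h4 : 4 ≤ P.V.ncard)
    (hZ : Comp Z P h) (hc : Z.Mod c) {x y : α} (hx : x ∈ Z.V) (hxc : x ∈ c) (hy : y ∈ Z.V)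
    (hyc : y ∈ c) (hxy : h x ≠ h y) : ∀ z, z ∈ Z.V → z ∈ c := by
  obtain ⟨hZ1, hZ2, hZ3⟩ := hZ
  have hI : ∀ i ∈ P.V, ∃ z, z ∈ Z.V ∧ z ∈ c ∧ h z = i := by
    have m : P.Mod {i | ∃ z, z ∈ Z.V ∧ z ∈ c ∧ h z = i} := by
      rintro v hv hv' _ _ ⟨z, hz, hzc, rfl⟩ _ _ ⟨z', hz', hzc', rfl⟩ ha
      obtain ⟨w, hw, rfl⟩ := hZ2 v hv
      have hwc : w ∉ c := fun h' => hv' ⟨w, hw, h', rfl⟩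
      have n1 : h w ≠ h z := fun e => hv' ⟨z, hz, hzc, e.symm⟩
      have n2 : h w ≠ h z' := fun e => hv' ⟨z', hz', hzc', e.symm⟩
      exact (hZ3 w z' hw hz' n2).1 (hc w hw hwc z hz hzc z' hz' hzc' ((hZ3 w z hw hz n1).2 ha))
    rcases hP _ (by rintro _ ⟨z, hz, _, rfl⟩; exact hZ1 z hz) m with h1 | ⟨v, h1⟩ | h1
    · exact absurd ⟨x, hx, hxc, rfl⟩ (h1 (h x))
    · exact absurd ((h1 _ ⟨x, hx, hxc, rfl⟩).trans (h1 _ ⟨y, hy, hyc, rfl⟩).symm) hxy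
    · exact h1
  intro v hv
  by_contra hvc
  have m : P.Mod {i | i ∈ P.V ∧ i ≠ h v} := by
    rintro w hw hw' i _ ⟨hi, hiv⟩ j _ ⟨hj, hjv⟩ ha
    have e : w = h v := by
      by_contra h'
      exact hw' ⟨hw, h'⟩
    subst e
    obtain ⟨z, hz, hzc, rfl⟩ := hI i hi
    obtain ⟨z', hz', hzc', rfl⟩ := hI j hj
    exact (hZ3 v z' hv hz' hjv.symm).1 (hc v hv hvc z hz hzc z' hz' hzc'
      ((hZ3 v z hv hz hiv.symm).2 ha))
  rcases hP _ (fun _ h => h.1) m with h1 | ⟨w, h1⟩ | h1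
  · obtain ⟨i, hi, hiv, _⟩ := not_two_of_card h4 (h v) (h v)
    exact h1 i ⟨hi, hiv⟩
  · obtain ⟨i, hi, hiv, hiw⟩ := not_two_of_card h4 (h v) w
    exact hiw (h1 i ⟨hi, hiv⟩)
  · exact (h1 _ (hZ1 v hv)).2 rfl

theorem connPri [Finite α] {Z P : SG α} {h : α → α} (hP : P.Pri) (h4 : 4 ≤ P.V.ncard)
    (hZ : Comp Z P h) : Conn Z := by
  intro U ⟨x, hx, hxU⟩ ⟨y, hy, hyU⟩
  by_contra hc
  push Not at hc
  have m1 : Z.Mod U := by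
    intro v _ hv z _ hz w _ _ ha
    exact absurd (Z.symm ha) (hc z v hz hv)
  have m2 : Z.Mod Uᶜ := by
    intro v _ hv z _ hz w _ _ ha
    exact absurd ha (hc v z (by simpa using hv) hz)
  obtain ⟨i, hi, hix, hiy⟩ := not_two_of_card h4 (h x) (h y)
  obtain ⟨z, hz, rfl⟩ := hZ.2.1 i hi
  by_cases hzU : z ∈ U
  · exact hyU (primeMod hP h4 hZ m1 hz hzU hx hxU hix y hy)
  · exact primeMod hP h4 hZ m2 hz hzU hy hyU hiy x hx hxU

theorem connCP [Finite α] {Z P : SG α} {h : α → α} (hP : CP P) (hZ : Comp Z P h) : Conn Z := by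
  rcases hP with hP | ⟨a, b, hab, hV, hadj⟩
  · exact connPri hP.1 hP.2 hZ
  obtain ⟨hZ1, hZ2, hZ3⟩ := hZ
  have key : ∀ x y, x ∈ Z.V → y ∈ Z.V → h x ≠ h y → Z.adj x y := by
    intro x y hx hy hxy
    rw [hZ3 x y hx hy hxy]
    have := P.symm hadj
    have := (hV _).1 (hZ1 x hx)
    have := (hV _).1 (hZ1 y hy)
    grind
  intro U ⟨x, hx, hxU⟩ ⟨y, hy, hyU⟩
  by_cases hxy : h x = h y
  · obtain ⟨w, hw, hwx⟩ : ∃ w, w ∈ Z.V ∧ h w ≠ h x := by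
      obtain ⟨u, hu, hua⟩ := hZ2 a ((hV a).2 (Or.inl rfl))
      obtain ⟨v, hv, hvb⟩ := hZ2 b ((hV b).2 (Or.inr rfl))
      by_cases e : h x = a
      · exact ⟨v, hv, by grind⟩
      · exact ⟨u, hu, by grind⟩
    by_cases hwU : w ∈ U
    · exact ⟨w, y, hwU, hyU, key w y hw hy (by grind)⟩
    · exact ⟨x, w, hxU, hwU, key x w hx hw (by grind)⟩
  · exact ⟨x, y, hxU, hyU, key x y hx hy hxy⟩

/-- A module meeting a connected component without containing it lies inside it. -/
theorem modInComp {Y : SG α} {Z M : Set α} (hZ : Conn (Y.ind Z))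
    (hc : ∀ x y, Y.adj x y → x ∈ Z → y ∈ Z) (hM : Y.Mod M) {x y : α}
    (hx : x ∈ Y.V) (hxZ : x ∈ Z) (hxM : x ∈ M) (hy : y ∈ Y.V) (hyZ : y ∈ Z) (hyM : y ∉ M) :
    ∀ z, z ∈ Y.V → z ∈ M → z ∈ Z := by
  obtain ⟨u, v, hu, hv, ha, hu', hv'⟩ := hZ M ⟨x, ⟨hx, hxZ⟩, hxM⟩ ⟨y, ⟨hy, hyZ⟩, hyM⟩
  intro z hz hzM
  exact hc v z (hM v (Y.mem' ha) hv u (Y.mem ha) hu z hz hzM (Y.symm ha)) hv'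

theorem compl_comp {Z P : SG α} {h : α → α} (h1 : ∀ x, x ∈ Z.V → h x ∈ P.V)
    (h2 : ∀ i, i ∈ P.V → ∃ x, x ∈ Z.V ∧ h x = i) (h3 : CoC Z P h) : Comp Z.compl P h := by
  refine ⟨h1, h2, ?_⟩
  intro x y hx hy hxy
  have a1 := h3 x y hx hy hxy
  have a2 : x ≠ y := fun e => hxy (by rw [e])
  have a3 := h1 x hx
  have a4 := h1 y hy
  have a5 : x ∈ Z.V := hx
  have a6 : y ∈ Z.V := hy
  simp only [adj_compl]
  grind

theorem Rule.coconn [Finite α] {p c : SG α} (hr : Rule lab p c) (U : Set α)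
    (h1 : ∃ x, x ∈ c.V ∧ x ∈ U) (h2 : ∃ x, x ∈ c.V ∧ x ∉ U) :
    ∃ x y, x ∈ c.V ∧ y ∈ c.V ∧ x ∈ U ∧ y ∉ U ∧ ¬ c.adj x y := by
  have par : ∀ X Y : SG α, c = X.par Y → Dj X Y → (∃ x, x ∈ X.V) → (∃ y, y ∈ Y.V) →
      ∃ x y, x ∈ c.V ∧ y ∈ c.V ∧ x ∈ U ∧ y ∉ U ∧ ¬ c.adj x y := by
    rintro X Y rfl hd ⟨x, hx⟩ ⟨y, hy⟩
    have key : ∀ x y, x ∈ X.V → y ∈ Y.V → ¬ (X.par Y).adj x y ∧ ¬ (X.par Y).adj y x := by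
      intro x y hx hy
      have := hd x hx
      have := hd.symm y hy
      grind
    obtain ⟨u, hu, huU⟩ := h1
    obtain ⟨v, hv, hvU⟩ := h2
    by_cases hxU : x ∈ U <;> by_cases hyU : y ∈ U
    · rcases hv with hv | hv
      · exact ⟨y, v, Or.inr hy, Or.inl hv, hyU, hvU, (key v y hv hy).2⟩
      · exact ⟨x, v, Or.inl hx, Or.inr hv, hxU, hvU, (key x v hx hv).1⟩
    · exact ⟨x, y, Or.inl hx, Or.inr hy, hxU, hyU, (key x y hx hy).1⟩
    · exact ⟨y, x, Or.inr hy, Or.inl hx, hyU, hxU, (key x y hx hy).2⟩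
    · rcases hu with hu | hu
      · exact ⟨u, y, Or.inl hu, Or.inr hy, huU, hyU, (key u y hu hy).1⟩
      · exact ⟨u, x, Or.inr hu, Or.inl hx, huU, hxU, (key x u hx hu).2⟩
  cases hr with
  | ai x y hxy hl =>
    obtain ⟨u, hu, huU⟩ := h1
    obtain ⟨v, hv, hvU⟩ := h2
    exact ⟨u, v, hu, hv, huU, hvU, id⟩
  | ss A B S hd hA hS => exact par B A rfl hd (hS.imp fun _ h => h.1) hA
  | p P X Y h hP h4 hd hX hY hXs cX cY =>
    by_cases hYn : ∃ y, y ∈ Y.V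
    · obtain ⟨i, hi, _⟩ : ∃ i, i ∈ P.V ∧ True := by
        obtain ⟨a, _, _, ha, _⟩ := three_of_card h4
        exact ⟨a, ha, trivial⟩
      exact par X Y rfl hd ((hXs i hi).imp fun _ h => h.1) hYn
    · have e : X.par Y = X := by
        apply ext' <;> grind -funext -ext
      rw [e] at h1 h2 ⊢
      obtain ⟨x, y, hx, hy, ha⟩ := connPri hP h4 (compl_comp hX hXs cX) U h1 h2
      exact ⟨x, y, ha.2.1, ha.2.2.1, hx, hy, ha.2.2.2⟩

/-- Proper modules. -/
def PM (W : SG α) (M : Set α) : Prop := (∀ x ∈ M, x ∈ W.V) ∧ W.Mod M ∧ ∃ w, w ∈ W.V ∧ w ∉ M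

theorem pm_union {W : SG α} (hc : Conn W) (hcc : Conn W.compl) {M N : Set α} (hM : PM W M)
    (hN : PM W N) {x : α} (hxM : x ∈ M) (hxN : x ∈ N) : PM W (M ∪ N) := by
  obtain ⟨hM1, hM2, wM, hwM, hwM'⟩ := hM
  obtain ⟨hN1, hN2, wN, hwN, hwN'⟩ := hN
  refine ⟨by grind, ?_, ?_⟩
  · intro v hv hv' y hy hyM z hz hzM ha
    have m1 : v ∉ M := fun h => hv' (Or.inl h)
    have n1 : v ∉ N := fun h => hv' (Or.inr h)
    have hx := hM1 x hxM
    have e : W.adj v x := by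
      rcases hyM with hyM | hyM
      · exact hM2 v hv m1 y hy hyM x hx hxM ha
      · exact hN2 v hv n1 y hy hyM x hx hxN ha
    rcases hzM with hzM | hzM
    · exact hM2 v hv m1 x hx hxM z hz hzM e
    · exact hN2 v hv n1 x hx hxN z hz hzM e
  · by_contra hall
    push Not at hall
    have n0 : wM ∈ N := (hall wM hwM).resolve_left hwM'
    have m0 : wN ∈ M := (hall wN hwN).resolve_right hwN'
    -- uniformity
    have key : ∀ m n m' n', m ∈ M → m ∉ N → n ∈ N → m' ∈ M → m' ∉ N → n' ∈ N →
        W.adj m n → W.adj m' n' := by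
      intro m n m' n' hm hm2 hn hm' hm2' hn' ha
      have a1 := hN2 m (hM1 m hm) hm2 n (hN1 n hn) hn wM hwM n0 ha
      have a2 := hM2 wM hwM hwM' m (hM1 m hm) hm m' (hM1 m' hm') hm' (W.symm a1)
      exact hN2 m' (hM1 m' hm') hm2' wM hwM n0 n' (hN1 n' hn') hn' (W.symm a2)
    by_cases ha : W.adj wN wM
    · obtain ⟨u, v, hu, hv, hav⟩ := hcc N ⟨wM, hwM, n0⟩ ⟨wN, hwN, hwN'⟩
      exact hav.2.2.2 (W.symm (key wN wM v u m0 hwN' n0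
        ((hall v hav.2.2.1).resolve_right hv) hv hu ha))
    · obtain ⟨u, v, hu, hv, hav⟩ := hc N ⟨wM, hwM, n0⟩ ⟨wN, hwN, hwN'⟩
      exact ha (key v u wN wM ((hall v (W.mem' hav)).resolve_right hv) hv hu m0 hwN' n0
        (W.symm hav))

theorem split_aux {W : SG α} {U : Set α} {a b : α} (ha : a ∈ W.V) (haU : a ∈ U) (hb : b ∈ W.V)
    (hbU : b ∉ U) (hall : ∀ x y, x ∈ W.V → y ∈ W.V → x ∈ U → y ∉ U → W.adj x y) :
    ∃ (P : SG α) (t : α → α), CP P ∧ Comp W P t ∧ a ∈ P.V ∧ b ∈ P.V ∧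
      (∀ x, x ∈ U → t x = a) ∧ (∀ x, x ∉ U → t x = b) ∧ (∀ i, i ∈ P.V → i = a ∨ i = b) ∧
      P.adj a b := by
  classical
  have hab : a ≠ b := by rintro rfl; exact hbU haU
  have h1 := hall a b ha hb haU hbU
  refine ⟨W.ind {x | x = a ∨ x = b}, fun x => if x ∈ U then a else b,
    Or.inr ⟨a, b, hab, ?_, ?_⟩, ⟨?_, ?_, ?_⟩, ?_, ?_, ?_, ?_, ?_, ?_⟩
  · grind
  · grind
  · grind
  · rintro i ⟨hi, rfl | rfl⟩
    · exact ⟨i, hi, by grind⟩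
    · exact ⟨i, hi, by grind⟩
  · intro x y hx hy hxy
    have h1' := W.symm h1
    have k1 := hall x y hx hy
    have k2 := fun h1 h2 => W.symm (hall y x hy hx h1 h2)
    grind
  · grind
  · grind
  · grind
  · grind
  · exact fun i hi => hi.2
  · exact ⟨h1, Or.inl rfl, Or.inr rfl⟩

set_option maxHeartbeats 1000000 in
theorem decomp [Finite α] {W : SG α} {T : Set α} (hc : Conn W) (hT : W.Mod T)
    (hTW : ∀ x ∈ T, x ∈ W.V) (hT0 : ∃ x, x ∈ T) (hT1 : ∃ x, x ∈ W.V ∧ x ∉ T) :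
    ∃ (P : SG α) (t : α → α) (j : α), CP P ∧ Comp W P t ∧ j ∈ P.V ∧ ∀ x, x ∈ T → t x = j := by
  classical
  obtain ⟨x0, hx0⟩ := hT0
  by_cases hcc : Conn W.compl
  · have hTP : PM W T := ⟨hTW, hT, hT1⟩
    let s : Setoid α := {
      r := fun x y => x = y ∨ ∃ M, PM W M ∧ x ∈ M ∧ y ∈ M
      iseqv := ⟨fun x => Or.inl rfl, by
        rintro x y (h | ⟨M, hM, hx, hy⟩)
        · exact Or.inl h.symm
        · exact Or.inr ⟨M, hM, hy, hx⟩, by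
        rintro x y z (rfl | ⟨M, hM, hx, hy⟩) (rfl | ⟨N, hN, hy', hz⟩)
        · exact Or.inl rfl
        · exact Or.inr ⟨N, hN, hy', hz⟩
        · exact Or.inr ⟨M, hM, hx, hy⟩
        · exact Or.inr ⟨M ∪ N, pm_union hc hcc hM hN hy hy', Or.inl hx, Or.inr hz⟩⟩ }
    obtain ⟨t, ht1, ht2⟩ : ∃ t : α → α, (∀ x, s.r (t x) x) ∧ ∀ x y, s.r x y → t x = t y := by
      refine ⟨fun x => (Quotient.mk s x).out, fun x => Quotient.mk_out x, fun x y h => ?_⟩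
      have : Quotient.mk s x = Quotient.mk s y := Quotient.sound h
      simp only [this]
    have hs : ∀ x y, s.r x y ↔ x = y ∨ ∃ M, PM W M ∧ x ∈ M ∧ y ∈ M := fun _ _ => Iff.rfl
    have hsymm : ∀ x y, s.r x y → s.r y x := fun x y h => s.symm h
    have htrans : ∀ x y z, s.r x y → s.r y z → s.r x z := fun x y z h h' => s.trans h h'
    clear_value s
    have hpm : ∀ x, x ∈ W.V → ∃ M, PM W M ∧ x ∈ M ∧ ∀ y, s.r x y → y ∈ M := by
      intro x hx
      have h0 : PM W {x} := by
        refine ⟨by grind, ?_, ?_⟩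
        · rintro v hv hv' y _ rfl z _ rfl ha
          exact ha
        · obtain ⟨w, hw, hwT⟩ := hT1
          by_cases e : w = x
          · exact ⟨x0, hTW x0 hx0, by rintro rfl; exact hwT (e ▸ hx0)⟩
          · exact ⟨w, hw, e⟩
      obtain ⟨M, hxM, hM⟩ := (Set.toFinite {M : Set α | PM W M}).exists_le_maximal h0
      have hxM' : x ∈ M := hxM rfl
      refine ⟨M, hM.prop, hxM', fun y hy => ?_⟩
      rcases (hs x y).1 hy with rfl | ⟨N, hN, hx', hy'⟩
      · exact hxM'
      · exact hM.le_of_ge (pm_union hc hcc hM.prop hN hxM' hx') (fun z hz => Or.inl hz)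
          (Or.inr hy')
    have htW : ∀ x, x ∈ W.V → t x ∈ W.V := by
      intro x hx
      rcases (hs _ _).1 (ht1 x) with h | ⟨M, hM, h1, h2⟩
      · rwa [h]
      · exact hM.1 _ h1
    have htt : ∀ x, t (t x) = t x := fun x => ht2 _ _ (ht1 x)
    have hswap : ∀ x x' y, x ∈ W.V → x' ∈ W.V → y ∈ W.V → t x = t x' → t x ≠ t y →
        W.adj x y → W.adj x' y := by
      intro x x' y hx hx' hy hxx hxy ha
      have r : s.r x x' := htrans x (t x) x' (hsymm _ _ (ht1 x)) (by rw [hxx]; exact ht1 x')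
      rcases (hs _ _).1 r with rfl | ⟨M, hM, h1, h2⟩
      · exact ha
      · have : y ∉ M := fun h => hxy (ht2 _ _ ((hs _ _).2 (Or.inr ⟨M, hM, h1, h⟩)))
        exact W.symm (hM.2.1 y hy this x hx h1 x' hx' h2 (W.symm ha))
    have hiff : ∀ x y, x ∈ W.V → y ∈ W.V → t x ≠ t y → (W.adj x y ↔ W.adj (t x) (t y)) := by
      intro x y hx hy hxy
      constructor
      · intro ha
        have a1 := hswap x (t x) y hx (htW x hx) hy (htt x).symm hxy ha
        exact W.symm (hswap y (t y) (t x) hy (htW y hy) (htW x hx) (htt y).symm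
          (by rw [htt]; exact hxy.symm) (W.symm a1))
      · intro ha
        have a1 := hswap (t x) x (t y) (htW x hx) hx (htW y hy) (htt x)
          (by rw [htt, htt]; exact hxy) ha
        exact W.symm (hswap (t y) y x (htW y hy) hy hx (htt y) (by rw [htt]; exact hxy.symm)
          (W.symm a1))
    have hPV : ∀ x, x ∈ W.V → t x ∈ (W.ind {x | t x = x}).V := fun x hx => ⟨htW x hx, htt x⟩
    have hpri : (W.ind {x | t x = x}).Pri := by
      intro M hMP hM
      by_cases hall : ∀ x ∈ (W.ind {x | t x = x}).V, x ∈ M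
      · exact Or.inr (Or.inr hall)
      push Not at hall
      obtain ⟨w, hw, hwM⟩ := hall
      by_cases hne : ∃ x, x ∈ M
      · obtain ⟨x, hx⟩ := hne
        right; left
        have hpm' : PM W {y | y ∈ W.V ∧ t y ∈ M} := by
          refine ⟨fun y hy => hy.1, ?_, w, hw.1, ?_⟩
          · rintro v hv hv' y hy ⟨_, hyM⟩ z hz ⟨_, hzM⟩ ha
            have hvM : t v ∉ M := fun h => hv' ⟨hv, h⟩
            have n1 : t v ≠ t y := fun e => hvM (e ▸ hyM)
            have n2 : t v ≠ t z := fun e => hvM (e ▸ hzM)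
            have := hM (t v) (hPV v hv) hvM (t y) (hPV y hy) hyM (t z) (hPV z hz) hzM
              ⟨(hiff v y hv hy n1).1 ha, htt v, htt y⟩
            exact (hiff v z hv hz n2).2 this.1
          · rintro ⟨_, h⟩
            rw [hw.2] at h
            exact hwM h
        refine ⟨x, fun y hy => ?_⟩
        have e1 : t x = x := (hMP x hx).2
        have e2 : t y = y := (hMP y hy).2
        rw [← e1, ← e2]
        exact ht2 _ _ ((hs _ _).2 (Or.inr ⟨_, hpm', ⟨(hMP y hy).1, by rwa [e2]⟩,
          ⟨(hMP x hx).1, by rwa [e1]⟩⟩))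
      · left
        exact fun x hx => hne ⟨x, hx⟩
    have h2 : 2 ≤ (W.ind {x | t x = x}).V.ncard := by
      obtain ⟨M, hM, hxM, hMM⟩ := hpm x0 (hTW x0 hx0)
      obtain ⟨w, hw, hwM⟩ := hM.2.2
      have : 1 < (W.ind {x | t x = x}).V.ncard := by
        refine (Set.one_lt_ncard (Set.toFinite _)).2 ⟨t x0, hPV x0 (hTW x0 hx0), t w, hPV w hw, ?_⟩
        intro e
        exact hwM (hMM w (htrans x0 (t x0) w (hsymm _ _ (ht1 x0)) (by rw [e]; exact ht1 w)))
      omega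
    have h4 : 4 ≤ (W.ind {x | t x = x}).V.ncard := by
      have h3 := hpri.ne3
      by_contra hlt
      obtain ⟨a, b, hab, hV⟩ := Set.ncard_eq_two.1 (show (W.ind {x | t x = x}).V.ncard = 2 by omega)
      have ha : a ∈ (W.ind {x | t x = x}).V := by rw [hV]; simp
      have hb : b ∈ (W.ind {x | t x = x}).V := by rw [hV]; simp
      have hor : ∀ x, x ∈ W.V → t x = a ∨ t x = b := by
        intro x hx
        have := hPV x hx
        rw [hV] at this
        simpa using this
      have k1 : ∃ x, x ∈ W.V ∧ x ∈ {x | t x = a} := ⟨a, ha.1, ha.2⟩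
      have k2 : ∃ x, x ∈ W.V ∧ x ∉ {x | t x = a} := ⟨b, hb.1, by
        intro h
        exact hab (h.symm.trans hb.2)⟩
      by_cases hadj : W.adj a b
      · obtain ⟨x, y, hx, hy, hh⟩ := hcc {x | t x = a} k1 k2
        have hx' : t x = a := hx
        have hy' : t y = b := (hor y hh.2.2.1).resolve_left hy
        exact hh.2.2.2 ((hiff x y hh.2.1 hh.2.2.1 (by rw [hx', hy']; exact hab)).2
          (by rwa [hx', hy']))
      · obtain ⟨x, y, hx, hy, hh⟩ := hc {x | t x = a} k1 k2
        have hx' : t x = a := hx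
        have hy' : t y = b := (hor y (W.mem' hh)).resolve_left hy
        have := (hiff x y (W.mem hh) (W.mem' hh) (by rw [hx', hy']; exact hab)).1 hh
        rw [hx', hy'] at this
        exact hadj this
    refine ⟨W.ind {x | t x = x}, t, t x0, Or.inl ⟨hpri, h4⟩, ⟨hPV, ?_, ?_⟩, hPV x0 (hTW x0 hx0), ?_⟩
    · rintro i ⟨hi, hi'⟩
      exact ⟨i, hi, hi'⟩
    · intro x y hx hy hxy
      rw [hiff x y hx hy hxy]
      exact ⟨fun h => ⟨h, htt x, htt y⟩, fun h => h.1⟩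
    · intro x hx
      exact ht2 _ _ ((hs _ _).2 (Or.inr ⟨T, hTP, hx, hx0⟩))
  · unfold Conn at hcc
    push Not at hcc
    obtain ⟨U, ⟨a, ha, haU⟩, ⟨b, hb, hbU⟩, hU⟩ := hcc
    have hall : ∀ x y, x ∈ W.V → y ∈ W.V → x ∈ U → y ∉ U → W.adj x y := by
      intro x y hx hy hxU hyU
      by_contra hn
      exact hU x y hxU hyU ⟨by rintro rfl; exact hyU hxU, hx, hy, hn⟩
    by_cases h1 : ∀ x ∈ T, x ∈ U
    · obtain ⟨P, t, hP, hC, haP, hbP, ht1, ht2, _⟩ := split_aux (W := W) ha haU hb hbU hall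
      exact ⟨P, t, a, hP, hC, haP, fun x hx => ht1 x (h1 x hx)⟩
    by_cases h2 : ∀ x ∈ T, x ∉ U
    · obtain ⟨P, t, hP, hC, haP, hbP, ht1, ht2, _⟩ := split_aux (W := W) ha haU hb hbU hall
      exact ⟨P, t, b, hP, hC, hbP, fun x hx => ht2 x (h2 x hx)⟩
    push Not at h1 h2
    obtain ⟨u, hu, huU⟩ := h1
    obtain ⟨v, hv, hvU⟩ := h2
    obtain ⟨w, hw, hwT⟩ := hT1
    obtain ⟨P, t, hP, hC, haP, hbP, ht1, ht2, _⟩ := split_aux (hTW x0 hx0) hx0 hw hwT (by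
      intro x y hx hy hxT hyT
      apply W.symm
      by_cases hyU : y ∈ U
      · exact hT y hy hyT u (hTW u hu) hu x hx hxT (hall y u hy (hTW u hu) hyU huU)
      · exact hT y hy hyT v (hTW v hv) hv x hx hxT (W.symm (hall v y (hTW v hv) hy hvU hyU)))
    exact ⟨P, t, x0, hP, hC, haP, fun x hx => ht1 x hx⟩

end SG
end

section
namespace SG

variable {α : Type} {lab : α → Atom}

theorem ind_ind (Z : SG α) (S S' : Set α) : (Z.ind S).ind S' = Z.ind {x | x ∈ S ∧ x ∈ S'} := by
  apply ext' <;> simp only [mem_ind, adj_ind, Set.mem_ofPred_eq] <;> intros <;> tauto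

theorem ind_congr {Z : SG α} {S S' : Set α} (h : ∀ x, x ∈ Z.V → (x ∈ S ↔ x ∈ S')) :
    Z.ind S = Z.ind S' := by
  apply ext' <;> simp only [mem_ind, adj_ind]
  · intro x
    have := h x
    tauto
  · intro x y
    have h1 := h x
    have h2 := h y
    have m1 := fun h => Z.mem (x := x) (y := y) h
    have m2 := fun h => Z.mem' (x := x) (y := y) h
    tauto

theorem ind_self {Z : SG α} {S : Set α} (h : ∀ x, x ∈ Z.V → x ∈ S) : Z.ind S = Z := by
  apply ext' <;> simp only [mem_ind, adj_ind]
  · intro x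
    have := h x
    tauto
  · intro x y
    have h1 := h x
    have h2 := h y
    have m1 := fun h => Z.mem (x := x) (y := y) h
    have m2 := fun h => Z.mem' (x := x) (y := y) h
    tauto

theorem ind_emp {Z : SG α} {S : Set α} (h : ∀ x, x ∈ Z.V → x ∉ S) : Z.ind S = emp := by
  apply ext' <;> simp only [mem_ind, adj_ind, mem_emp, adj_emp]
  · intro x
    have := h x
    tauto
  · intro x y
    have h1 := h x
    have m1 := fun h => Z.mem (x := x) (y := y) h
    tauto

theorem par_ind (G H : SG α) (S : Set α) : (G.par H).ind S = (G.ind S).par (H.ind S) := by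
  apply ext' <;> simp only [mem_ind, adj_ind, mem_par, adj_par] <;> intros <;> tauto

theorem Mod.ind {T : SG α} {M : Set α} (h : T.Mod M) (S : Set α) : (T.ind S).Mod M := by
  intro v hv hvM x hx hxM y hy hyM ha
  exact ⟨h v hv.1 hvM x hx.1 hxM y hy.1 hyM ha.1, hv.2, hy.2⟩

theorem Mod.parL {Y Z : SG α} {M : Set α} (h : (Y.par Z).Mod M) (hd : Dj Y Z) : Y.Mod M := by
  intro v hv hvM x hx hxM y hy hyM ha
  rcases h v (Or.inl hv) hvM x (Or.inl hx) hxM y (Or.inl hy) hyM (Or.inl ha) with h | h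
  · exact h
  · exact absurd (Z.mem h) (hd v hv)

theorem Mod.parR {Y Z : SG α} {M : Set α} (h : (Y.par Z).Mod M) (hd : Dj Y Z) : Z.Mod M := by
  rw [par_comm] at h
  exact h.parL hd.symm

theorem Mod.congr {T : SG α} {M N : Set α} (h : T.Mod M) (hMN : ∀ x, x ∈ T.V → (x ∈ M ↔ x ∈ N)) :
    T.Mod N := by
  intro v hv hvM x hx hxM y hy hyM ha
  exact h v hv (fun h' => hvM ((hMN v hv).1 h')) x hx ((hMN x hx).2 hxM) y hy ((hMN y hy).2 hyM) ha

theorem Dj.mono {G H G' H' : SG α} (h : Dj G H) (h1 : ∀ x, x ∈ G'.V → x ∈ G.V)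
    (h2 : ∀ x, x ∈ H'.V → x ∈ H.V) : Dj G' H' := fun x hx hx' => h x (h1 x hx) (h2 x hx')

def SplA (lab : α → Atom) (G Z P : SG α) (h : α → α) : Prop :=
  ∃ (K : SG α) (k : α → α), (∀ x, x ∈ K.V → k x ∈ P.V) ∧ CoC K P k ∧ Red lab K G ∧
    ∀ i, i ∈ P.V → Prov lab ((K.ind {x | k x = i}).par (Z.ind {x | h x = i}))

def SplB (lab : α → Atom) (G Z : SG α) (A : Set α) : Prop :=
  ∃ KA KB : SG α, Dj KA KB ∧ Red lab (KA.par KB) G ∧ Prov lab (KA.par (Z.ind A)) ∧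
    Prov lab (KB.par (Z.ind {x | x ∉ A}))

def Spl (lab : α → Atom) (G Z P : SG α) (h : α → α) : Prop :=
  SplA lab G Z P h ∨ ∃ i, i ∈ P.V ∧ SplB lab G Z {x | h x = i}

theorem SplB.red {G G' Z : SG α} {A : Set α} (h : SplB lab G Z A) (hr : Red lab G G') :
    SplB lab G' Z A := by
  obtain ⟨KA, KB, hd, h1, h2, h3⟩ := h
  exact ⟨KA, KB, hd, h1.trans hr, h2, h3⟩

theorem Spl.red {G G' Z P : SG α} {h : α → α} (hs : Spl lab G Z P h) (hr : Red lab G G') :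
    Spl lab G' Z P h := by
  rcases hs with ⟨K, k, h1, h2, h3, h4⟩ | ⟨i, hi, hB⟩
  · exact Or.inl ⟨K, k, h1, h2, h3.trans hr, h4⟩
  · exact Or.inr ⟨i, hi, hB.red hr⟩

theorem SplB.swap {G Z : SG α} {A A' : Set α} (h : SplB lab G Z A)
    (hA : ∀ x, x ∈ Z.V → (x ∈ A' ↔ x ∉ A)) : SplB lab G Z A' := by
  obtain ⟨KA, KB, hd, h1, h2, h3⟩ := h
  refine ⟨KB, KA, hd.symm, by rwa [par_comm], ?_, ?_⟩
  · rwa [ind_congr (S' := {x | x ∉ A}) (fun x hx => hA x hx)]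
  · rwa [ind_congr (S' := A)]
    intro x hx
    have := hA x hx
    simp only [Set.mem_ofPred_eq]
    tauto

theorem SplB.congr {G Z : SG α} {A A' : Set α} (h : SplB lab G Z A)
    (hA : ∀ x, x ∈ Z.V → (x ∈ A' ↔ x ∈ A)) : SplB lab G Z A' := by
  refine (h.swap (A' := {x | x ∉ A}) fun x hx => Iff.rfl).swap fun x hx => ?_
  have := hA x hx
  simp only [Set.mem_ofPred_eq]
  tauto

/-- Binary tensor splitting from the general form. -/
theorem tensOf {G Z : SG α} {A : Set α}
    (hS : ∀ P h, CP P → Comp Z P h → Spl lab G Z P h) (hp : Prov lab (G.par Z))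
    (hall : ∀ x y, x ∈ Z.V → y ∈ Z.V → x ∈ A → y ∉ A → Z.adj x y) : SplB lab G Z A := by
  by_cases h1 : ∃ a, a ∈ Z.V ∧ a ∈ A
  · by_cases h2 : ∃ a, a ∈ Z.V ∧ a ∉ A
    · obtain ⟨a, ha, haA⟩ := h1
      obtain ⟨b, hb, hbA⟩ := h2
      obtain ⟨P, t, hP, hC, haP, hbP, ht1, ht2, hor, hadj⟩ := split_aux ha haA hb hbA hall
      have hab : a ≠ b := by rintro rfl; exact hbA haA
      have eA : ∀ x, x ∈ Z.V → (x ∈ A ↔ x ∈ {x | t x = a}) := by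
        intro x hx
        have := ht1 x
        have := ht2 x
        simp only [Set.mem_ofPred_eq]
        grind
      have eB : ∀ x, x ∈ Z.V → (x ∈ A ↔ x ∉ {x | t x = b}) := by
        intro x hx
        have := ht1 x
        have := ht2 x
        simp only [Set.mem_ofPred_eq]
        grind
      rcases hS P t hP hC with ⟨K, k, k1, k2, k3, k4⟩ | ⟨i, hi, hB⟩
      · refine SplB.congr (A := {x | t x = a}) ?_ eA
        refine ⟨K.ind {x | k x = a}, K.ind {x | k x = b}, ?_, ?_, k4 a haP, ?_⟩
        · intro x hx hx'
          exact hab (hx.2.symm.trans hx'.2)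
        · have e : (K.ind {x | k x = a}).par (K.ind {x | k x = b}) = K := by
            have hadj' := P.symm hadj
            apply ext' <;> simp only [mem_par, adj_par, mem_ind, adj_ind, Set.mem_ofPred_eq]
            · intro x
              have := k1 x
              have := hor (k x)
              grind
            · intro x y
              have a1 := k1 x
              have a2 := hor (k x)
              have a3 := k1 y
              have a4 := hor (k y)
              have a5 := k2 x y
              grind
          rwa [e]
        · rw [ind_congr (Z := Z) (S' := {x | t x = b})]
          · exact k4 b hbP
          · intro x hx
            have e1 := eA x hx
            have e2 := eB x hx
            simp only [Set.mem_ofPred_eq] at *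
            tauto
      · rcases hor i hi with rfl | rfl
        · exact hB.congr eA
        · exact hB.swap eB
    · push Not at h2
      refine ⟨G, emp, fun _ _ h => h, ?_, ?_, ?_⟩
      · rw [par_emp]; exact Red.refl _
      · rwa [ind_self h2]
      · rw [ind_emp, par_emp]
        · exact Prov.emp
        · intro x hx hx'
          exact hx' (h2 x hx)
  · push Not at h1
    refine ⟨emp, G, fun _ h _ => h, ?_, ?_, ?_⟩
    · rw [emp_par]; exact Red.refl _
    · rw [ind_emp h1, par_emp]; exact Prov.emp
    · rwa [ind_self (S := {x | x ∉ A}) h1]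

/-- The induction hypothesis on graphs whose vertex set is properly contained in `B`. -/
def IH (lab : α → Atom) (B : Set α) : Prop :=
  ∀ (G Z P : SG α) (h : α → α), (∀ x, x ∈ G.V → x ∈ B) → (∀ x, x ∈ Z.V → x ∈ B) →
    (∃ b, b ∈ B ∧ b ∉ G.V ∧ b ∉ Z.V) → Prov lab (G.par Z) → Dj G Z → CP P → Comp Z P h →
    Spl lab G Z P h

theorem cocIns {K P X : SG α} {k : α → α} {j : α} (hk : ∀ x, x ∈ K.V → k x ∈ P.V)
    (cK : CoC K P k) (hj : j ∈ P.V) (hd : Dj K X) :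
    ∃ (K' : SG α) (k' : α → α), (∀ x, x ∈ K'.V → k' x ∈ P.V) ∧ CoC K' P k' ∧
      Drv lab K' (K.par X) ∧ K'.ind {x | k' x = j} = (K.ind {x | k x = j}).par X ∧
      (∀ i, i ≠ j → K'.ind {x | k' x = i} = K.ind {x | k x = i}) ∧
      (∀ x, x ∈ K'.V ↔ x ∈ K.V ∨ x ∈ X.V) ∧ (∀ x, x ∉ X.V → k' x = k x) ∧
      (∀ x, x ∈ X.V → k' x = j) := by
  classical
  have hd' := hd
  unfold Dj at hd
  unfold CoC at cK
  have hs : P.adj = fun x y => P.adj y x := by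
    funext x y
    exact propext ⟨P.symm, P.symm⟩
  have hs' : ∀ x y, P.adj x y → P.adj y x := fun x y => P.symm
  refine ⟨K.plug {x | k x ≠ j ∧ ¬ P.adj (k x) j} X, fun x => if x ∈ X.V then j else k x,
    ?_, ?_, ssPlug _ _ _ hd', ?_, ?_, ?_, ?_, ?_⟩
  · intro x hx
    have := hk x
    simp only [mem_plug] at hx
    grind
  · intro x y hx hy hxy
    have c1 := cK x y
    have d1 := hd x
    have d2 := hd y
    have k1 := hs' (k x) j
    have k2 := hs' j (k x)
    have k3 := hs' (k y) j
    have k4 := hs' j (k y)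
    clear hs hs' cK hd
    simp only [mem_plug, adj_plug, Set.mem_ofPred_eq] at *
    have m1 := fun h => K.mem (x := x) (y := y) h
    have m2 := fun h => K.mem' (x := x) (y := y) h
    have m3 := fun h => X.mem (x := x) (y := y) h
    have m4 := fun h => X.mem' (x := x) (y := y) h
    by_cases hxX : x ∈ X.V <;> by_cases hyX : y ∈ X.V <;> simp only [hxX, hyX, if_true, if_false] at * <;> grind
  · apply ext' <;> simp only [mem_plug, adj_plug, mem_ind, adj_ind, mem_par, adj_par, Set.mem_ofPred_eq]
    · intro x
      have d1 := hd x
      grind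
    · intro x y
      have d1 := hd x
      have d2 := hd y
      have m1 := fun h => K.mem (x := x) (y := y) h
      have m2 := fun h => K.mem' (x := x) (y := y) h
      have m3 := fun h => X.mem (x := x) (y := y) h
      have m4 := fun h => X.mem' (x := x) (y := y) h
      by_cases hxX : x ∈ X.V <;> by_cases hyX : y ∈ X.V <;> simp only [hxX, hyX, if_true, if_false] at * <;> grind
  · intro i hij
    apply ext' <;> simp only [mem_plug, adj_plug, mem_ind, adj_ind, mem_par, adj_par, Set.mem_ofPred_eq]
    · intro x
      have d1 := hd x
      grind
    · intro x y
      have d1 := hd x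
      have d2 := hd y
      have m1 := fun h => K.mem (x := x) (y := y) h
      have m2 := fun h => K.mem' (x := x) (y := y) h
      have m3 := fun h => X.mem (x := x) (y := y) h
      have m4 := fun h => X.mem' (x := x) (y := y) h
      by_cases hxX : x ∈ X.V <;> by_cases hyX : y ∈ X.V <;> simp only [hxX, hyX, if_true, if_false] at * <;> grind
  · intro x; rfl
  · intro x hx
    simp [hx]
  · intro x hx
    simp [hx]

end SG
end

section
namespace SG

variable {α : Type} {lab : α → Atom}

theorem Prov.cast {X Y : SG α} (h : Prov lab X) (e : X = Y) : Prov lab Y := e ▸ h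
theorem Red.cast {X X' Y : SG α} (h : Red lab X Y) (e : X = X') : Red lab X' Y := e ▸ h
theorem Red.cast' {X Y Y' : SG α} (h : Red lab X Y) (e : Y = Y') : Red lab X Y' := e ▸ h

/-- Merge along a module, relative version. -/
theorem provMerge' {Z KX KY : SG α} {M S : Set α} (hM : Z.Mod M) (hd : Dj KX Z) (hd2 : Dj KY Z)
    (hd3 : Dj KX KY) (hp : Prov lab (KX.par (Z.ind {x | x ∈ M ∧ x ∈ S})))
    (hp2 : Prov lab (KY.par (Z.ind {x | x ∉ M ∧ x ∈ S}))) :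
    Prov lab ((KX.par KY).par (Z.ind S)) := by
  refine provMerge (M := M) (hM.ind S) (hd.mono (fun _ h => h) fun _ h => h.1)
    (hd2.mono (fun _ h => h) fun _ h => h.1) hd3 ?_ ?_
  · rw [ind_ind]
    refine hp.cast ?_
    congr 1
    exact ind_congr fun x _ => and_comm
  · rw [ind_ind]
    refine hp2.cast ?_
    congr 1
    exact ind_congr fun x _ => and_comm

theorem comb [Finite α] {B : Set α} (ih : IH lab B) {Z P KX KY : SG α} {h : α → α} {M : Set α}
    (hP : CP P) (hZ : Comp Z P h) (hM : Z.Mod M) (hm : ∃ m, m ∈ Z.V ∧ m ∈ M)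
    (hw : ∃ w, w ∈ Z.V ∧ w ∉ M) (hd : Dj KX KY) (hdX : Dj KX Z) (hdY : Dj KY Z)
    (bX : ∀ x, x ∈ KX.V → x ∈ B) (bY : ∀ x, x ∈ KY.V → x ∈ B) (bZ : ∀ x, x ∈ Z.V → x ∈ B)
    (hpX : Prov lab (KX.par (Z.ind M))) (hpY : Prov lab (KY.par (Z.ind {x | x ∉ M}))) :
    Spl lab (KX.par KY) Z P h := by
  obtain ⟨m, hmZ, hmM⟩ := hm
  obtain ⟨w, hwZ, hwM⟩ := hw
  have sX : ∃ b, b ∈ B ∧ b ∉ KX.V ∧ b ∉ (Z.ind M).V :=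
    ⟨w, bZ w hwZ, fun h' => hdX w h' hwZ, fun h' => hwM h'.2⟩
  have sY : ∃ b, b ∈ B ∧ b ∉ KY.V ∧ b ∉ (Z.ind {x | x ∉ M}).V :=
    ⟨m, bZ m hmZ, fun h' => hdY m h' hmZ, fun h' => h'.2 hmM⟩
  by_cases hone : ∀ x, x ∈ Z.V → x ∈ M → h x = h m
  · by_cases hfull : ∀ x, x ∈ Z.V → h x = h m → x ∈ M
    · right
      have e : ∀ x, x ∈ Z.V → (x ∈ {x | h x = h m} ↔ x ∈ M) :=
        fun x hx => ⟨hfull x hx, hone x hx⟩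
      refine ⟨h m, hZ.1 m hmZ, SplB.congr (A := M) ?_ e⟩
      exact ⟨KX, KY, hd, Red.refl _, hpX, hpY⟩
    · push Not at hfull
      obtain ⟨u, huZ, huh, huM⟩ := hfull
      have hZ' : Comp (Z.ind {x | x ∉ M}) P h := by
        refine ⟨fun x hx => hZ.1 x hx.1, fun i hi => ?_, ?_⟩
        · obtain ⟨x, hx, hxi⟩ := hZ.2.1 i hi
          by_cases hxM : x ∈ M
          · exact ⟨u, ⟨huZ, huM⟩, by rw [huh, ← hone x hx hxM, hxi]⟩
          · exact ⟨x, ⟨hx, hxM⟩, hxi⟩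
        · intro x y hx hy hxy
          rw [← hZ.2.2 x y hx.1 hy.1 hxy]
          exact ⟨fun h => h.1, fun h => ⟨h, hx.2, hy.2⟩⟩
      have hdY' : Dj KY (Z.ind {x | x ∉ M}) := hdY.mono (fun _ h => h) fun _ h => h.1
      have eM : Z.ind M = Z.ind {x | x ∈ M ∧ x ∈ {x | h x = h m}} :=
        ind_congr fun x hx => ⟨fun h' => ⟨h', hone x hx h'⟩, fun h' => h'.1⟩
      rcases ih KY (Z.ind {x | x ∉ M}) P h bY (fun x hx => bZ x hx.1) sY hpY hdY' hP hZ' with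
        ⟨K, k, k1, k2, k3, k4⟩ | ⟨i, hi, KA, KB, b1, b2, b3, b4⟩
      · left
        have hsub := k3.sub
        have hKX : Dj K KX := hd.symm.mono hsub fun _ h => h
        obtain ⟨K', k', e1, e2, e3, e4, e5, -, -, -⟩ :=
          cocIns (lab := lab) k1 k2 (hZ.1 m hmZ) hKX
        refine ⟨K', k', e1, e2, e3.red.trans ?_, ?_⟩
        · rw [par_comm KX]
          exact k3.par KX hd.symm
        · intro i hi
          by_cases him : i = h m
          · subst him
            rw [e4, par_comm _ KX]
            refine provMerge' hM hdX ?_ ?_ (by rwa [← eM]) ?_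
            · exact hdY.mono (fun x hx => hsub x hx.1) fun _ h => h
            · exact hKX.symm.mono (fun _ h => h) fun x hx => hx.1
            · have := k4 _ hi
              rwa [ind_ind] at this
          · rw [e5 i him]
            have := k4 i hi
            rw [ind_ind] at this
            refine this.cast ?_
            congr 1
            refine ind_congr fun x hx => ⟨fun h' => h'.2, fun h' => ⟨fun h'' => him ?_, h'⟩⟩
            exact (show h x = i from h').symm.trans (hone x hx h'')
      · right
        have hsub := b2.sub
        have dA : Dj KX KA := hd.mono (fun _ h => h) fun x hx => hsub x (Or.inl hx)
        have dB : Dj KX KB := hd.mono (fun _ h => h) fun x hx => hsub x (Or.inr hx)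
        have dA' : Dj KA Z := hdY.mono (fun x hx => hsub x (Or.inl hx)) fun _ h => h
        have dB' : Dj KB Z := hdY.mono (fun x hx => hsub x (Or.inr hx)) fun _ h => h
        have hr : Red lab (KX.par (KA.par KB)) (KX.par KY) := b2.par' KX hd.symm
        rw [ind_ind] at b3 b4
        by_cases him : i = h m
        · subst him
          refine ⟨h m, hi, KX.par KA, KB, ?_, ?_, ?_, ?_⟩
          · rintro x (hx | hx) hx'
            · exact dB x hx hx'
            · exact b1 x hx hx'
          · rwa [par_assoc]
          · exact provMerge' hM hdX dA' dA (by rwa [← eM]) b3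
          · refine b4.cast ?_
            congr 1
            exact ind_congr fun x hx => ⟨fun h' => h'.2, fun h' => ⟨fun h'' => h' (hone x hx h''), h'⟩⟩
        · refine ⟨i, hi, KA, KX.par KB, ?_, ?_, ?_, ?_⟩
          · rintro x hx (hx' | hx')
            · exact dA x hx' hx
            · exact b1 x hx hx'
          · rwa [← par_assoc, par_comm KA KX, par_assoc]
          · refine b3.cast ?_
            congr 1
            refine ind_congr fun x hx => ⟨fun h' => h'.2, fun h' => ⟨fun h'' => him ?_, h'⟩⟩
            exact (show h x = i from h').symm.trans (hone x hx h'')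
          · refine provMerge' hM hdX dB' dB ?_ b4
            refine hpX.cast ?_
            congr 1
            refine ind_congr fun x hx => ⟨fun h' => ⟨h', fun h'' => him ?_⟩, fun h' => h'.1⟩
            exact (show h x = i from h'').symm.trans (hone x hx h')
  · push Not at hone
    obtain ⟨u, huZ, huM, huh⟩ := hone
    rcases hP with hP | ⟨a, b, hab, hV, hadj⟩
    · exact absurd (primeMod hP.1 hP.2 hZ hM huZ huM hmZ hmM huh w hwZ) hwM
    · have hadj' := P.symm hadj
      have hall : ∀ x y, x ∈ Z.V → y ∈ Z.V → x ∈ {x | h x = a} → y ∉ {x | h x = a} →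
          Z.adj x y := by
        intro x y hx hy hxa hya
        have e1 : h x = a := hxa
        have e2 : h y = b := ((hV _).1 (hZ.1 y hy)).resolve_left hya
        rw [hZ.2.2 x y hx hy (by rw [e1, e2]; exact hab), e1, e2]
        exact hadj
      have s1 : SplB lab KX (Z.ind M) {x | h x = a} := by
        refine tensOf (fun P' h' hP' hC' => ?_) hpX ?_
        · exact ih _ _ _ _ bX (fun x hx => bZ x hx.1) sX hpX
            (hdX.mono (fun _ h => h) fun _ h => h.1) hP' hC'
        · exact fun x y hx hy hxa hya => ⟨hall x y hx.1 hy.1 hxa hya, hx.2, hy.2⟩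
      have s2 : SplB lab KY (Z.ind {x | x ∉ M}) {x | h x = a} := by
        refine tensOf (fun P' h' hP' hC' => ?_) hpY ?_
        · exact ih _ _ _ _ bY (fun x hx => bZ x hx.1) sY hpY
            (hdY.mono (fun _ h => h) fun _ h => h.1) hP' hC'
        · exact fun x y hx hy hxa hya => ⟨hall x y hx.1 hy.1 hxa hya, hx.2, hy.2⟩
      obtain ⟨X1, X2, x1, x2, x3, x4⟩ := s1
      obtain ⟨Y1, Y2, y1, y2, y3, y4⟩ := s2
      rw [ind_ind] at x3 x4 y3 y4
      have sx := x2.sub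
      have sy := y2.sub
      have dd : Dj (X1.par X2) (Y1.par Y2) := hd.mono sx sy
      right
      refine ⟨a, (hV a).2 (Or.inl rfl), X1.par Y1, X2.par Y2, ?_, ?_, ?_, ?_⟩
      · rintro x (hx | hx) (hx' | hx')
        · exact x1 x hx hx'
        · exact dd x (Or.inl hx) (Or.inr hx')
        · exact dd x (Or.inr hx') (Or.inl hx)
        · exact y1 x hx hx'
      · have e : (X1.par Y1).par (X2.par Y2) = (X1.par X2).par (Y1.par Y2) := by
          rw [par_assoc, ← par_assoc Y1, par_comm Y1 X2, par_assoc X2, ← par_assoc]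
        rw [e]
        exact (x2.par _ (hd.mono (fun _ h => h) sy)).trans (y2.par' _ hd.symm)
      · exact provMerge' hM (hdX.mono (fun x hx => sx x (Or.inl hx)) fun _ h => h)
          (hdY.mono (fun x hx => sy x (Or.inl hx)) fun _ h => h)
          (dd.mono (fun x hx => Or.inl hx) fun x hx => Or.inl hx) x3 y3
      · exact provMerge' hM (hdX.mono (fun x hx => sx x (Or.inr hx)) fun _ h => h)
          (hdY.mono (fun x hx => sy x (Or.inr hx)) fun _ h => h)
          (dd.mono (fun x hx => Or.inr hx) fun x hx => Or.inr hx) x4 y4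

/-- Splitting across a module. -/
theorem splMod [Finite α] {B : Set α} (ih : IH lab B) {Y' Z P KX KY : SG α} {h : α → α} {M : Set α}
    (hP : CP P) (hZ : Comp Z P h) (hYZ : Dj Y' Z) (hM : (Y'.par Z).Mod M)
    (hd : Dj KX KY) (hdX : Dj KX (Y'.par Z)) (hdY : Dj KY (Y'.par Z))
    (bX : ∀ x, x ∈ KX.V → x ∈ B) (bY : ∀ x, x ∈ KY.V → x ∈ B) (bZ : ∀ x, x ∈ Z.V → x ∈ B)
    (bY' : ∀ x, x ∈ Y'.V → x ∈ B)
    (sX : ∃ b, b ∈ B ∧ b ∉ KX.V ∧ b ∉ ((Y'.par Z).ind M).V)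
    (sY : ∃ b, b ∈ B ∧ b ∉ KY.V ∧ b ∉ ((Y'.par Z).ind {x | x ∉ M}).V)
    (hpX : Prov lab (KX.par ((Y'.par Z).ind M)))
    (hpY : Prov lab (KY.par ((Y'.par Z).ind {x | x ∉ M}))) :
    Spl lab ((KX.par KY).par Y') Z P h := by
  have dX1 : Dj KX Y' := hdX.mono (fun _ h => h) fun _ h => Or.inl h
  have dX2 : Dj KX Z := hdX.mono (fun _ h => h) fun _ h => Or.inr h
  have dY1 : Dj KY Y' := hdY.mono (fun _ h => h) fun _ h => Or.inl h
  have dY2 : Dj KY Z := hdY.mono (fun _ h => h) fun _ h => Or.inr h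
  by_cases h1 : ∀ x, x ∈ Z.V → x ∉ M
  · have e1 : (Y'.par Z).ind M = Y'.ind M := by rw [par_ind, ind_emp h1, par_emp]
    have e2 : (Y'.par Z).ind {x | x ∉ M} = (Y'.ind {x | x ∉ M}).par Z := by
      rw [par_ind, ind_self (Z := Z) (S := {x | x ∉ M}) h1]
    rw [e1] at hpX
    rw [e2, ← par_assoc] at hpY
    obtain ⟨b, hb, hb1, hb2⟩ := sY
    rw [e2] at hb2
    have := ih (KY.par (Y'.ind {x | x ∉ M})) Z P h (by
      rintro x (hx | hx)
      · exact bY x hx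
      · exact bY' x hx.1) bZ ⟨b, hb, by
        rintro (h' | h')
        · exact hb1 h'
        · exact hb2 (Or.inl h'), fun h' => hb2 (Or.inr h')⟩ hpY (by
        rintro x (hx | hx)
        · exact dY2 x hx
        · exact hYZ x hx.1) hP hZ
    refine this.red (Drv.red ?_)
    have hh := (mergeIns (hM.parL hYZ) dX1 hpX).parR KY (by
      rintro x hx (hx' | hx')
      · exact hd x hx' hx
      · exact dY1 x hx hx')
    rwa [← par_assoc KY, par_comm KY KX] at hh
  by_cases h2 : ∀ x, x ∈ Z.V → x ∈ M
  · have e1 : (Y'.par Z).ind M = (Y'.ind M).par Z := by rw [par_ind, ind_self h2]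
    have e2 : (Y'.par Z).ind {x | x ∉ M} = Y'.ind {x | x ∉ M} := by
      rw [par_ind, ind_emp (Z := Z) (S := {x | x ∉ M}) (fun x hx h' => h' (h2 x hx)), par_emp]
    rw [e1, ← par_assoc] at hpX
    rw [e2] at hpY
    obtain ⟨b, hb, hb1, hb2⟩ := sX
    rw [e1] at hb2
    have := ih (KX.par (Y'.ind M)) Z P h (by
      rintro x (hx | hx)
      · exact bX x hx
      · exact bY' x hx.1) bZ ⟨b, hb, by
        rintro (h' | h')
        · exact hb1 h'
        · exact hb2 (Or.inl h'), fun h' => hb2 (Or.inr h')⟩ hpX (by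
        rintro x (hx | hx)
        · exact dX2 x hx
        · exact hYZ x hx.1) hP hZ
    exact this.red (mergeCtx (hM.parL hYZ) dX1 dY1 hd hpY)
  push Not at h1 h2
  obtain ⟨u, huZ, huM⟩ := h1
  obtain ⟨w, hwZ, hwM⟩ := h2
  have eZ : (Y'.par Z).ind Z.V = Z := by
    rw [par_ind, ind_emp hYZ, emp_par, ind_self fun x hx => hx]
  have hin := modInComp (Y := Y'.par Z) (Z := Z.V) (M := M) (by rw [eZ]; exact connCP hP hZ) (by
    rintro x y (ha | ha) hx
    · exact absurd hx (hYZ x (Y'.mem ha))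
    · exact Z.mem' ha) hM (Or.inr huZ) huZ huM (Or.inr hwZ) hwZ hwM
  have hout : ∀ x, x ∈ Y'.V → x ∉ M := fun x hx hxM => hYZ x hx (hin x (Or.inl hx) hxM)
  have e1 : (Y'.par Z).ind M = Z.ind M := by rw [par_ind, ind_emp hout, emp_par]
  have e2 : (Y'.par Z).ind {x | x ∉ M} = Y'.par (Z.ind {x | x ∉ M}) := by
    rw [par_ind, ind_self (Z := Y') (S := {x | x ∉ M}) hout]
  rw [e1] at hpX
  rw [e2, ← par_assoc] at hpY
  rw [par_assoc]
  refine comb ih hP hZ (hM.parR hYZ) ⟨u, huZ, huM⟩ ⟨w, hwZ, hwM⟩ ?_ dX2 ?_ bX ?_ bZ hpX hpY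
  · rintro x hx (hx' | hx')
    · exact hd x hx hx'
    · exact dX1 x hx hx'
  · rintro x (hx | hx) hx'
    · exact dY2 x hx hx'
    · exact hYZ x hx hx'
  · rintro x (hx | hx)
    · exact bY x hx
    · exact bY' x hx

end SG
end

section
namespace SG

variable {α : Type} {lab : α → Atom}

theorem Cm.ind {Y Q : SG α} {h : α → α} (c : Cm Y Q h) (S : Set α) : Cm (Y.ind S) Q h := by
  intro x y hx hy hxy
  rw [← c x y hx.1 hy.1 hxy]
  exact ⟨fun h => h.1, fun h => ⟨h, hx.2, hy.2⟩⟩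

theorem CoC.ind {Y Q : SG α} {h : α → α} (c : CoC Y Q h) (S : Set α) : CoC (Y.ind S) Q h := by
  intro x y hx hy hxy
  rw [← c x y hx.1 hy.1 hxy]
  exact ⟨fun h => h.1, fun h => ⟨h, hx.2, hy.2⟩⟩

theorem Cm.parR {Y' Z Q : SG α} {h : α → α} (c : Cm (Y'.par Z) Q h) (hd : Dj Y' Z) : Cm Z Q h := by
  intro x y hx hy hxy
  rw [← c x y (Or.inr hx) (Or.inr hy) hxy]
  refine ⟨Or.inr, fun h => h.resolve_left fun h => hd x (Y'.mem h) hx⟩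

theorem Cm.parL {Y' Z Q : SG α} {h : α → α} (c : Cm (Y'.par Z) Q h) (hd : Dj Y' Z) :
    Cm Y' Q h := by
  rw [par_comm] at c
  exact c.parR hd.symm

theorem Cm.mod {Y Q : SG α} {h : α → α} (c : Cm Y Q h) (i : α) : Y.Mod {x | h x = i} := by
  intro v hv hvi x hx hxi y hy hyi ha
  have e1 : h x = i := hxi
  have e2 : h y = i := hyi
  have e3 : h v ≠ i := hvi
  rw [c v x hv hx (by rwa [e1]), e1] at ha
  rwa [c v y hv hy (by rwa [e2]), e2]

/-- The core case: all indices occur in the connected graph `Z`. -/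
theorem splCore [Finite α] {B : Set α} (ih : IH lab B) {X Z Q P : SG α} {t h : α → α}
    (hd : Dj X Z) (hX : ∀ x, x ∈ X.V → ∃ z, z ∈ Z.V ∧ t z = t x) (hZt : ∀ z, z ∈ Z.V → t z ∈ Q.V)
    (cX : CoC X Q t) (cZ : Cm Z Q t)
    (hp : ∀ i, i ∈ Q.V → Prov lab ((X.par Z).ind {x | t x = i}))
    (bX : ∀ x, x ∈ X.V → x ∈ B) (bZ : ∀ x, x ∈ Z.V → x ∈ B)
    (hP : CP P) (hZ : Comp Z P h)
    (hnot : ∀ i, ∃ z, z ∈ Z.V ∧ t z ≠ i) : Spl lab X Z P h := by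
  classical
  have hXt : ∀ x, x ∈ X.V → t x ∈ Q.V := by
    intro x hx
    obtain ⟨z, hz, e⟩ := hX x hx
    rw [← e]
    exact hZt z hz
  -- sub-families are provable
  have hsub : ∀ S : Set α, (∀ x y, (x ∈ X.V ∨ x ∈ Z.V) → (y ∈ X.V ∨ y ∈ Z.V) → t x = t y →
      x ∈ S → y ∈ S) → Prov lab ((X.ind S).par (Z.ind S)) := by
    intro S hS
    refine genpProv (Q := Q) (h := t) (hd.mono (fun _ h => h.1) fun _ h => h.1)
      (fun x hx => hXt x hx.1) (fun x hx => hZt x hx.1) (cX.ind S) (cZ.ind S) fun i hi => ?_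
    rw [← par_ind, ind_ind]
    by_cases hne : ∃ x, (x ∈ X.V ∨ x ∈ Z.V) ∧ t x = i ∧ x ∈ S
    · obtain ⟨x, hx, hxi, hxS⟩ := hne
      refine (hp i hi).cast ?_
      refine ind_congr fun y hy => ⟨fun h' => ⟨?_, h'⟩, fun h' => h'.2⟩
      exact hS x y hx hy (hxi.trans (show t y = i from h').symm) hxS
    · refine Prov.emp.cast (ind_emp ?_).symm
      rintro x hx ⟨h1, h2⟩
      exact hne ⟨x, hx, h2, h1⟩
  by_cases hfib : ∀ x y, x ∈ Z.V → y ∈ Z.V → t x = t y → h x = h y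
  · left
    obtain ⟨κ, hκ⟩ : ∃ κ : α → α, ∀ z, z ∈ Z.V → κ (t z) = h z := by
      refine ⟨fun i => if hi : ∃ z, z ∈ Z.V ∧ t z = i then h hi.choose else i, fun z hz => ?_⟩
      have hi : ∃ z', z' ∈ Z.V ∧ t z' = t z := ⟨z, hz, rfl⟩
      simp only [dif_pos hi]
      exact hfib _ _ hi.choose_spec.1 hz hi.choose_spec.2
    refine ⟨X, fun x => κ (t x), ?_, ?_, Red.refl _, ?_⟩
    · intro x hx
      obtain ⟨z, hz, e⟩ := hX x hx
      simp only [← e, hκ z hz]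
      exact hZ.1 z hz
    · intro x y hx hy hxy
      obtain ⟨z, hz, e⟩ := hX x hx
      obtain ⟨z', hz', e'⟩ := hX y hy
      simp only [← e, ← e', hκ z hz, hκ z' hz'] at hxy ⊢
      have hne : t z ≠ t z' := fun h' => hxy (hfib z z' hz hz' h')
      rw [cX x y hx hy (by rwa [← e, ← e']), ← e, ← e', ← cZ z z' hz hz' hne,
        hZ.2.2 z z' hz hz' hxy]
    · intro i hi
      have := hsub {x | κ (t x) = i} (by
        intro x y _ _ hxy hx
        simp only [Set.mem_ofPred_eq] at *
        rwa [← hxy])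
      refine this.cast ?_
      congr 1
      refine ind_congr fun x hx => ?_
      simp only [Set.mem_ofPred_eq, hκ x hx]
  · push Not at hfib
    obtain ⟨u, v, hu, hv, huv, hne⟩ := hfib
    obtain ⟨w, hw, hwu⟩ := hnot (t u)
    have hM := cZ.mod (t u)
    rcases hP with hP | ⟨a, b, hab, hV, hadj⟩
    · exact absurd (primeMod hP.1 hP.2 hZ hM hu rfl hv huv.symm hne w hw) hwu
    have hadj' := P.symm hadj
    have hall : ∀ x y, x ∈ Z.V → y ∈ Z.V → h x ≠ h y → Z.adj x y := by
      intro x y hx hy hxy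
      rw [hZ.2.2 x y hx hy hxy]
      have a1 := (hV _).1 (hZ.1 x hx)
      have a2 := (hV _).1 (hZ.1 y hy)
      rcases a1 with a1 | a1 <;> rcases a2 with a2 | a2 <;> rw [a1, a2] at hxy ⊢
      · exact absurd rfl hxy
      · exact hadj
      · exact hadj'
      · exact absurd rfl hxy
    have hQ : ∀ j, (∃ z, z ∈ Z.V ∧ t z = j) → j ≠ t u → Q.adj (t u) j := by
      rintro _ ⟨z, hz, rfl⟩ hj
      by_cases hz1 : h z = h u
      · have := (cZ v z hv hz (by rw [← huv]; exact hj.symm)).1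
          (hall v z hv hz (by rw [hz1]; exact hne.symm))
        rwa [← huv] at this
      · exact (cZ u z hu hz hj.symm).1 (hall u z hu hz (Ne.symm hz1))
    have e : X = (X.ind {x | t x = t u}).par (X.ind {x | x ∉ {x | t x = t u}}) := by
      apply ext' <;> simp only [mem_par, adj_par, mem_ind, adj_ind, Set.mem_ofPred_eq]
      · intro x; tauto
      · intro x y
        constructor
        · intro ha
          have k1 := cX x y (X.mem ha) (X.mem' ha)
          have k2 := hQ (t y) (hX y (X.mem' ha))
          have k3 := fun h => Q.symm (hQ (t x) (hX x (X.mem ha)) h)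
          by_cases e1 : t x = t u <;> by_cases e2 : t y = t u
          · exact Or.inl ⟨ha, e1, e2⟩
          · exact absurd (by rw [e1]; exact k2 e2) ((k1 (by rw [e1]; exact Ne.symm e2)).1 ha)
          · exact absurd (by rw [e2]; exact k3 e1) ((k1 (by rw [e2]; exact e1)).1 ha)
          · exact Or.inr ⟨ha, e1, e2⟩
        · rintro (h' | h')
          · exact h'.1
          · exact h'.1
    rw [e]
    refine comb ih (Or.inr ⟨a, b, hab, hV, hadj⟩) hZ hM ⟨u, hu, rfl⟩ ⟨w, hw, hwu⟩
      (fun x hx hx' => hx'.2 hx.2) (hd.mono (fun _ h => h.1) fun _ h => h)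
      (hd.mono (fun _ h => h.1) fun _ h => h) (fun x hx => bX x hx.1) (fun x hx => bX x hx.1) bZ
      (hsub _ ?_) (hsub _ ?_)
    · intro x y _ _ hxy hx
      simp only [Set.mem_ofPred_eq] at *
      rwa [← hxy]
    · intro x y _ _ hxy hx
      simp only [Set.mem_ofPred_eq] at *
      rwa [← hxy]

/-- Splitting a generalised `p` configuration. -/
theorem splP [Finite α] {B : Set α} (ih : IH lab B) {X Y' Z Q P : SG α} {t h : α → α}
    (hd : Dj X (Y'.par Z)) (hYZ : Dj Y' Z)
    (hX : ∀ x, x ∈ X.V → t x ∈ Q.V) (hY : ∀ x, x ∈ (Y'.par Z).V → t x ∈ Q.V)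
    (cX : CoC X Q t) (cY : Cm (Y'.par Z) Q t)
    (hp : ∀ i, i ∈ Q.V → Prov lab ((X.par (Y'.par Z)).ind {x | t x = i}))
    (hs : ∀ i, i ∈ Q.V → ∃ b, b ∈ B ∧ b ∉ ((X.par (Y'.par Z)).ind {x | t x = i}).V)
    (bX : ∀ x, x ∈ X.V → x ∈ B) (bY' : ∀ x, x ∈ Y'.V → x ∈ B) (bZ : ∀ x, x ∈ Z.V → x ∈ B)
    (hP : CP P) (hZ : Comp Z P h) : Spl lab (X.par Y') Z P h := by
  have dY' : Dj X Y' := hd.mono (fun _ h => h) fun _ h => Or.inl h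
  have dZ : Dj X Z := hd.mono (fun _ h => h) fun _ h => Or.inr h
  have cY' := cY.parL hYZ
  have cZ := cY.parR hYZ
  have hY't : ∀ x, x ∈ Y'.V → t x ∈ Q.V := fun x hx => hY x (Or.inl hx)
  have hZt : ∀ x, x ∈ Z.V → t x ∈ Q.V := fun x hx => hY x (Or.inr hx)
  have hcon := connCP hP hZ
  by_cases hone : ∃ i, i ∈ Q.V ∧ ∀ z, z ∈ Z.V → t z = i
  · obtain ⟨i, hi, hone⟩ := hone
    have e : (X.par (Y'.par Z)).ind {x | t x = i} = ((X.par Y').ind {x | t x = i}).par Z := by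
      rw [← par_assoc, par_ind (X.par Y') Z, ind_self (Z := Z) (S := {x | t x = i}) hone]
    have hpi := hp i hi
    obtain ⟨b, hb, hb'⟩ := hs i hi
    rw [e] at hpi hb'
    have := ih ((X.par Y').ind {x | t x = i}) Z P h (by
      rintro x ⟨hx | hx, _⟩
      · exact bX x hx
      · exact bY' x hx) bZ ⟨b, hb, fun h' => hb' (Or.inl h'), fun h' => hb' (Or.inr h')⟩ hpi (by
      rintro x ⟨hx | hx, _⟩ hx'
      · exact dZ x hx hx'
      · exact hYZ x hx hx') hP hZ
    refine this.red (Drv.red (genp dY' hX hY't cX cY' hi fun j hj hji => ?_))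
    refine (hp j hj).cast ?_
    rw [← par_assoc, par_ind (X.par Y') Z, ind_emp (Z := Z) (S := {x | t x = j}), par_emp]
    intro z hz hzj
    exact hji ((show t z = j from hzj).symm.trans (hone z hz))
  -- the indices of `Z`
  obtain ⟨z0, hz0⟩ : ∃ z, z ∈ Z.V := by
    rcases hP with hP | ⟨a, b, hab, hV, hadj⟩
    · obtain ⟨a, _, _, ha, _⟩ := three_of_card hP.2
      exact (hZ.2.1 a ha).imp fun _ h => h.1
    · exact (hZ.2.1 a (P.mem hadj)).imp fun _ h => h.1
  have hnot : ∀ i, ∃ z, z ∈ Z.V ∧ t z ≠ i := by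
    intro i
    by_contra hc
    push Not at hc
    refine hone ⟨i, ?_, hc⟩
    rw [← hc z0 hz0]
    exact hZt z0 hz0
  have hsep : ∀ y z, y ∈ Y'.V → z ∈ Z.V → t y ≠ t z := by
    intro y z hy hz hyz
    obtain ⟨w, hw, hwz⟩ := hnot (t z)
    obtain ⟨u, v, hu, hv, ha⟩ := hcon {x | t x = t z} ⟨z, hz, rfl⟩ ⟨w, hw, hwz⟩
    have e1 : t u = t z := hu
    have e2 : t v ≠ t z := hv
    have a1 := (cZ u v (Z.mem ha) (Z.mem' ha) (by rw [e1]; exact e2.symm)).1 ha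
    rw [e1, ← hyz] at a1
    have a2 := (cY y v (Or.inl hy) (Or.inr (Z.mem' ha)) (by rw [hyz]; exact e2.symm)).2 a1
    rcases a2 with a2 | a2
    · exact hYZ v (Y'.mem' a2) (Z.mem' ha)
    · exact hYZ y hy (Z.mem a2)
  have hnadj : ∀ y z, y ∈ Y'.V → z ∈ Z.V → ¬ Q.adj (t y) (t z) := by
    intro y z hy hz ha
    rcases (cY y z (Or.inl hy) (Or.inr hz) (hsep y z hy hz)).2 ha with a2 | a2
    · exact hYZ z (Y'.mem' a2) hz
    · exact hYZ y hy (Z.mem a2)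
  have hcore : Spl lab (X.ind {x | ∃ z, z ∈ Z.V ∧ t z = t x}) Z P h := by
    refine splCore ih (Q := Q) (t := t) (dZ.mono (fun _ h => h.1) fun _ h => h) (fun x hx => hx.2)
      hZt (cX.ind _) cZ ?_ (fun x hx => bX x hx.1) bZ hP hZ hnot
    intro i hi
    by_cases hiU : ∃ z, z ∈ Z.V ∧ t z = i
    · obtain ⟨z, hz, rfl⟩ := hiU
      refine (hp _ hi).cast ?_
      rw [par_ind, par_ind, par_ind, ind_emp (Z := Y') (S := {x | t x = t z}), emp_par, ind_ind]
      · congr 1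
        exact ind_congr fun x hx => ⟨fun h' => ⟨⟨z, hz, (show t x = t z from h').symm⟩, h'⟩,
          fun h' => h'.2⟩
      · intro y hy
        exact hsep y z hy hz
    · refine Prov.emp.cast (ind_emp ?_).symm
      rintro x (hx | hx) hxi
      · obtain ⟨z, hz, e⟩ := hx.2
        exact hiU ⟨z, hz, e.trans hxi⟩
      · exact hiU ⟨x, hx, hxi⟩
  refine hcore.red (Drv.red ?_)
  -- reassembling
  have pE : Prov lab ((X.ind {x | ∃ y, y ∈ Y'.V ∧ t y = t x}).par Y') := by
    refine genpProv (Q := Q) (h := t) (dY'.mono (fun _ h => h.1) fun _ h => h)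
      (fun x hx => hX x hx.1) hY't (cX.ind _) cY' fun i hi => ?_
    by_cases hiE : ∃ y, y ∈ Y'.V ∧ t y = i
    · obtain ⟨y, hy, rfl⟩ := hiE
      refine (hp _ hi).cast ?_
      rw [← par_assoc, par_ind, par_ind, par_ind, ind_emp (Z := Z) (S := {x | t x = t y}), par_emp,
        ind_ind]
      · congr 1
        exact ind_congr fun x hx => ⟨fun h' => ⟨⟨y, hy, (show t x = t y from h').symm⟩, h'⟩,
          fun h' => h'.2⟩
      · intro z hz e
        exact hsep y z hy hz (show t z = t y from e).symm
    · refine Prov.emp.cast (ind_emp ?_).symm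
      rintro x (hx | hx) hxi
      · obtain ⟨z, hz, e⟩ := hx.2
        exact hiE ⟨z, hz, e.trans hxi⟩
      · exact hiE ⟨x, hx, hxi⟩
  have hUE : ∀ x, (∃ z, z ∈ Z.V ∧ t z = t x) → ¬ ∃ y, y ∈ Y'.V ∧ t y = t x := by
    rintro x ⟨z, hz, e⟩ ⟨y, hy, e'⟩
    exact hsep y z hy hz (e'.trans e.symm)
  have s1 := pE.insert (C := X.ind {x | ∃ z, z ∈ Z.V ∧ t z = t x}) Set.univ (by
    rintro x ⟨hx, hx'⟩ (hy | hy)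
    · exact hUE x hx' hy.2
    · exact dY' x hx hy)
  refine s1.trans ?_
  refine (plug_par_mod _ _ _ _ ?_ ?_ ?_).trans ?_
  · rintro x ⟨hx, hx'⟩ hy
    exact hUE x hx' hy.2
  · exact fun x hx => dY' x hx.1
  · exact fun x hx => dY' x hx.1
  have s2 := insMany (lab := lab) t {j | j ∈ Q.V ∧ ∀ y, y ∈ (Y'.par Z).V → t y ≠ j} (X.par Y') (by
    rintro j ⟨hj, hjY⟩ v hv hvj x hx hxj y hy hyj ha
    have e1 : t x = j := hxj
    have e2 : t y = j := hyj
    have e3 : t v ≠ j := hvj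
    have hxX : x ∈ X.V := hx.resolve_right fun h' => hjY x (Or.inl h') e1
    have hyX : y ∈ X.V := hy.resolve_right fun h' => hjY y (Or.inl h') e2
    rcases ha with ha | ha
    · left
      have hvX : v ∈ X.V := X.mem ha
      rw [cX v x hvX hxX (by rwa [e1]), e1] at ha
      rwa [cX v y hvX hyX (by rwa [e2]), e2]
    · exact absurd (Y'.mem' ha) (dY' x hxX)) (by
    rintro j ⟨hj, hjY⟩
    refine (hp j hj).cast ?_
    rw [par_ind X (Y'.par Z), par_ind X Y', ind_emp (Z := Y'.par Z) (S := {x | t x = j}) hjY,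
      ind_emp (Z := Y') (S := {x | t x = j}) (fun y hy => hjY y (Or.inl hy))])
  refine Drv.trans (Drv.of_eq ?_) s2
  rw [par_ind]
  have eY : Y'.ind {x | t x ∉ {j | j ∈ Q.V ∧ ∀ y, y ∈ (Y'.par Z).V → t y ≠ j}} = Y' :=
    ind_self fun x hx h' => h'.2 x (Or.inl hx) rfl
  rw [eY]
  congr 1
  have hkey : ∀ x, x ∈ X.V → ((t x ∉ {j | j ∈ Q.V ∧ ∀ y, y ∈ (Y'.par Z).V → t y ≠ j}) ↔
      ((∃ z, z ∈ Z.V ∧ t z = t x) ∨ ∃ y, y ∈ Y'.V ∧ t y = t x)) := by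
    intro x hx
    have := hX x hx
    constructor
    · intro h'
      by_contra hc
      push Not at hc
      exact h' ⟨this, fun y hy => hy.elim (hc.2 y) (hc.1 y)⟩
    · rintro (⟨z, hz, e⟩ | ⟨y, hy, e⟩) h'
      · exact h'.2 z (Or.inr hz) e
      · exact h'.2 y (Or.inl hy) e
  have hX' : X.ind {x | t x ∉ {j | j ∈ Q.V ∧ ∀ y, y ∈ (Y'.par Z).V → t y ≠ j}} =
      X.ind {x | (∃ z, z ∈ Z.V ∧ t z = t x) ∨ ∃ y, y ∈ Y'.V ∧ t y = t x} :=
    ind_congr hkey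
  rw [hX']
  have hfull : ∀ x y, x ∈ X.V → y ∈ X.V → (∃ z, z ∈ Z.V ∧ t z = t x) →
      (∃ z, z ∈ Y'.V ∧ t z = t y) → X.adj x y := by
    rintro x y hx hy ⟨z, hz, e⟩ ⟨w, hw, e'⟩
    rw [cX x y hx hy (by rw [← e, ← e']; exact (hsep w z hw hz).symm), ← e, ← e']
    exact fun h' => hnadj w z hw hz (Q.symm h')
  clear hkey hX' eY s2 s1 pE hcore hp hs
  generalize hU : {x | ∃ z, z ∈ Z.V ∧ t z = t x} = U
  generalize hE : {x | ∃ y, y ∈ Y'.V ∧ t y = t x} = E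
  have hUm : ∀ x, (∃ z, z ∈ Z.V ∧ t z = t x) ↔ x ∈ U := by
    intro x; rw [← hU]; rfl
  have hEm : ∀ x, (∃ y, y ∈ Y'.V ∧ t y = t x) ↔ x ∈ E := by
    intro x; rw [← hE]; rfl
  simp only [hUm, hEm] at hfull hUE ⊢
  apply ext' <;> simp only [mem_plug, adj_plug, mem_ind, adj_ind, Set.mem_ofPred_eq, Set.mem_univ]
  · intro x; tauto
  · intro x y
    have f1 := hfull x y
    have f2 := fun a b c d => X.symm (hfull y x a b c d)
    have f3 := hUE x
    have f4 := hUE y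
    have m1 := fun h => X.mem (x := x) (y := y) h
    have m2 := fun h => X.mem' (x := x) (y := y) h
    grind

end SG
end

section
namespace SG
variable {α : Type} {lab : α → Atom}

theorem eq_emp {Z : SG α} (h : ∀ x, x ∉ Z.V) : Z = emp := by
  apply ext'
  · exact fun x => ⟨h x, fun h' => h'.elim⟩
  · exact fun x y => ⟨fun h' => h x (Z.mem h'), fun h' => h'.elim⟩

theorem Prov.redEmp {G : SG α} (h : Prov lab G) : Red lab SG.emp G :=
  ⟨G, ∅, fun _ _ h => h, h, by rw [plug_emp]; exact Drv.refl _⟩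

theorem bigT [Finite α] {B : Set α} (ih : IH lab B) (t : α → α) (I : Set α) :
    ∀ (G Z : SG α), (∀ x, x ∈ G.V → x ∈ B) → (∀ x, x ∈ Z.V → x ∈ B) → Dj G Z →
    (∀ x, x ∈ Z.V → t x ∈ I) →
    (∀ P h, CP P → Comp Z P h → Spl lab G Z P h) → Prov lab (G.par Z) →
    (∀ x y, x ∈ Z.V → y ∈ Z.V → t x ≠ t y → Z.adj x y) →
    ∃ (K : SG α) (k : α → α), (∀ x, x ∈ K.V → k x ∈ I) ∧ Red lab K G ∧
      (∀ x y, K.adj x y → k x = k y) ∧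
      ∀ i, i ∈ I → Prov lab ((K.ind {x | k x = i}).par (Z.ind {x | t x = i})) := by
  classical
  induction I, Set.toFinite I using Set.Finite.induction_on with
  | empty =>
    intro G Z bG bZ hd hI hS hp hall
    have hZ : Z = emp := eq_emp fun x hx => (hI x hx).elim
    refine ⟨emp, id, fun x h => h.elim, ?_, fun x y h => h.elim, fun i h => h.elim⟩
    rw [hZ, par_emp] at hp
    exact hp.redEmp
  | @insert i I hi _ IHI =>
    intro G Z bG bZ hd hI hS hp hall
    by_cases hz : ∃ z, z ∈ Z.V ∧ t z = i
    · obtain ⟨z, hz, rfl⟩ := hz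
      obtain ⟨KA, KB, hdK, hr, pA, pB⟩ := tensOf (A := {x | t x = t z}) hS hp (by
        intro x y hx hy hxA hyA
        have e1 : t x = t z := hxA
        have e2 : t y ≠ t z := hyA
        exact hall x y hx hy (by rw [e1]; exact e2.symm))
      have sA : ∀ x, x ∈ KA.V → x ∈ G.V := fun x hx => hr.sub x (Or.inl hx)
      have sB : ∀ x, x ∈ KB.V → x ∈ G.V := fun x hx => hr.sub x (Or.inr hx)
      have dB : Dj KB (Z.ind {x | x ∉ {x | t x = t z}}) := hd.mono sB fun x hx => hx.1
      obtain ⟨K, k, hk, hrK, hc, hpK⟩ := IHI KB (Z.ind {x | x ∉ {x | t x = t z}})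
        (fun x hx => bG x (sB x hx)) (fun x hx => bZ x hx.1) dB
        (fun x hx => (hI x hx.1).resolve_left hx.2)
        (fun P h hP hC => ih KB _ P h (fun x hx => bG x (sB x hx)) (fun x hx => bZ x hx.1)
          ⟨z, bZ z hz, fun h' => hd z (sB z h') hz, fun h' => h'.2 rfl⟩ pB dB hP hC)
        pB (fun x y hx hy hxy => ⟨hall x y hx.1 hy.1 hxy, hx.2, hy.2⟩)
      have dK : Dj KA K := fun x hx hx' => hdK x hx (hrK.sub x hx')
      have hKA : ∀ x, x ∈ KA.V → (if x ∈ KA.V then t z else k x) = t z := fun x hx => if_pos hx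
      have hKK : ∀ x, x ∈ K.V → (if x ∈ KA.V then t z else k x) = k x :=
        fun x hx => if_neg fun h' => dK x h' hx
      refine ⟨KA.par K, fun x => if x ∈ KA.V then t z else k x, ?_, ?_, ?_, ?_⟩
      · rintro x (hx | hx)
        · beta_reduce; rw [hKA x hx]; exact Or.inl rfl
        · beta_reduce; rw [hKK x hx]; exact Or.inr (hk x hx)
      · exact (hrK.par' KA hdK.symm).trans hr
      · rintro x y (h | h)
        · beta_reduce; rw [hKA x (KA.mem h), hKA y (KA.mem' h)]
        · beta_reduce; rw [hKK x (K.mem h), hKK y (K.mem' h)]; exact hc x y h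
      · rintro j (rfl | hj)
        · refine pA.cast ?_
          rw [par_ind KA K, ind_self (Z := KA) (S := {x | (if x ∈ KA.V then t z else k x) = t z}) (fun x hx => hKA x hx), ind_emp (Z := K), par_emp]
          intro x hx hx'
          have e : (if x ∈ KA.V then t z else k x) = t z := hx'
          rw [hKK x hx] at e
          exact hi (e ▸ hk x hx)
        · have hji : j ≠ t z := fun e => hi (e ▸ hj)
          refine (hpK j hj).cast ?_
          rw [par_ind KA K, ind_emp (Z := KA), emp_par]
          · congr 1
            · refine ind_congr fun x hx => ?_
              simp only [Set.mem_ofPred_eq, hKK x hx]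
            · rw [ind_ind]
              refine ind_congr fun x hx => ?_
              simp only [Set.mem_ofPred_eq]
              constructor
              · exact fun h => h.2
              · exact fun h => ⟨fun h' => hji (h.symm.trans h'), h⟩
          · intro x hx hx'
            have e : (if x ∈ KA.V then t z else k x) = j := hx'
            rw [hKA x hx] at e
            exact hji e.symm
    · push Not at hz
      obtain ⟨K, k, hk, hrK, hc, hpK⟩ := IHI G Z bG bZ hd
        (fun x hx => (hI x hx).resolve_left (hz x hx)) hS hp hall
      refine ⟨K, k, fun x hx => Or.inr (hk x hx), hrK, hc, ?_⟩
      rintro j (rfl | hj)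
      · refine Prov.emp.cast ?_
        rw [ind_emp (Z := K), ind_emp (Z := Z), par_emp]
        · exact hz
        · intro x hx e
          exact hi ((show k x = j from e) ▸ hk x hx)
      · exact hpK j hj

theorem cocMany [Finite α] {X P : SG α} {h : α → α} (hX : ∀ x, x ∈ X.V → h x ∈ P.V)
    (cX : CoC X P h) (k : α → α) (I : Set α) : (∀ i, i ∈ I → i ∈ P.V) →
    ∀ (K : SG α), Dj X K → (∀ x, x ∈ K.V → k x ∈ I) → (∀ x y, K.adj x y → k x = k y) →
    ∃ (X' : SG α) (h' : α → α), (∀ x, x ∈ X'.V → h' x ∈ P.V) ∧ CoC X' P h' ∧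
      Drv lab X' (X.par K) ∧
      (∀ i, X'.ind {x | h' x = i} = (X.ind {x | h x = i}).par (K.ind {x | k x = i})) ∧
      (∀ x, x ∈ X'.V ↔ x ∈ X.V ∨ x ∈ K.V) ∧ (∀ x, x ∉ K.V → h' x = h x) := by
  induction I, Set.toFinite I using Set.Finite.induction_on with
  | empty =>
    intro _ K hd hk hc
    have hK : K = emp := eq_emp fun x hx => (hk x hx).elim
    subst hK
    refine ⟨X, h, hX, cX, by rw [par_emp]; exact Drv.refl _, ?_, ?_, fun _ _ => rfl⟩
    · intro i
      rw [ind_emp (Z := emp) (fun x hx => hx.elim), par_emp]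
    · intro x
      simp only [mem_emp, or_false]
  | @insert i I hi _ IHI =>
    intro hI K hd hk hc
    obtain ⟨X1, h1, m1, c1, d1, f1, v1, e1⟩ := IHI (fun j hj => hI j (Or.inr hj))
      (K.ind {x | k x ≠ i}) (fun x hx hx' => hd x hx hx'.1)
      (fun x hx => (hk x hx.1).resolve_left hx.2) (fun x y hh => hc x y hh.1)
    have dd : Dj X1 (K.ind {x | k x = i}) := by
      intro x hx hx'
      rcases (v1 x).1 hx with h' | h'
      · exact hd x h' hx'.1
      · exact h'.2 hx'.2
    obtain ⟨X2, h2, m2, c2, d2, f2, f2', v2, e2, e2'⟩ := cocIns (lab := lab) m1 c1 (hI i (Or.inl rfl)) dd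
    refine ⟨X2, h2, m2, c2, ?_, ?_, ?_, ?_⟩
    · refine d2.trans ((d1.parL _ ?_).trans (Drv.of_eq ?_))
      · rintro x ⟨hx, hx'⟩ (h' | h')
        · exact hd x h' hx
        · exact h'.2 hx'
      · rw [par_assoc]
        congr 1
        apply ext' <;> simp only [mem_par, adj_par, mem_ind, adj_ind, Set.mem_ofPred_eq]
        · intro x; tauto
        · intro x y
          have := hc x y
          grind
    · intro j
      by_cases hj : j = i
      · subst hj
        rw [f2, f1, ind_ind, ind_emp (Z := K) (S := {x | x ∈ {x | k x ≠ j} ∧ x ∈ {x | k x = j}}) (fun x _ hx => hx.1 hx.2), par_emp]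
      · rw [f2' j hj, f1, ind_ind]
        congr 1
        refine ind_congr fun x hx => ?_
        simp only [Set.mem_ofPred_eq]
        constructor
        · exact fun h => h.2
        · exact fun h => ⟨fun h' => hj (h.symm.trans h'), h⟩
    · intro x
      rw [v2, v1]
      simp only [mem_ind, Set.mem_ofPred_eq]
      tauto
    · intro x hx
      rw [e2 x (fun h' => hx h'.1), e1 x (fun h' => hx h'.1)]

theorem pCase [Finite α] {B : Set α} (ih : IH lab B) {D X Y' Z Q P : SG α} {t h : α → α}
    (hDX : Dj D X) (hDY : Dj D (Y'.par Z)) (hd : Dj X (Y'.par Z)) (hYZ : Dj Y' Z)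
    (hX : ∀ x, x ∈ X.V → t x ∈ Q.V) (hY : ∀ x, x ∈ (Y'.par Z).V → t x ∈ Q.V)
    (cX : CoC X Q t) (cY : Cm (Y'.par Z) Q t)
    (bD : ∀ x, x ∈ D.V → x ∈ B)
    (bX : ∀ x, x ∈ X.V → x ∈ B) (bY' : ∀ x, x ∈ Y'.V → x ∈ B) (bZ : ∀ x, x ∈ Z.V → x ∈ B)
    (hS : ∀ P h, CP P → Comp (pprem X (Y'.par Z) t) P h → Spl lab D (pprem X (Y'.par Z) t) P h)
    (hp : Prov lab (D.par (pprem X (Y'.par Z) t)))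
    (hs : ∀ i, i ∈ Q.V → ∃ b, (b ∈ X.V ∨ b ∈ (Y'.par Z).V) ∧ t b ≠ i)
    (hP : CP P) (hZ : Comp Z P h) : Spl lab (D.par (X.par Y')) Z P h := by
  obtain ⟨K, k, hk, hr, hc, hpK⟩ := bigT ih t Q.V D (pprem X (Y'.par Z) t) bD
    (by
      rintro x (hx | hx | hx)
      · exact bX x hx
      · exact bY' x hx
      · exact bZ x hx)
    (by
      rintro x hx (hx' | hx')
      · exact hDX x hx hx'
      · exact hDY x hx hx')
    (by
      rintro x (hx | hx)
      · exact hX x hx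
      · exact hY x hx)
    hS hp (fun x y hx hy hxy => Or.inr (Or.inr ⟨hxy, hx, hy⟩))
  have hXK : Dj X K := fun x hx hx' => hDX x (hr.sub x hx') hx
  have hKY : Dj K (Y'.par Z) := fun x hx => hDY x (hr.sub x hx)
  obtain ⟨X', t', mX, cX', dX', fX, vX, eX⟩ := cocMany (lab := lab) hX cX k Q.V (fun _ h => h) K hXK hk hc
  have hYt : ∀ x, x ∈ (Y'.par Z).V → t' x = t x := fun x hx => eX x fun h' => hKY x h' hx
  have hX'Y : Dj X' (Y'.par Z) := by
    intro x hx hx'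
    rcases (vX x).1 hx with h' | h'
    · exact hd x h' hx'
    · exact hKY x h' hx'
  have key : ∀ i, (X'.par (Y'.par Z)).ind {x | t' x = i} =
      (K.ind {x | k x = i}).par ((X.par (Y'.par Z)).ind {x | t x = i}) := by
    intro i
    rw [par_ind X' (Y'.par Z), fX, par_ind X (Y'.par Z), par_comm (X.ind _), par_assoc]
    congr 2
    refine ind_congr fun x hx => ?_
    simp only [Set.mem_ofPred_eq, hYt x hx]
  have := splP ih (X := X') (Y' := Y') (Z := Z) (Q := Q) (P := P) (t := t') (h := h) hX'Y hYZ mX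
    (fun x hx => by rw [hYt x hx]; exact hY x hx) cX'
    (fun x y hx hy hxy => by
      rw [hYt x hx, hYt y hy] at *
      exact cY x y hx hy hxy)
    (fun i hi => by
      refine (hpK i hi).cast ?_
      rw [key]
      congr 1
      apply ext' <;> simp only [mem_par, adj_par, mem_ind, adj_ind, Set.mem_ofPred_eq, mem_pprem,
        adj_pprem]
      · intro x; tauto
      · intro x y; grind)
    (fun i hi => by
      obtain ⟨b, hb, hbi⟩ := hs i hi
      refine ⟨b, ?_, ?_⟩
      · rcases hb with hb | hb | hb
        · exact bX b hb
        · exact bY' b hb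
        · exact bZ b hb
      · rw [key]
        rintro (⟨h', _⟩ | ⟨_, h'⟩)
        · rcases hb with hb | hb
          · exact hXK b hb h'
          · exact hKY b h' hb
        · exact hbi h')
    (fun x hx => by
      rcases (vX x).1 hx with h' | h'
      · exact bX x h'
      · exact bD x (hr.sub x h')) bY' bZ hP hZ
  refine this.red ?_
  have dXY' : Dj X Y' := hd.mono (fun _ h => h) fun _ h => Or.inl h
  have dKY' : Dj K Y' := hKY.mono (fun _ h => h) fun _ h => Or.inl h
  refine ((dX'.parL Y' ?_).red).trans ?_
  · rintro x hx (h' | h')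
    · exact dXY' x h' hx
    · exact dKY' x h' hx
  · rw [par_comm X K, par_assoc]
    refine hr.par _ ?_
    rintro x hx (h' | h')
    · exact hDX x hx h'
    · exact hDY x hx (Or.inl h')

theorem component (T : SG α) {a : α} (ha : a ∈ T.V) :
    ∃ W : Set α, a ∈ W ∧ (∀ x, x ∈ W → x ∈ T.V) ∧ Conn (T.ind W) ∧
      ∀ x y, T.adj x y → x ∈ W → y ∈ W := by
  refine ⟨{x | Relation.ReflTransGen T.adj a x}, Relation.ReflTransGen.refl, ?_, ?_,
    fun x y h hx => Relation.ReflTransGen.tail hx h⟩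
  · intro x hx
    rcases Relation.ReflTransGen.cases_tail hx with rfl | ⟨y, _, h⟩
    · exact ha
    · exact T.mem' h
  · rintro U ⟨x, hx, hxU⟩ ⟨y, hy, hyU⟩
    by_contra hno
    push Not at hno
    -- U-membership is constant along paths
    have key : ∀ z, Relation.ReflTransGen T.adj a z → (z ∈ U ↔ a ∈ U) := by
      intro z hz
      induction hz with
      | refl => rfl
      | tail h1 h2 ih =>
        rename_i b c
        rw [← ih]
        constructor
        · intro hc
          by_contra hb
          exact hno _ _ hc hb ⟨T.symm h2, h1.tail h2, h1⟩
        · intro hb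
          by_contra hc
          exact hno _ _ hb hc ⟨h2, h1, h1.tail h2⟩
    exact hyU ((key y hy.2).2 ((key x hx.2).1 hxU))

end SG
end

section
namespace SG
variable {α : Type} {lab : α → Atom}

theorem wgOut {Wg A Y : SG α} {S : Set α} (hA : Wg.Mod A.V) (eA : Wg.ind A.V = A)
    (eY : Wg.ind {x | x ∉ A.V} = Y) (hS : ∀ x, x ∈ A.V → x ∈ S) :
    Drv lab (Wg.ind S) ((Y.ind S).par A) := by
  refine (ssOut (hA.ind S)).trans (Drv.of_eq ?_)
  congr 1
  · rw [← eY, ind_ind, ind_ind]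
    refine ind_congr fun x hx => ?_
    simp only [Set.mem_ofPred_eq]
    tauto
  · rw [ind_ind]
    conv_rhs => rw [← eA]
    refine ind_congr fun x hx => ?_
    simp only [Set.mem_ofPred_eq]
    exact ⟨fun h => h.2, fun h => ⟨hS x h, h⟩⟩

theorem wgSame {Wg A Y : SG α} {S : Set α}
    (eY : Wg.ind {x | x ∉ A.V} = Y) (hS : ∀ x, x ∈ A.V → x ∉ S) :
    Wg.ind S = Y.ind S := by
  rw [← eY, ind_ind]
  refine ind_congr fun x hx => ?_
  simp only [Set.mem_ofPred_eq]
  exact ⟨fun h => ⟨fun h' => hS x h' h, h⟩, fun h => h.2⟩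

theorem CP.two {P : SG α} [Finite α] (hP : CP P) (i : α) : ∃ j, j ∈ P.V ∧ j ≠ i := by
  rcases hP with ⟨_, h4⟩ | ⟨a, b, hab, hV, _⟩
  · obtain ⟨x, hx, h1, _⟩ := not_two_of_card h4 i i
    exact ⟨x, hx, h1⟩
  · by_cases h : a = i
    · exact ⟨b, (hV b).2 (Or.inr rfl), fun h' => hab (h.trans h'.symm)⟩
    · exact ⟨a, (hV a).2 (Or.inl rfl), h⟩

theorem Comp.other [Finite α] {Z P : SG α} {h : α → α} (hP : CP P) (hZ : Comp Z P h) (i : α) :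
    ∃ z, z ∈ Z.V ∧ h z ≠ i := by
  obtain ⟨j, hj, hji⟩ := hP.two i
  obtain ⟨z, hz, rfl⟩ := hZ.2.1 j hj
  exact ⟨z, hz, hji⟩

theorem ssB [Finite α] {Bd : Set α} (ih : IH lab Bd) {G' Y' Z A Wg P' P : SG α} {t h : α → α}
    {j : α} (hA : Wg.Mod A.V) (eA : Wg.ind A.V = A) (eY : Wg.ind {x | x ∉ A.V} = Y'.par Z)
    (hG : Dj G' Wg) (hYZ : Dj Y' Z) (bG : ∀ x, x ∈ G'.V → x ∈ Bd) (bW : ∀ x, x ∈ Wg.V → x ∈ Bd)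
    (hP' : CP P') (hW : Comp Wg P' t) (hj : j ∈ P'.V) (htA : ∀ x, x ∈ A.V → t x = j)
    (hs : Spl lab G' Wg P' t) (hP : CP P) (hZ : Comp Z P h) :
    Spl lab (G'.par (Y'.par A)) Z P h := by
  classical
  have mA : ∀ x, x ∈ A.V → x ∈ Wg.V := by
    intro x hx; rw [← eA] at hx; exact hx.1
  have mY : ∀ x, x ∈ (Y'.par Z).V ↔ x ∈ Wg.V ∧ x ∉ A.V := by
    intro x; rw [← eY]; rfl
  have dAY : Dj A (Y'.par Z) := fun x hx hx' => ((mY x).1 hx').2 hx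
  have dAY' : Dj A Y' := dAY.mono (fun _ h => h) fun _ h => Or.inl h
  have bZ : ∀ x, x ∈ Z.V → x ∈ Bd := fun x hx => bW x ((mY x).1 (Or.inr hx)).1
  have bY' : ∀ x, x ∈ Y'.V → x ∈ Bd := fun x hx => bW x ((mY x).1 (Or.inl hx)).1
  have dGA : Dj G' A := fun x hx hx' => hG x hx (mA x hx')
  have dGY : Dj G' (Y'.par Z) := fun x hx hx' => hG x hx ((mY x).1 hx').1
  have dGAY : Dj G' (A.par Y') := by
    rintro x hx (h' | h')
    · exact dGA x hx h'
    · exact dGY x hx (Or.inl h')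
  have cW : Cm (Y'.par Z) P' t := by rw [← eY]; exact hW.2.2.ind _
  rcases hs with ⟨K, k, hk, cK, hr, hpK⟩ | ⟨i, hi, KX, KY, hd, hr, pX, pY⟩
  · have dKA : Dj K A := fun x hx => dGA x (hr.sub x hx)
    have dKY : Dj K (Y'.par Z) := fun x hx => dGY x (hr.sub x hx)
    obtain ⟨K2, k2, m2, c2, d2, f2, f2', v2, e2, e2'⟩ := cocIns (lab := lab) hk cK hj dKA
    have d2Y : Dj K2 (Y'.par Z) := by
      intro x hx hx'
      rcases (v2 x).1 hx with h' | h'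
      · exact dKY x h' hx'
      · exact dAY x h' hx'
    have t1 : ∀ x, x ∈ K2.V → (if x ∈ K2.V then k2 x else t x) = k2 x := fun x hx => if_pos hx
    have t2 : ∀ x, x ∈ (Y'.par Z).V → (if x ∈ K2.V then k2 x else t x) = t x :=
      fun x hx => if_neg fun h' => d2Y x h' hx
    obtain ⟨t', ht'⟩ : ∃ t' : α → α, ∀ x, t' x = if x ∈ K2.V then k2 x else t x :=
      ⟨_, fun _ => rfl⟩
    simp only [← ht'] at t1 t2
    have key : ∀ i, (K2.par (Y'.par Z)).ind {x | t' x = i} =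
        (K2.ind {x | k2 x = i}).par ((Y'.par Z).ind {x | t x = i}) := by
      intro i
      rw [par_ind K2 (Y'.par Z)]
      congr 1
      · refine ind_congr fun x hx => ?_
        simp only [Set.mem_ofPred_eq, t1 x hx]
      · refine ind_congr fun x hx => ?_
        simp only [Set.mem_ofPred_eq, t2 x hx]
    have := splP ih (X := K2) (Y' := Y') (Z := Z) (Q := P') (P := P) (t := t') (h := h) d2Y hYZ
      (fun x hx => by rw [t1 x hx]; exact m2 x hx)
      (fun x hx => by rw [t2 x hx]; exact hW.1 x ((mY x).1 hx).1)
      (fun x y hx hy hxy => by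
        rw [t1 x hx, t1 y hy] at *
        exact c2 x y hx hy hxy)
      (fun x y hx hy hxy => by
        rw [t2 x hx, t2 y hy] at *
        exact cW x y hx hy hxy)
      (fun i hi => by
        rw [key]
        by_cases hij : i = j
        · subst hij
          rw [f2, par_assoc, par_comm A]
          refine (hpK i hi).drv ((wgOut hA eA eY (fun x hx => htA x hx)).parR _ ?_)
          rintro x hx (h' | h')
          · exact dKY x hx.1 h'.1
          · exact dKA x hx.1 h'
        · rw [f2' i hij]
          refine (hpK i hi).cast ?_
          rw [wgSame (S := {x | t x = i}) eY]
          exact fun x hx e => hij ((show t x = i from e).symm.trans (htA x hx)))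
      (fun i hi => by
        obtain ⟨b, hb, hbi⟩ := hW.other hP' i
        refine ⟨b, bW b hb, ?_⟩
        rw [key]
        rintro (⟨h1, h2⟩ | ⟨h1, h2⟩)
        · rcases (v2 b).1 h1 with h' | h'
          · exact hG b (hr.sub b h') hb
          · exact hbi ((htA b h').trans ((e2' b h').symm.trans h2))
        · exact hbi h2)
      (fun x hx => by
        rcases (v2 x).1 hx with h' | h'
        · exact bG x (hr.sub x h')
        · exact bW x (mA x h')) bY' bZ hP hZ
    refine this.red ?_
    refine ((d2.parL Y' ?_).red).trans ?_
    · rintro x hx (h' | h')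
      · exact dKY x h' (Or.inl hx)
      · exact dAY' x h' hx
    · rw [par_assoc, par_comm Y' A]
      exact hr.par _ dGAY
  · have sX : ∀ x, x ∈ KX.V → x ∈ G'.V := fun x hx => hr.sub x (Or.inl hx)
    have sY : ∀ x, x ∈ KY.V → x ∈ G'.V := fun x hx => hr.sub x (Or.inr hx)
    have dXY := dGY.mono sX (fun _ h => h)
    have dYY := dGY.mono sY (fun _ h => h)
    have dXA := dGA.mono sX (fun _ h => h)
    have dYA := dGA.mono sY (fun _ h => h)
    obtain ⟨b, hb, hbi⟩ := hW.other hP' i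
    obtain ⟨b', hb', hbi'⟩ := hW.2.1 i hi
    by_cases hij : i = j
    · subst hij
      have := splMod ih (KX := KX.par A) (KY := KY) (Y' := Y') (M := {x | t x = i}) hP hZ hYZ
        (cW.mod i)
        (by
          rintro x (h' | h') hx
          · exact hd x h' hx
          · exact dYA x hx h')
        (by
          rintro x (h' | h') hx
          · exact dXY x h' hx
          · exact dAY x h' hx)
        dYY
        (by
          rintro x (h' | h')
          · exact bG x (sX x h')
          · exact bW x (mA x h'))
        (fun x hx => bG x (sY x hx)) bZ bY'
        ⟨b, bW b hb, by
          rintro (h' | h')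
          · exact hG b (sX b h') hb
          · exact hbi (htA b h'), fun h' => hbi h'.2⟩
        ⟨b', bW b' hb', fun h' => hG b' (sY b' h') hb', fun h' => h'.2 hbi'⟩
        (by
          rw [par_assoc, par_comm A]
          refine pX.drv ((wgOut hA eA eY (fun x hx => htA x hx)).parR _ ?_)
          rintro x hx (h' | h')
          · exact dXY x hx h'.1
          · exact dXA x hx h')
        (pY.cast (by rw [wgSame eY]; exact fun x hx h' => h' (htA x hx)))
      refine this.red ((hr.par (A.par Y') dGAY).cast ?_ |>.cast' ?_)
      · rw [par_assoc KX A, par_comm A KY, ← par_assoc KX, par_assoc _ A]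
      · rw [par_comm Y' A]
    · have := splMod ih (KX := KX) (KY := KY.par A) (Y' := Y') (M := {x | t x = i}) hP hZ hYZ
        (cW.mod i)
        (by
          rintro x hx (h' | h')
          · exact hd x hx h'
          · exact dXA x hx h')
        dXY
        (by
          rintro x (h' | h') hx
          · exact dYY x h' hx
          · exact dAY x h' hx)
        (fun x hx => bG x (sX x hx))
        (by
          rintro x (h' | h')
          · exact bG x (sY x h')
          · exact bW x (mA x h')) bZ bY'
        ⟨b, bW b hb, fun h' => hG b (sX b h') hb, fun h' => hbi h'.2⟩
        ⟨b', bW b' hb', by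
          rintro (h' | h')
          · exact hG b' (sY b' h') hb'
          · exact hij (hbi'.symm.trans (htA b' h')), fun h' => h'.2 hbi'⟩
        (pX.cast (by
          rw [wgSame eY]
          exact fun x hx h' => hij ((show t x = i from h').symm.trans (htA x hx))))
        (by
          rw [par_assoc, par_comm A]
          refine pY.drv ((wgOut (S := {x | x ∉ {x | t x = i}}) hA eA eY (fun x hx h' => ?_)).parR _ ?_)
          · exact hij ((show t x = i from h').symm.trans (htA x hx))
          rintro x hx (h' | h')
          · exact dYY x hx h'.1
          · exact dYA x hx h')
      refine this.red ((hr.par (A.par Y') dGAY).cast ?_ |>.cast' ?_)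
      · rw [← par_assoc KX KY A, par_assoc _ A]
      · rw [par_comm Y' A]

theorem ssA [Finite α] {Bd : Set α} (ih : IH lab Bd) {G' Y Z A A1 Wg P' P : SG α} {t h : α → α}
    {j : α} (hA : Wg.Mod A.V) (eA : Wg.ind A.V = A) (eY : Wg.ind {x | x ∉ A.V} = Y)
    (hAZ : A = A1.par Z)
    (hG : Dj G' Wg) (hYZ : Dj A1 Z) (bG : ∀ x, x ∈ G'.V → x ∈ Bd) (bW : ∀ x, x ∈ Wg.V → x ∈ Bd)
    (hP' : CP P') (hW : Comp Wg P' t) (hj : j ∈ P'.V) (htA : ∀ x, x ∈ A.V → t x = j)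
    (hs : Spl lab G' Wg P' t) (hP : CP P) (hZ : Comp Z P h) :
    Spl lab (G'.par (Y.par A1)) Z P h := by
  classical
  have mA : ∀ x, x ∈ A.V → x ∈ Wg.V := by
    intro x hx; rw [← eA] at hx; exact hx.1
  have mA1 : ∀ x, x ∈ A1.V → x ∈ A.V := by
    intro x hx; rw [hAZ]; exact Or.inl hx
  have mZ : ∀ x, x ∈ Z.V → x ∈ A.V := by
    intro x hx; rw [hAZ]; exact Or.inr hx
  have mY : ∀ x, x ∈ Y.V ↔ x ∈ Wg.V ∧ x ∉ A.V := by
    intro x; rw [← eY]; rfl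
  have dAY : Dj A Y := fun x hx hx' => ((mY x).1 hx').2 hx
  have dGA : Dj G' A := fun x hx hx' => hG x hx (mA x hx')
  have dGY : Dj G' Y := fun x hx hx' => hG x hx ((mY x).1 hx').1
  have dGAY : Dj G' (A1.par Y) := by
    rintro x hx (h' | h')
    · exact dGA x hx (mA1 x h')
    · exact dGY x hx h'
  have bA1 : ∀ x, x ∈ A1.V → x ∈ Bd := fun x hx => bW x (mA x (mA1 x hx))
  have bZ : ∀ x, x ∈ Z.V → x ∈ Bd := fun x hx => bW x (mA x (mZ x hx))
  have bY : ∀ x, x ∈ Y.V → x ∈ Bd := fun x hx => bW x ((mY x).1 hx).1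
  have cW : Cm Y P' t := by rw [← eY]; exact hW.2.2.ind _
  -- the common use of the induction hypothesis
  have main : ∀ (K : SG α) (S : Set α), (∀ x, x ∈ K.V → x ∈ G'.V) → (∀ x, x ∈ A.V → x ∈ S) →
      (∃ b, b ∈ Wg.V ∧ b ∉ S) → Prov lab (K.par (Wg.ind S)) →
      Spl lab ((K.par A1).par (Y.ind S)) Z P h := by
    rintro K S sK hS ⟨b, hb, hbS⟩ hp
    have dKA := dGA.mono sK (fun _ h => h)
    have dKY := dGY.mono sK (fun _ h => h)
    refine ih _ Z P h ?_ bZ ⟨b, bW b hb, ?_, fun h' => hbS (hS b (mZ b h'))⟩ ?_ ?_ hP hZ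
    · rintro x ((h' | h') | h')
      · exact bG x (sK x h')
      · exact bA1 x h'
      · exact bY x h'.1
    · rintro ((h' | h') | h')
      · exact hG b (sK b h') hb
      · exact hbS (hS b (mA1 b h'))
      · exact hbS h'.2
    · refine (hp.drv ((wgOut hA eA eY hS).parR K ?_)).cast ?_
      · rintro x hx (h' | h')
        · exact dKY x hx h'.1
        · exact dKA x hx h'
      · rw [hAZ, ← par_assoc, ← par_assoc, par_assoc K, par_comm _ A1, ← par_assoc]
    · rintro x ((h' | h') | h') hx
      · exact dKA x h' (mZ x hx)
      · exact hYZ x h' hx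
      · exact dAY x (mZ x hx) h'.1
  rcases hs with ⟨K, k, hk, cK, hr, hpK⟩ | ⟨i, hi, KX, KY, hd, hr, pX, pY⟩
  · have dKA : Dj K A := fun x hx => dGA x (hr.sub x hx)
    have dKA1 : Dj K A1 := fun x hx h' => dKA x hx (mA1 x h')
    have dKY : Dj K Y := fun x hx => dGY x (hr.sub x hx)
    have dAY1 : Dj A1 Y := fun x hx h' => dAY x (mA1 x hx) h'
    obtain ⟨K2, k2, m2, c2, d2, f2, f2', v2, e2, e2'⟩ := cocIns (lab := lab) hk cK hj dKA1
    have d2Y : Dj K2 Y := by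
      intro x hx hx'
      rcases (v2 x).1 hx with h' | h'
      · exact dKY x h' hx'
      · exact dAY1 x h' hx'
    have t1 : ∀ x, x ∈ K2.V → (if x ∈ K2.V then k2 x else t x) = k2 x := fun x hx => if_pos hx
    have t2 : ∀ x, x ∈ Y.V → (if x ∈ K2.V then k2 x else t x) = t x :=
      fun x hx => if_neg fun h' => d2Y x h' hx
    obtain ⟨t', ht'⟩ : ∃ t' : α → α, ∀ x, t' x = if x ∈ K2.V then k2 x else t x :=
      ⟨_, fun _ => rfl⟩
    simp only [← ht'] at t1 t2
    have key : ∀ i, (K2.par Y).ind {x | t' x = i} =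
        (K2.ind {x | k2 x = i}).par (Y.ind {x | t x = i}) := by
      intro i
      rw [par_ind K2 Y]
      congr 1
      · refine ind_congr fun x hx => ?_
        simp only [Set.mem_ofPred_eq, t1 x hx]
      · refine ind_congr fun x hx => ?_
        simp only [Set.mem_ofPred_eq, t2 x hx]
    have gp := genp (lab := lab) (Q := P') (X := K2) (Y := Y) (h := t') (j := j) d2Y
      (fun x hx => by rw [t1 x hx]; exact m2 x hx)
      (fun x hx => by rw [t2 x hx]; exact hW.1 x ((mY x).1 hx).1)
      (fun x y hx hy hxy => by
        rw [t1 x hx, t1 y hy] at *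
        exact c2 x y hx hy hxy)
      (fun x y hx hy hxy => by
        rw [t2 x hx, t2 y hy] at *
        exact cW x y hx hy hxy) hj
      (fun i hi hij => by
        rw [key, f2' i hij]
        refine (hpK i hi).cast ?_
        rw [wgSame (S := {x | t x = i}) eY]
        exact fun x hx e => hij ((show t x = i from e).symm.trans (htA x hx)))
    rw [key, f2] at gp
    have := main (K.ind {x | k x = j}) {x | t x = j} (fun x hx => hr.sub x hx.1)
      (fun x hx => htA x hx) (hW.other hP' j) (hpK j hj)
    refine this.red (gp.red.trans (((d2.parL Y ?_).red).trans ?_))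
    · rintro x hx (h' | h')
      · exact dKY x h' hx
      · exact dAY1 x h' hx
    · rw [par_assoc, par_comm Y A1]
      exact hr.par _ dGAY
  · have sX : ∀ x, x ∈ KX.V → x ∈ G'.V := fun x hx => hr.sub x (Or.inl hx)
    have sY : ∀ x, x ∈ KY.V → x ∈ G'.V := fun x hx => hr.sub x (Or.inr hx)
    have dXY := dGY.mono sX (fun _ h => h)
    have dYY := dGY.mono sY (fun _ h => h)
    have dXA := dGA.mono sX (fun _ h => h)
    have dYA := dGA.mono sY (fun _ h => h)
    have dAY1 : Dj A1 Y := fun x hx h' => dAY x (mA1 x hx) h'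
    obtain ⟨b', hb', hbi'⟩ := hW.2.1 i hi
    by_cases hij : i = j
    · subst hij
      have := main KX {x | t x = i} sX (fun x hx => htA x hx) (hW.other hP' i) pX
      refine this.red ((mergeCtx (KY := KY) (cW.mod i) ?_ dYY ?_ ?_).trans
        ((hr.par (A1.par Y) dGAY).cast ?_ |>.cast' ?_))
      · rintro x (h' | h') hx
        · exact dXY x h' hx
        · exact dAY1 x h' hx
      · rintro x (h' | h') hx
        · exact hd x h' hx
        · exact dYA x hx (mA1 x h')
      · exact pY.cast (by rw [wgSame eY]; exact fun x hx h' => h' (htA x hx))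
      · rw [par_assoc KX A1, par_comm A1 KY, ← par_assoc KX, par_assoc _ A1]
      · rw [par_comm Y A1]
    · have := main KY {x | x ∉ {x | t x = i}} sY
        (fun x hx h' => hij ((show t x = i from h').symm.trans (htA x hx)))
        ⟨b', hb', fun h' => h' hbi'⟩ pY
      have mi := mergeIns (lab := lab) (cW.mod i) dXY (pX.cast (by
          rw [wgSame eY]
          exact fun x hx h' => hij ((show t x = i from h').symm.trans (htA x hx))))
      refine this.red ((mi.parR (KY.par A1) ?_).red.trans
        ((hr.par (A1.par Y) dGAY).cast ?_ |>.cast' ?_))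
      · rintro x (hx | hx) (h' | h')
        · exact hd x h' hx
        · exact dYY x hx h'
        · exact dXA x h' (mA1 x hx)
        · exact dAY1 x hx h'
      · rw [par_comm KX KY, par_assoc, par_assoc, ← par_assoc KX, par_comm KX, par_assoc]
      · rw [par_comm Y A1]

end SG
end

section
namespace SG
variable {α : Type} {lab : α → Atom}

def AllSpl (lab : α → Atom) (H : SG α) : Prop :=
  ∀ (G Z P : SG α) (h : α → α), H = G.par Z → Dj G Z → CP P → Comp Z P h → Spl lab G Z P h

theorem eq_indL {G Z H : SG α} (e : H = G.par Z) (hd : Dj G Z) : G = H.ind {x | x ∉ Z.V} := by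
  subst e
  rw [par_ind, ind_self (Z := G) (S := {x | x ∉ Z.V}) hd,
    ind_emp (Z := Z) (S := {x | x ∉ Z.V}) (fun x hx h => h hx), par_emp]

theorem eq_indR {G Z H : SG α} (e : H = G.par Z) (hd : Dj G Z) : Z = H.ind {x | x ∈ Z.V} := by
  subst e
  rw [par_ind, ind_self (Z := Z) (S := {x | x ∈ Z.V}) (fun _ h => h),
    ind_emp (Z := G) (S := {x | x ∈ Z.V}) hd, emp_par]

theorem Conn.sub {Z : SG α} (hc : Conn Z) {U : Set α} (hz : ∃ x, x ∈ Z.V ∧ x ∈ U)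
    (hcl : ∀ x y, Z.adj x y → x ∈ U → y ∈ U) : ∀ x, x ∈ Z.V → x ∈ U := by
  intro x hx
  by_contra h
  obtain ⟨u, v, hu, hv, ha⟩ := hc U hz ⟨x, hx, h⟩
  exact hv (hcl u v ha hu)

theorem par_of_closed {T : SG α} {W : Set α} (hcl : ∀ x y, T.adj x y → x ∈ W → y ∈ W) :
    T = (T.ind {x | x ∉ W}).par (T.ind W) := by
  apply ext' <;> simp only [mem_ind, adj_ind, Set.mem_ofPred_eq, mem_par, adj_par]
  · intro x; tauto
  · intro x y
    have h1 := hcl x y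
    have h2 := fun h => hcl y x (T.symm h)
    tauto

theorem plug_ind_off {B A : SG α} {S W : Set α} (hAW : ∀ x, x ∈ A.V → x ∈ W) :
    (B.plug S A).ind {x | x ∉ W} = B.ind {x | x ∉ W} := by
  apply ext' <;> simp only [mem_ind, adj_ind, Set.mem_ofPred_eq, mem_plug, adj_plug]
  · intro x
    have := hAW x
    tauto
  · intro x y
    have := hAW x
    have := hAW y
    have m0 := fun h => A.mem (x := x) (y := y) h
    tauto

set_option maxHeartbeats 1600000 in
theorem ssCase [Finite α] {Bd : Set α} (ih : IH lab Bd) {D B A G Z P : SG α} {S : Set α} {h : α → α}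
    (hS : AllSpl lab (D.par (B.plug S A))) (hDB : Dj D B) (hDA : Dj D A) (hBA : Dj B A)
    (ha : ∃ a, a ∈ A.V) (hb : ∃ b, b ∈ B.V ∧ b ∈ S) (e : D.par (B.par A) = G.par Z) (hd : Dj G Z)
    (hZc : ∀ x, x ∈ Z.V → x ∈ B.V ∨ x ∈ A.V)
    (bD : ∀ x, x ∈ D.V → x ∈ Bd) (bB : ∀ x, x ∈ B.V → x ∈ Bd) (bA : ∀ x, x ∈ A.V → x ∈ Bd)
    (hP : CP P) (hZ : Comp Z P h) : Spl lab G Z P h := by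
  have cZ : Conn Z := connCP hP hZ
  obtain ⟨a, ha⟩ := ha
  obtain ⟨b, hb, hbS⟩ := hb
  have eG := eq_indL e hd
  have eZ := eq_indR e hd
  have aZ : ∀ x y, Z.adj x y → B.adj x y ∨ A.adj x y := by
    intro x y hxy
    have h1 := hZc x (Z.mem hxy)
    have : (D.par (B.par A)).adj x y := by rw [e]; exact Or.inr hxy
    rcases this with h' | h'
    · rcases h1 with h1 | h1
      · exact absurd h1 (hDB x (D.mem h'))
      · exact absurd h1 (hDA x (D.mem h'))
    · exact h'
  have hZcase : (∀ x, x ∈ Z.V → x ∈ A.V) ∨ (∀ x, x ∈ Z.V → x ∈ B.V) := by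
    by_cases hz : ∃ x, x ∈ Z.V ∧ x ∈ A.V
    · refine Or.inl (cZ.sub hz fun x y hxy hx => ?_)
      rcases aZ x y hxy with h' | h'
      · exact absurd hx (hBA x (B.mem h'))
      · exact A.mem' h'
    · push Not at hz
      exact Or.inr fun x hx => (hZc x hx).resolve_right (hz x hx)
  obtain ⟨W, haW, hWT, hWc, hcl⟩ := component (B.plug S A) (a := a) (Or.inr ha)
  have hbW : b ∈ W := hcl a b (Or.inr (Or.inr (Or.inr ⟨hb, hbS, ha, fun h' => hBA a h' ha⟩))) haW
  have hAW : ∀ x, x ∈ A.V → x ∈ W := fun x hx =>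
    hcl b x (Or.inr (Or.inr (Or.inl ⟨hb, hbS, hx, fun h' => hBA x h' hx⟩))) hbW
  have hclB : ∀ x y, B.adj x y → x ∈ W → y ∈ W := fun x y hxy => hcl x y (Or.inl hxy)
  have hSW : ∀ x, x ∈ B.V → x ∈ S → x ∈ W := fun x hx hxS =>
    hcl a x (Or.inr (Or.inr (Or.inr ⟨hx, hxS, ha, fun h' => hBA a h' ha⟩))) haW
  have bW : ∀ x, x ∈ ((B.plug S A).ind W).V → x ∈ Bd := by
    rintro x ⟨hx | hx, _⟩
    · exact bB x hx
    · exact bA x hx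
  have hA : ((B.plug S A).ind W).Mod A.V := by
    unfold Dj at *
    rintro v hv hvM x hx hxM y hy hyM hvx
    grind
  have eA : ((B.plug S A).ind W).ind A.V = A := by
    unfold Dj at *
    apply ext'
    · intro x; grind -funext -ext
    · intro x y; grind -funext -ext
  have eY : ((B.plug S A).ind W).ind {x | x ∉ A.V} = B.ind W := by
    unfold Dj at *
    apply ext' <;> simp only [mem_plug, adj_plug, mem_ind, adj_ind, Set.mem_ofPred_eq]
    · intro x; grind -funext -ext
    · intro x y; grind -funext -ext
  obtain ⟨P', t, j, hP', hC', hj, hjA⟩ := decomp (W := (B.plug S A).ind W) (T := A.V) hWc hA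
    (fun x hx => ⟨Or.inr hx, hAW x hx⟩) ⟨a, ha⟩ ⟨b, ⟨Or.inl hb, hbW⟩, hBA b hb⟩
  have dG' : Dj (D.par (B.ind {x | x ∉ W})) ((B.plug S A).ind W) := by
    rintro x (hx | hx) hx'
    · rcases hx'.1 with h' | h'
      · exact hDB x hx h'
      · exact hDA x hx h'
    · exact hx.2 hx'.2
  have bG' : ∀ x, x ∈ (D.par (B.ind {x | x ∉ W})).V → x ∈ Bd := by
    rintro x (hx | hx)
    · exact bD x hx
    · exact bB x hx.1
  have eO : (B.plug S A).ind {x | x ∉ W} = B.ind {x | x ∉ W} := plug_ind_off hAW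
  have hs := hS (D.par (B.ind {x | x ∉ W})) ((B.plug S A).ind W) P' t (by
    rw [par_assoc, ← eO, ← par_of_closed hcl]) dG' hP' hC'
  have hclB' : ∀ x y, B.adj x y → y ∈ W → x ∈ W := fun x y hxy => hclB y x (B.symm hxy)
  have hZcl : ∀ x y, (D.par (B.par A)).adj x y → x ∈ Z.V → y ∈ Z.V := by
    intro x y hxy hx
    rw [e] at hxy
    rcases hxy with h' | h'
    · exact absurd hx (hd x (G.mem h'))
    · exact Z.mem' h'
  have hZclB : ∀ x y, B.adj x y → (x ∈ Z.V ↔ y ∈ Z.V) := fun x y hxy =>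
    ⟨hZcl x y (Or.inr (Or.inl hxy)), hZcl y x (Or.inr (Or.inl (B.symm hxy)))⟩
  have hZclA : ∀ x y, A.adj x y → (x ∈ Z.V ↔ y ∈ Z.V) := fun x y hxy =>
    ⟨hZcl x y (Or.inr (Or.inr hxy)), hZcl y x (Or.inr (Or.inr (A.symm hxy)))⟩
  rw [par_ind, par_ind] at eG eZ
  rcases hZcase with hZA | hZB
  · -- Z inside A
    have nD : ∀ x, x ∈ D.V → x ∉ Z.V := fun x hx hx' => hDA x hx (hZA x hx')
    have nB : ∀ x, x ∈ B.V → x ∉ Z.V := fun x hx hx' => hBA x hx (hZA x hx')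
    rw [ind_self (Z := D) (S := {x | x ∉ Z.V}) nD, ind_self (Z := B) (S := {x | x ∉ Z.V}) nB] at eG
    rw [ind_emp (Z := D) (S := {x | x ∈ Z.V}) nD, ind_emp (Z := B) (S := {x | x ∈ Z.V}) nB, emp_par,
      emp_par] at eZ
    have eAZ : A = (A.ind {x | x ∉ Z.V}).par Z := by
      have := par_of_closed (T := A) (W := {x | x ∈ Z.V}) (fun x y hxy => (hZclA x y hxy).1)
      rw [← eZ] at this
      exact this
    have := ssA ih (G' := D.par (B.ind {x | x ∉ W})) (Y := B.ind W) (Z := Z) (A := A)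
      (A1 := A.ind {x | x ∉ Z.V}) hA eA eY eAZ
      dG' (fun x hx => hx.2) bG' bW hP' hC' hj hjA hs hP hZ
    refine this.red (Drv.of_eq ?_).red
    conv_rhs => rw [eG, par_of_closed hclB]
    simp only [par_assoc]
  · have nD : ∀ x, x ∈ D.V → x ∉ Z.V := fun x hx hx' => hDB x hx (hZB x hx')
    have nA : ∀ x, x ∈ A.V → x ∉ Z.V := fun x hx hx' => hBA x (hZB x hx') hx
    rw [ind_self (Z := D) (S := {x | x ∉ Z.V}) nD, ind_self (Z := A) (S := {x | x ∉ Z.V}) nA] at eG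
    rw [ind_emp (Z := D) (S := {x | x ∈ Z.V}) nD, ind_emp (Z := A) (S := {x | x ∈ Z.V}) nA, emp_par,
      par_emp] at eZ
    by_cases hzW : ∃ x, x ∈ Z.V ∧ x ∈ W
    · have hZW := cZ.sub hzW (fun x y hxy hx => by
        rcases aZ x y hxy with h' | h'
        · exact hclB x y h' hx
        · exact hAW y (A.mem' h'))
      have := ssB ih (G' := D.par (B.ind {x | x ∉ W})) (Y' := B.ind {x | x ∈ W ∧ x ∉ Z.V}) (Z := Z)
        (A := A) hA eA (by
          rw [eY, par_of_closed (T := B.ind W) (W := {x | x ∈ Z.V})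
            (fun x y hxy => (hZclB x y hxy.1).1), ind_ind, ind_ind]
          congr 1
          conv_rhs => rw [eZ]
          refine ind_congr fun x _ => ?_
          simp only [Set.mem_ofPred_eq]
          exact ⟨fun h' => h'.2, fun h' => ⟨hZW x h', h'⟩⟩)
        dG' (fun x hx => hx.2.2) bG' bW hP' hC' hj hjA hs hP hZ
      refine this.red (Drv.of_eq ?_).red
      conv_rhs => rw [eG, par_of_closed (T := B.ind {x | x ∉ Z.V}) (W := W)
        (fun x y hxy => hclB x y hxy.1), ind_ind, ind_ind]
      have e1 : B.ind {x | x ∈ {x | x ∉ Z.V} ∧ x ∈ {x | x ∉ W}} = B.ind {x | x ∉ W} := by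
        refine ind_congr fun x _ => ?_
        simp only [Set.mem_ofPred_eq]
        exact ⟨fun h' => h'.2, fun h' => ⟨fun h'' => h' (hZW x h''), h'⟩⟩
      have e2 : B.ind {x | x ∈ {x | x ∉ Z.V} ∧ x ∈ W} = B.ind {x | x ∈ W ∧ x ∉ Z.V} := by
        refine ind_congr fun x _ => ?_
        simp only [Set.mem_ofPred_eq]
        exact and_comm
      rw [e1, e2]
      simp only [par_assoc]
    · push Not at hzW
      have hzS : ∀ x, x ∈ Z.V → x ∉ S := fun x hx hxS => hzW x hx (hSW x (hZB x hx) hxS)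
      have := hS (D.par ((B.ind {x | x ∉ Z.V}).plug S A)) Z P h (by
          rw [par_assoc]
          congr 1
          conv_lhs => rw [par_of_closed (T := B) (W := {x | x ∈ Z.V})
            (fun x y hxy => (hZclB x y hxy).1), ← eZ]
          apply ext' <;> simp only [mem_par, adj_par, mem_plug, adj_plug]
          · intro x
            tauto
          · intro x y
            have := hzS x
            have := hzS y
            have := hBA x
            have := hBA y
            have := hZB x
            have := hZB y
            grind)
        (by
          rintro x (hx | hx | hx) hx'
          · exact hDB x hx (hZB x hx')
          · exact hx.2 hx'
          · exact hBA x (hZB x hx') hx) hP hZ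
      refine this.red ?_
      have d1 := ssPlug (lab := lab) (B.ind {x | x ∉ Z.V}) A S (fun x hx => hBA x hx.1)
      refine ((d1.parR D ?_).trans (Drv.of_eq ?_)).red
      · rintro x hx (h' | h')
        · exact hDB x hx h'.1
        · exact hDA x hx h'
      · exact eG.symm

end SG
end

section
namespace SG
variable {α : Type} {lab : α → Atom}

theorem pprem_comm (X Y : SG α) (t : α → α) : pprem X Y t = pprem Y X t := by
  apply ext' <;> simp only [mem_pprem, adj_pprem] <;> intros <;> tauto

theorem pStepY [Finite α] {Bd : Set α} (ih : IH lab Bd) {D X Y G Z P Q : SG α} {t h : α → α}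
    (hS : AllSpl lab (D.par (pprem X Y t))) (hp : Prov lab (D.par (pprem X Y t)))
    (hDX : Dj D X) (hDY : Dj D Y) (hXY : Dj X Y)
    (hX : ∀ x, x ∈ X.V → t x ∈ Q.V) (hY : ∀ x, x ∈ Y.V → t x ∈ Q.V)
    (cX : CoC X Q t) (cY : Cm Y Q t)
    (hs : ∀ i, i ∈ Q.V → ∃ b, (b ∈ X.V ∨ b ∈ Y.V) ∧ t b ≠ i)
    (e : D.par (X.par Y) = G.par Z) (hd : Dj G Z)
    (hZY : ∀ x, x ∈ Z.V → x ∈ Y.V)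
    (bD : ∀ x, x ∈ D.V → x ∈ Bd) (bX : ∀ x, x ∈ X.V → x ∈ Bd) (bY : ∀ x, x ∈ Y.V → x ∈ Bd)
    (hP : CP P) (hZ : Comp Z P h) : Spl lab G Z P h := by
  have eG := eq_indL e hd
  have eZ := eq_indR e hd
  have hZcl : ∀ x y, (D.par (X.par Y)).adj x y → x ∈ Z.V → y ∈ Z.V := by
    intro x y hxy hx
    rw [e] at hxy
    rcases hxy with h' | h'
    · exact absurd hx (hd x (G.mem h'))
    · exact Z.mem' h'
  have nD : ∀ x, x ∈ D.V → x ∉ Z.V := fun x hx hx' => hDY x hx (hZY x hx')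
  have nX : ∀ x, x ∈ X.V → x ∉ Z.V := fun x hx hx' => hXY x hx (hZY x hx')
  rw [par_ind, par_ind] at eG eZ
  rw [ind_self (Z := D) (S := {x | x ∉ Z.V}) nD, ind_self (Z := X) (S := {x | x ∉ Z.V}) nX] at eG
  rw [ind_emp (Z := D) (S := {x | x ∈ Z.V}) nD, ind_emp (Z := X) (S := {x | x ∈ Z.V}) nX, emp_par,
      emp_par] at eZ
  have eY : (Y.ind {x | x ∉ Z.V}).par Z = Y := by
    have := par_of_closed (T := Y) (W := {x | x ∈ Z.V})
      (fun x y hxy => hZcl x y (Or.inr (Or.inr hxy)))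
    rw [← eZ] at this
    exact this.symm
  refine (pCase ih (D := D) (X := X) (Y' := Y.ind {x | x ∉ Z.V}) (Z := Z) (Q := Q) (t := t) hDX
    (by rwa [eY]) (by rwa [eY]) (fun x hx => hx.2) hX (by rwa [eY]) cX (by rwa [eY]) bD bX
    (fun x hx => bY x hx.1) (fun x hx => bY x (hZY x hx)) ?_ (by rwa [eY]) (by rwa [eY]) hP hZ).red
    (Drv.of_eq eG.symm).red
  rw [eY]
  refine fun P h hP hC => hS D _ P h rfl ?_ hP hC
  rintro x hx (h' | h')
  · exact hDX x hx h'
  · exact hDY x hx h'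

theorem stepInd {D p c : SG α} {R S : Set α} (hr : Rule lab p c) (hd : Dj D c)
    (hS : (∀ x, x ∈ c.V → x ∈ S) ∨ (∀ x, x ∈ c.V → x ∉ S)) :
    Drv lab ((D.plug R p).ind S) ((D.plug R c).ind S) := by
  rcases hS with hS | hS
  · have key : ∀ c' : SG α, (∀ x, x ∈ c'.V → x ∈ c.V) →
        (D.plug R c').ind S = (D.ind S).plug R c' := by
      intro c' hc'
      apply ext' <;> simp only [mem_plug, adj_plug, mem_ind, adj_ind]
      · intro x
        have := hS x
        have := hc' x
        tauto
      · intro x y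
        have := hS x
        have := hc' x
        have := hd x
        have := hS y
        have := hc' y
        have := hd y
        grind
    rw [key p hr.sub, key c (fun _ h => h)]
    exact (Drv.rule hr).ctx R (fun x hx => hd x hx.1)
  · have key : ∀ c' : SG α, (∀ x, x ∈ c'.V → x ∈ c.V) →
        (D.plug R c').ind S = D.ind S := by
      intro c' hc'
      apply ext' <;> simp only [mem_plug, adj_plug, mem_ind, adj_ind]
      · intro x
        have := hS x
        have := hc' x
        tauto
      · intro x y
        have := hS x
        have := hc' x
        have := hd x
        have := hS y
        have := hc' y
        have := hd y
        grind
    rw [key p hr.sub, key c (fun _ h => h)]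
    exact Drv.refl _

/-- Splitting of the premise of a step along a split of the conclusion. -/
theorem stepPar {D p c G Z : SG α} {R : Set α} (hr : Rule lab p c) (hd : Dj D c)
    (e : D.plug R c = G.par Z) (hGZ : Dj G Z)
    (hS : (∀ x, x ∈ c.V → x ∈ Z.V) ∨ (∀ x, x ∈ c.V → x ∉ Z.V)) :
    D.plug R p = ((D.plug R p).ind {x | x ∉ Z.V}).par ((D.plug R p).ind {x | x ∈ Z.V}) := by
  have hZcl : ∀ x y, (D.plug R c).adj x y → x ∈ Z.V → y ∈ Z.V := by
    intro x y hxy hx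
    rw [e] at hxy
    rcases hxy with h' | h'
    · exact absurd hx (hGZ x (G.mem h'))
    · exact Z.mem' h'
  have hs := hr.sub
  refine par_of_closed fun x y hxy hx => ?_
  rcases hxy with h' | h' | h' | h'
  · exact hZcl x y (Or.inl h') hx
  · rcases hS with hS | hS
    · exact hS y (hs y (p.mem' h'))
    · exact absurd hx (hS x (hs x (p.mem h')))
  · exact hZcl x y (Or.inr (Or.inr (Or.inl ⟨h'.1, h'.2.1, hs y h'.2.2.1, h'.2.2.2⟩))) hx
  · exact hZcl x y (Or.inr (Or.inr (Or.inr ⟨h'.1, h'.2.1, hs x h'.2.2.1, h'.2.2.2⟩))) hx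

theorem step [Finite α] {D p c : SG α} {R : Set α} (hr : Rule lab p c) (hdc : Dj D c)
    (ih : IH lab (D.plug R c).V) (hS : AllSpl lab (D.plug R p)) (hp : Prov lab (D.plug R p)) :
    AllSpl lab (D.plug R c) := by
  intro G Z P h e hd hP hZ
  have eG := eq_indL e hd
  have eZ := eq_indR e hd
  have hs := hr.sub
  have hZcl : ∀ x y, (D.plug R c).adj x y → x ∈ Z.V → y ∈ Z.V := by
    intro x y hxy hx
    rw [e] at hxy
    rcases hxy with h' | h'
    · exact absurd hx (hd x (G.mem h'))
    · exact Z.mem' h'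
  by_cases h1 : ∀ x, x ∈ c.V → x ∉ Z.V
  · -- the redex is outside `Z`
    have eq := stepPar hr hdc e hd (Or.inr h1)
    have eZ' : (D.plug R p).ind {x | x ∈ Z.V} = Z := by
      conv_rhs => rw [eZ]
      apply ext' <;> simp only [mem_plug, adj_plug, mem_ind, adj_ind, Set.mem_ofPred_eq]
      · intro x
        have := h1 x
        have := hs x
        tauto
      · intro x y
        have := h1 x
        have := hs x
        have := h1 y
        have := hs y
        grind
    rw [eZ'] at eq
    refine (hS _ Z P h eq (fun x hx => hx.2) hP hZ).red (Drv.red ?_)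
    conv_rhs => rw [eG]
    exact stepInd hr hdc (Or.inl h1)
  push Not at h1
  obtain ⟨x0, hx0, hx0Z⟩ := h1
  by_cases h2 : (∀ x, x ∈ c.V → x ∈ Z.V) ∧ ∀ x, x ∈ c.V → h x = h x0
  · -- the redex is inside a fibre
    obtain ⟨hcZ, hch⟩ := h2
    have eq := stepPar hr hdc e hd (Or.inl hcZ)
    have eG' : (D.plug R p).ind {x | x ∉ Z.V} = G := by
      conv_rhs => rw [eG]
      apply ext' <;> simp only [mem_plug, adj_plug, mem_ind, adj_ind, Set.mem_ofPred_eq]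
      · intro x
        have := hcZ x
        have := hs x
        tauto
      · intro x y
        have := hcZ x
        have := hs x
        have := hcZ y
        have := hs y
        grind
    rw [eG'] at eq
    obtain ⟨Z', hZ'⟩ : ∃ Z', Z' = (D.plug R p).ind {x | x ∈ Z.V} := ⟨_, rfl⟩
    rw [← hZ'] at eq
    have hdZ' : Dj G Z' := by
      intro x hx hx'
      rw [hZ'] at hx'
      exact hd x hx hx'.2
    have hdr : ∀ S : Set α, ((∀ x, x ∈ c.V → x ∈ S) ∨ (∀ x, x ∈ c.V → x ∉ S)) →
        Drv lab (Z'.ind S) (Z.ind S) := by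
      intro S hS'
      conv_rhs => rw [eZ]
      rw [hZ', ind_ind, ind_ind]
      refine stepInd hr hdc ?_
      rcases hS' with h' | h'
      · exact Or.inl fun x hx => ⟨hcZ x hx, h' x hx⟩
      · exact Or.inr fun x hx hx' => h' x hx hx'.2
    have hfib : ∀ i, ((∀ x, x ∈ c.V → x ∈ {x | h x = i}) ∨ (∀ x, x ∈ c.V → x ∉ {x | h x = i})) := by
      intro i
      by_cases hi : h x0 = i
      · exact Or.inl fun x hx => (hch x hx).trans hi
      · exact Or.inr fun x hx hx' => hi ((hch x hx).symm.trans hx')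
    have hfib' : ∀ i, ((∀ x, x ∈ c.V → x ∈ {x | x ∉ {x | h x = i}}) ∨
        (∀ x, x ∈ c.V → x ∉ {x | x ∉ {x | h x = i}})) := by
      intro i
      rcases hfib i with h' | h'
      · exact Or.inr fun x hx hx' => hx' (h' x hx)
      · exact Or.inl h'
    have hZ'Z : ∀ x, x ∈ Z'.V → x ∈ Z.V := by
      intro x hx; rw [hZ'] at hx; exact hx.2
    have dsub : ∀ (K : SG α) (S : Set α), (∀ x, x ∈ K.V → x ∈ G.V) → Dj K (Z.ind S) :=
      fun K S hK x hx hx' => hd x (hK x hx) hx'.1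
    have cZ' : Cm Z' P h := by
      intro x y hx hy hxy
      rw [← hZ.2.2 x y (hZ'Z x hx) (hZ'Z y hy) hxy]
      rw [hZ'] at hx hy
      have : ¬ (x ∈ c.V ∧ y ∈ c.V) := fun h' => hxy ((hch x h'.1).trans (hch y h'.2).symm)
      rw [hZ']
      conv_rhs => rw [eZ]
      simp only [mem_plug, adj_plug, mem_ind, adj_ind, Set.mem_ofPred_eq] at hx hy ⊢
      have := hs x
      have := hs y
      have := hdc x
      have := hdc y
      grind
    by_cases hne : ∃ x, x ∈ Z'.V ∧ h x = h x0
    · have hC : Comp Z' P h := by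
        refine ⟨fun x hx => hZ.1 x (hZ'Z x hx), fun i hi => ?_, cZ'⟩
        by_cases hi0 : i = h x0
        · subst hi0; exact hne
        · obtain ⟨x, hx, rfl⟩ := hZ.2.1 i hi
          refine ⟨x, ?_, rfl⟩
          have hxc : x ∉ c.V := fun h' => hi0 (hch x h')
          have hx2 := hx
          rw [eZ] at hx2
          rw [hZ']
          exact ⟨Or.inl (hx2.1.resolve_right hxc), hx⟩
      rcases hS G Z' P h eq hdZ' hP hC with ⟨K, k, hk, cK, hrK, hpK⟩ | ⟨i, hi, KA, KB, hdK, hrK, pA, pB⟩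
      · exact Or.inl ⟨K, k, hk, cK, hrK, fun i hi =>
          (hpK i hi).drv ((hdr _ (hfib i)).parR _ (dsub _ _ fun x hx => hrK.sub x hx.1))⟩
      · exact Or.inr ⟨i, hi, KA, KB, hdK, hrK,
          pA.drv ((hdr _ (hfib i)).parR _ (dsub _ _ fun x hx => hrK.sub x (Or.inl hx))),
          pB.drv ((hdr _ (hfib' i)).parR _ (dsub _ _ fun x hx => hrK.sub x (Or.inr hx)))⟩
    · push Not at hne
      refine Or.inr ⟨h x0, hZ.1 x0 hx0Z, emp, G, fun x hx => hx.elim, ?_, ?_, ?_⟩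
      · rw [emp_par]; exact Red.refl _
      · have := hdr _ (hfib (h x0))
        rw [ind_emp (Z := Z') (S := {x | h x = h x0}) hne] at this
        rw [emp_par]
        exact this
      · have := hdr _ (hfib' (h x0))
        rw [ind_self (Z := Z') (S := {x | x ∉ {x | h x = h x0}}) hne] at this
        rw [eq] at hp
        exact hp.drv (this.parR G (dsub _ _ fun _ h => h))
  -- the redex contains `Z`
  have cZ : Conn Z := connCP hP hZ
  have hmod : (D.plug R c).Mod c.V := by
    intro v hv hvM x hx hxM y hy hyM hvx
    have := hdc x
    have := hdc y
    grind
  have hccadj : ∀ x y, x ∈ c.V → y ∈ c.V → (D.plug R c).adj x y → c.adj x y := by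
    intro x y hx hy hxy
    have := hdc x
    have := hdc y
    grind
  have eZi : (D.plug R c).ind Z.V = Z := eZ.symm
  have hZsub : ∀ x, x ∈ Z.V → x ∈ (D.plug R c).V := by
    intro x hx; rw [e]; exact Or.inr hx
  have hZc : ∀ x, x ∈ Z.V → x ∈ c.V := by
    by_cases hcZ : ∀ x, x ∈ c.V → x ∈ Z.V
    · have h3 : ∃ y, y ∈ c.V ∧ h y ≠ h x0 := by
        by_contra hno
        push Not at hno
        exact h2 ⟨hcZ, hno⟩
      obtain ⟨y, hy, hyx⟩ := h3
      rcases hP with ⟨hPp, h4⟩ | ⟨a, b, hab, hPV, hPadj⟩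
      · refine primeMod hPp h4 hZ (c := c.V) ?_ hx0Z hx0 (hcZ y hy) hy hyx.symm
        rw [← eZi]
        exact hmod.ind _
      · exfalso
        obtain ⟨u, v, hu, hv, huU, hvU, hnadj⟩ := hr.coconn {x | h x = h x0} ⟨x0, hx0, rfl⟩ ⟨y, hy, hyx⟩
        have huv : h u ≠ h v := by
          intro h'
          exact hvU (h'.symm.trans huU)
        apply hnadj
        apply hccadj u v hu hv
        rw [e]
        refine Or.inr ((hZ.2.2 u v (hcZ u hu) (hcZ v hv) huv).2 ?_)
        have k1 := (hPV _).1 (hZ.1 u (hcZ u hu))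
        have k2 := (hPV _).1 (hZ.1 v (hcZ v hv))
        rcases k1 with k1 | k1 <;> rcases k2 with k2 | k2
        · exact absurd (k1.trans k2.symm) huv
        · rw [k1, k2]; exact hPadj
        · rw [k1, k2]; exact P.symm hPadj
        · exact absurd (k1.trans k2.symm) huv
    · push Not at hcZ
      obtain ⟨y, hy, hyZ⟩ := hcZ
      by_contra hno
      push Not at hno
      obtain ⟨z, hz, hzc⟩ := hno
      exact hyZ (modInComp (Y := D.plug R c) (Z := Z.V) (M := c.V) (by rw [eZi]; exact cZ) hZcl hmod
        (hZsub x0 hx0Z) hx0Z hx0 (hZsub z hz) hz hzc y (Or.inr hy) hy)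
  have hR : ∀ x, x ∈ D.V → x ∉ R := by
    intro x hx hxR
    have := hZcl x0 x (Or.inr (Or.inr (Or.inr ⟨hx, hxR, hx0, fun h' => hdc x0 h' hx0⟩))) hx0Z
    exact hdc x hx (hZc x this)
  have epar : ∀ c' : SG α, D.plug R c' = D.par c' := by
    intro c'
    apply ext'
    · exact fun x => Iff.rfl
    · intro x y
      simp only [adj_plug, adj_par]
      have := hR x
      have := hR y
      tauto
  have bD : ∀ x, x ∈ D.V → x ∈ (D.plug R c).V := fun x hx => Or.inl hx
  have bc : ∀ x, x ∈ c.V → x ∈ (D.plug R c).V := fun x hx => Or.inr hx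
  generalize hBd : (D.plug R c).V = Bd at ih bD bc
  rw [epar] at hS hp e
  rw [epar] at hccadj hZcl
  cases hr with
  | ai x y hxy hl =>
    exfalso
    obtain ⟨z, hz, hzx⟩ := hZ.other hP (h x0)
    obtain ⟨u, v, hu, hv, hadj⟩ := cZ {x | h x = h x0} ⟨x0, hx0Z, rfl⟩ ⟨z, hz, hzx⟩
    exact hccadj u v (hZc u (Z.mem hadj)) (hZc v (Z.mem' hadj)) (by rw [e]; exact Or.inr hadj)
  | ss A B S hBA ha hb =>
    exact ssCase ih hS (fun x hx h' => hdc x hx (Or.inl h')) (fun x hx h' => hdc x hx (Or.inr h'))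
      hBA ha hb e hd hZc bD (fun x hx => bc x (Or.inl hx)) (fun x hx => bc x (Or.inr hx)) hP hZ
  | p Q X Y t hQ h4 hXY hX hY hXs cX cY =>
    have dX : Dj D X := fun x hx h' => hdc x hx (Or.inl h')
    have dY : Dj D Y := fun x hx h' => hdc x hx (Or.inr h')
    have hoth : ∀ i, i ∈ Q.V → ∃ b, (b ∈ X.V ∨ b ∈ Y.V) ∧ t b ≠ i := by
      intro i hi
      obtain ⟨j, hj, hji, _⟩ := not_two_of_card h4 i i
      obtain ⟨x, hx, rfl⟩ := hXs j hj
      exact ⟨x, Or.inl hx, hji⟩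
    have aZ : ∀ u v, Z.adj u v → X.adj u v ∨ Y.adj u v := fun u v hadj =>
      hccadj u v (hZc u (Z.mem hadj)) (hZc v (Z.mem' hadj)) (by rw [e]; exact Or.inr hadj)
    by_cases hzX : ∃ x, x ∈ Z.V ∧ x ∈ X.V
    · have hZX := cZ.sub hzX (fun u v hadj hu => by
        rcases aZ u v hadj with h' | h'
        · exact X.mem' h'
        · exact absurd (Y.mem h') (hXY u hu))
      refine pStepY ih (D := D) (X := Y) (Y := X) (Q := Q.compl) (t := t) (by rwa [pprem_comm])
        (by rwa [pprem_comm]) dY dX hXY.symm hY hX (compl_coc hY cY) (compl_cm hX cX) ?_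
        (by rwa [par_comm Y X]) hd hZX bD (fun x hx => bc x (Or.inr hx))
        (fun x hx => bc x (Or.inl hx)) hP hZ
      intro i hi
      obtain ⟨b, hb, hbi⟩ := hoth i hi
      exact ⟨b, hb.symm, hbi⟩
    · push Not at hzX
      exact pStepY ih hS hp dX dY hXY hX hY cX cY hoth e hd
        (fun x hx => (hZc x hx).resolve_left (hzX x hx)) bD (fun x hx => bc x (Or.inl hx))
        (fun x hx => bc x (Or.inr hx)) hP hZ

theorem mainN [Finite α] (n : ℕ) : ∀ H : SG α, H.V.ncard ≤ n → Prov lab H → AllSpl lab H := by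
  induction n using Nat.strong_induction_on with
  | _ n IHn =>
    intro H hn hp
    induction hp with
    | refl =>
      intro G Z P h e hd hP hZ
      exfalso
      obtain ⟨z, hz, _⟩ := hZ.other hP (hP.two (hP.two (Classical.choose (hP.two
        (Classical.choice (by
          rcases hP with ⟨_, h4⟩ | ⟨a, _⟩
          · obtain ⟨a, _⟩ := three_of_card h4
            exact ⟨a⟩
          · exact ⟨a⟩))))).choose).choose
      have : z ∈ (emp : SG α).V := by rw [e]; exact Or.inr hz
      exact this
    | @tail H' H h1 h2 ihd =>
      obtain ⟨D, R, p, c, hr, hdc, rfl, rfl⟩ := h2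
      have hsub : ∀ x, x ∈ (D.plug R p).V → x ∈ (D.plug R c).V :=
        fun x hx => hx.imp id (hr.sub x)
      refine step hr hdc ?_ (ihd ((Set.ncard_le_ncard hsub (Set.toFinite _)).trans hn)) h1
      rintro G Z P h bG bZ ⟨b, hb, hbG, hbZ⟩ hp' hd hP hZ
      have hlt : (G.par Z).V.ncard < (D.plug R c).V.ncard := by
        refine Set.ncard_lt_ncard ⟨?_, fun h' => ?_⟩ (Set.toFinite _)
        · rintro x (hx | hx)
          · exact bG x hx
          · exact bZ x hx
        · exact (h' hb).elim hbG hbZ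
      exact IHn _ (lt_of_lt_of_le hlt hn) (G.par Z) le_rfl hp' G Z P h rfl hd hP hZ

/-- Tensor splitting inside the universe. -/
theorem tensorSplit [Finite α] {G Z : SG α} {A : Set α} (hp : Prov lab (G.par Z)) (hd : Dj G Z)
    (hall : ∀ x y, x ∈ Z.V → y ∈ Z.V → x ∈ A → y ∉ A → Z.adj x y) : SplB lab G Z A :=
  tensOf (fun P h hP hC => mainN _ _ le_rfl hp G Z P h rfl hd hP hC) hp hall

end SG
end

section
namespace SG
open LGraph

variable {α : Type} {lab : α → Atom}

/-- `Rep lab G X f`: the labelled graph `G` is represented by the graph `X` of the universe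
through the injection `f`. -/
structure Rep (lab : α → Atom) (G : LGraph) (X : SG α) (f : G.V → α) : Prop where
  inj : Function.Injective f
  mem : ∀ x, x ∈ X.V ↔ ∃ v, f v = x
  adj : ∀ v w, G.adj v w ↔ X.adj (f v) (f w)
  lab : ∀ v, lab (f v) = G.label v

def img (G : LGraph) (f : G.V → α) (hf : Function.Injective f) : SG α where
  V := {x | ∃ v, f v = x}
  adj x y := ∃ v w, f v = x ∧ f w = y ∧ G.adj v w
  symm := by
    rintro x y ⟨v, w, h1, h2, h⟩
    exact ⟨w, v, h2, h1, G.symm h⟩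
  irrefl := by
    rintro x ⟨v, w, h1, h2, h⟩
    have := hf (h1.trans h2.symm)
    subst this
    exact G.irrefl v h
  mem := by
    rintro x y ⟨v, w, h1, h2, h⟩
    exact ⟨v, h1⟩

theorem img_adj {G : LGraph} {f : G.V → α} (hf : Function.Injective f) (v w : G.V) :
    G.adj v w ↔ (img G f hf).adj (f v) (f w) := by
  refine ⟨fun h => ⟨v, w, rfl, rfl, h⟩, ?_⟩
  rintro ⟨v', w', h1, h2, h⟩
  rwa [← hf h1, ← hf h2]

theorem rep_img {G : LGraph} {f : G.V → α} (hf : Function.Injective f)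
    (hl : ∀ v, lab (f v) = G.label v) : Rep lab G (img G f hf) f :=
  ⟨hf, fun _ => Iff.rfl, img_adj hf, hl⟩

theorem Rep.eq {G : LGraph} {X Y : SG α} {f : G.V → α} (h : Rep lab G X f) (h' : Rep lab G Y f) :
    X = Y := by
  have key : ∀ {X Y : SG α}, Rep lab G X f → Rep lab G Y f → ∀ x y, X.adj x y → Y.adj x y := by
    intro X Y h h' x y hxy
    obtain ⟨v, rfl⟩ := (h.mem x).1 (X.mem hxy)
    obtain ⟨w, rfl⟩ := (h.mem y).1 (X.mem' hxy)
    exact (h'.adj v w).1 ((h.adj v w).2 hxy)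
  exact ext' (fun x => (h.mem x).trans (h'.mem x).symm)
    (fun x y => ⟨key h h' x y, key h' h x y⟩)

theorem isoOf {G H : LGraph} (f : G.V → H.V) (hf : Function.Bijective f)
    (ha : ∀ v w, G.adj v w ↔ H.adj (f v) (f w)) (hl : ∀ v, H.label (f v) = G.label v) :
    G.iso H :=
  ⟨⟨Equiv.ofBijective f hf, ha, hl⟩⟩

theorem iso_symm {G H : LGraph} (h : G.iso H) : H.iso G := by
  obtain ⟨e, h1, h2⟩ := h
  refine ⟨⟨e.symm, fun v w => ?_, fun v => ?_⟩⟩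
  · rw [h1]; simp
  · rw [← h2]; simp

theorem iso_trans {G H K : LGraph} (h : G.iso H) (h' : H.iso K) : G.iso K := by
  obtain ⟨e, h1, h2⟩ := h
  obtain ⟨e', h1', h2'⟩ := h'
  refine ⟨⟨e.trans e', fun v w => ?_, fun v => ?_⟩⟩
  · rw [h1, h1']; rfl
  · rw [← h2, ← h2']; rfl

theorem Rep.comp {G H : LGraph} {X : SG α} {f : H.V → α} (h : Rep lab H X f) (i : Iso G H) :
    Rep lab G X (f ∘ i.toEquiv) := by
  refine ⟨h.inj.comp i.toEquiv.injective, fun x => ?_, fun v w => ?_, fun v => ?_⟩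
  · rw [h.mem]
    constructor
    · rintro ⟨v, rfl⟩
      exact ⟨i.toEquiv.symm v, by simp⟩
    · rintro ⟨v, rfl⟩
      exact ⟨_, rfl⟩
  · rw [i.adj_iff, h.adj]; rfl
  · rw [← i.label_eq, ← h.lab]; rfl

theorem Rep.iso {G H : LGraph} {X : SG α} {f : G.V → α} {g : H.V → α} (h : Rep lab G X f)
    (h' : Rep lab H X g) : G.iso H := by
  have : ∀ v, ∃ w, g w = f v := fun v => (h'.mem _).1 ((h.mem _).2 ⟨v, rfl⟩)
  choose k hk using this
  refine isoOf k ⟨fun v w hvw => ?_, fun w => ?_⟩ (fun v w => ?_) (fun v => ?_)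
  · apply h.inj
    rw [← hk, ← hk, hvw]
  · obtain ⟨v, hv⟩ := (h.mem _).1 ((h'.mem _).2 ⟨w, rfl⟩)
    exact ⟨v, h'.inj ((hk v).trans hv)⟩
  · rw [h.adj, h'.adj, hk, hk]
  · rw [← h.lab, ← h'.lab, hk]

theorem Rep.plug {C K : LGraph} {X Y : SG α} {f : C.V → α} {g : K.V → α} {R : Set C.V} {R' : Set α}
    (h : Rep lab C X f) (h' : Rep lab K Y g) (hd : Dj X Y) (hR : ∀ v, v ∈ R ↔ f v ∈ R') :
    Rep lab (C.plug R K) (X.plug R' Y) (Sum.elim f g) := by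
  have hf : ∀ v, f v ∈ X.V := fun v => (h.mem _).2 ⟨v, rfl⟩
  have hg : ∀ v, g v ∈ Y.V := fun v => (h'.mem _).2 ⟨v, rfl⟩
  have hf' : ∀ v, f v ∉ Y.V := fun v => hd _ (hf v)
  have hg' : ∀ v, g v ∉ X.V := fun v h => hd _ h (hg v)
  have aX : ∀ x y, X.adj x y → x ∈ X.V ∧ y ∈ X.V := fun x y h => ⟨X.mem h, X.mem' h⟩
  have aY : ∀ x y, Y.adj x y → x ∈ Y.V ∧ y ∈ Y.V := fun x y h => ⟨Y.mem h, Y.mem' h⟩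
  refine ⟨?_, fun x => ?_, ?_, ?_⟩
  · rintro (v | v) (w | w) hvw
    · exact congrArg _ (h.inj hvw)
    · exact absurd (hg w) (by rw [← show f v = g w from hvw]; exact hf' v)
    · exact absurd (hg v) (by rw [show g v = f w from hvw]; exact hf' w)
    · exact congrArg _ (h'.inj hvw)
  · rw [mem_plug, h.mem, h'.mem]
    constructor
    · rintro (⟨v, hv⟩ | ⟨v, hv⟩)
      · exact ⟨.inl v, hv⟩
      · exact ⟨.inr v, hv⟩
    · rintro ⟨v | v, hv⟩
      · exact Or.inl ⟨v, hv⟩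
      · exact Or.inr ⟨v, hv⟩
  · rintro (v | v) (w | w)
    · have e : (C.plug R K).adj (.inl v) (.inl w) ↔ C.adj v w := Iff.rfl
      rw [e, h.adj, adj_plug]
      simp only [Sum.elim_inl]
      have := hf' v
      have := hf' w
      have := aY (f v) (f w)
      tauto
    · have e : (C.plug R K).adj (.inl v) (.inr w) ↔ v ∈ R := Iff.rfl
      rw [e, hR, adj_plug]
      simp only [Sum.elim_inl, Sum.elim_inr]
      have := hf v
      have := hg w
      have := hf' v
      have := hg' w
      have := aY (f v) (g w)
      have := aX (f v) (g w)
      tauto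
    · have e : (C.plug R K).adj (.inr v) (.inl w) ↔ w ∈ R := Iff.rfl
      rw [e, hR, adj_plug]
      simp only [Sum.elim_inl, Sum.elim_inr]
      have := hf w
      have := hg v
      have := hf' w
      have := hg' v
      have := aY (g v) (f w)
      have := aX (g v) (f w)
      tauto
    · have e : (C.plug R K).adj (.inr v) (.inr w) ↔ K.adj v w := Iff.rfl
      rw [e, h'.adj, adj_plug]
      simp only [Sum.elim_inr]
      have := hg' v
      have := hg' w
      have := aX (g v) (g w)
      tauto
  · rintro (v | v)
    · exact h.lab v
    · exact h'.lab v

theorem par_plug (G H : LGraph) : G.par H = G.plug ∅ H := by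
  have : parAdj G H = plugAdj G ∅ H := by
    funext x y
    rcases x with x | x <;> rcases y with y | y <;> rfl
  unfold LGraph.par LGraph.plug
  simp only [this]

theorem Rep.par {C K : LGraph} {X Y : SG α} {f : C.V → α} {g : K.V → α}
    (h : Rep lab C X f) (h' : Rep lab K Y g) (hd : Dj X Y) :
    Rep lab (C.par K) (X.par Y) (Sum.elim f g) := by
  have := Rep.plug (R := ∅) (R' := ∅) h h' hd (fun v => Iff.rfl)
  rw [plug_par] at this
  refine ⟨this.inj, this.mem, fun v w => ?_, this.lab⟩
  refine Iff.trans ?_ (this.adj v w)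
  rcases v with v | v <;> rcases w with w | w <;> exact Iff.rfl

/-- Splitting a representation of `C[K]_R`. -/
theorem Rep.unplug {C K : LGraph} {R : Set C.V} {X : SG α} {f : (C.plug R K).V → α}
    (h : Rep lab (C.plug R K) X f) : ∃ (D Y : SG α) (S : Set α),
      Rep lab C D (fun v => f (.inl v)) ∧ Rep lab K Y (fun v => f (.inr v)) ∧ Dj D Y ∧
      (∀ v, v ∈ R ↔ f (.inl v) ∈ S) ∧ X = D.plug S Y := by
  have h1 : Function.Injective (fun v : C.V => f (.inl v)) := h.inj.comp Sum.inl_injective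
  have h2 : Function.Injective (fun v : K.V => f (.inr v)) := h.inj.comp Sum.inr_injective
  have r1 : Rep lab C (img C _ h1) _ := rep_img h1 (fun v => h.lab (.inl v))
  have r2 : Rep lab K (img K _ h2) _ := rep_img h2 (fun v => h.lab (.inr v))
  have hd : Dj (img C _ h1) (img K _ h2) := by
    rintro x ⟨v, rfl⟩ ⟨w, hw⟩
    have := h.inj hw
    cases this
  have hS : ∀ v, v ∈ R ↔ f (.inl v) ∈ {x | ∃ v, v ∈ R ∧ f (.inl v) = x} := by
    intro v
    refine ⟨fun hv => ⟨v, hv, rfl⟩, ?_⟩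
    rintro ⟨w, hw, e⟩
    rwa [← h1 e]
  refine ⟨_, _, {x | ∃ v, v ∈ R ∧ f (.inl v) = x}, r1, r2, hd, hS, ?_⟩
  have := r1.plug r2 hd hS
  refine h.eq (Eq.mp ?_ this)
  congr 1
  funext v
  rcases v with v | v <;> rfl

theorem Rep.unpar {C K : LGraph} {X : SG α} {f : (C.par K).V → α}
    (h : Rep lab (C.par K) X f) : ∃ (D Y : SG α),
      Rep lab C D (fun v => f (.inl v)) ∧ Rep lab K Y (fun v => f (.inr v)) ∧ Dj D Y ∧
      X = D.par Y := by
  have h' : Rep lab (C.plug ∅ K) X f := by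
    refine ⟨h.inj, h.mem, fun v w => ?_, h.lab⟩
    refine Iff.trans ?_ (h.adj v w)
    rcases v with v | v <;> rcases w with w | w <;> exact Iff.rfl
  obtain ⟨D, Y, S, r1, r2, hd, hS, e⟩ := h'.unplug
  refine ⟨D, Y, r1, r2, hd, ?_⟩
  rw [e]
  apply ext'
  · exact fun x => Iff.rfl
  · intro x y
    have hn : ∀ x, x ∈ D.V → x ∉ S := by
      intro x hx hxS
      obtain ⟨v, rfl⟩ := (r1.mem x).1 hx
      exact (hS v).2 hxS
    have := hn x
    have := hn y
    simp only [adj_plug, adj_par]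
    tauto

/-- The complete graph. -/
def cg (ι : Type) [Fintype ι] : LGraph where
  V := ι
  adj i j := i ≠ j
  symm h := h.symm
  irrefl _ h := h rfl
  label _ := (0, true)

theorem comp_same {P : LGraph} {F : P.V → LGraph} (v : P.V) (a b : (F v).V) :
    (P.comp F).adj ⟨v, a⟩ ⟨v, b⟩ ↔ (F v).adj a b := by
  constructor
  · rintro (⟨w, x, y, h1, h2, h⟩ | h)
    · cases h1
      cases h2
      exact h
    · exact absurd rfl h.1
  · exact fun h => Or.inl ⟨v, a, b, rfl, rfl, h⟩

theorem comp_ne {P : LGraph} {F : P.V → LGraph} {v w : P.V} (hvw : v ≠ w) (a : (F v).V)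
    (b : (F w).V) : (P.comp F).adj ⟨v, a⟩ ⟨w, b⟩ ↔ P.adj v w := by
  constructor
  · rintro (⟨w, x, y, h1, h2, h⟩ | h)
    · cases h1
      cases h2
      exact absurd rfl hvw
    · exact h.2
  · exact fun h => Or.inr ⟨hvw, h⟩

theorem bigTensor_iso (n : ℕ) : ∀ F : Fin n → LGraph, (bigTensor n F).iso ((cg (Fin n)).comp F) := by
  induction n with
  | zero =>
    intro F
    refine isoOf (fun v => (v : Empty).elim) ⟨fun v => (v : Empty).elim, ?_⟩
      (fun v => (v : Empty).elim) (fun v => (v : Empty).elim)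
    rintro ⟨i, _⟩
    exact Fin.elim0 i
  | succ n ih =>
    intro F
    obtain ⟨e, h1, h2⟩ := ih (fun i => F i.succ)
    let k : (bigTensor (n + 1) F).V → ((cg (Fin (n + 1))).comp F).V := fun x =>
      match (x : (F 0).V ⊕ (bigTensor n fun i => F i.succ).V) with
      | .inl a => ⟨(0 : Fin (n + 1)), a⟩
      | .inr b => ⟨Fin.succ (e b).1, (e b).2⟩
    have kl : ∀ a : (F 0).V, k (Sum.inl a) = ⟨(0 : Fin (n + 1)), a⟩ := fun _ => rfl
    have kr : ∀ b : (bigTensor n fun i => F i.succ).V, k (Sum.inr b) =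
      ⟨Fin.succ (e b).1, (e b).2⟩ := fun _ => rfl
    refine isoOf k ⟨?_, ?_⟩ ?_ ?_
    · rintro (a | a) (b | b) hab
      · rw [kl, kl] at hab
        cases hab
        rfl
      · rw [kl, kr] at hab
        exact absurd (congrArg Sigma.fst hab) (Fin.succ_ne_zero _).symm
      · rw [kl, kr] at hab
        exact absurd (congrArg Sigma.fst hab) (Fin.succ_ne_zero _)
      · rw [kr, kr] at hab
        have : e a = e b := by
          generalize e a = x at *
          generalize e b = y at *
          obtain ⟨i, x⟩ := x
          obtain ⟨j, y⟩ := y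
          have hij : i = j := Fin.succ_injective _ (congrArg Sigma.fst hab)
          subst hij
          cases hab
          rfl
        exact congrArg _ (e.injective this)
    · rintro ⟨i, a⟩
      revert a
      refine Fin.cases ?_ (fun i => ?_) (i : Fin (n + 1))
      · exact fun a => ⟨.inl a, rfl⟩
      · intro a
        obtain ⟨z, hz⟩ := e.surjective ⟨i, a⟩
        refine ⟨.inr z, (kr z).trans ?_⟩
        rw [hz]
    · rintro (a | a) (b | b)
      · exact (comp_same (P := cg (Fin (n + 1))) (F := F) (0 : Fin (n + 1)) a b).symm
      · refine Iff.trans ?_ (comp_ne (P := cg (Fin (n + 1))) (F := F)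
          (v := (0 : Fin (n + 1))) (w := Fin.succ (e b).1) (Fin.succ_ne_zero _).symm a (e b).2).symm
        exact ⟨fun _ => (Fin.succ_ne_zero _).symm, fun _ => trivial⟩
      · refine Iff.trans ?_ (comp_ne (P := cg (Fin (n + 1))) (F := F)
          (w := (0 : Fin (n + 1))) (v := Fin.succ (e a).1) (Fin.succ_ne_zero _) (e a).2 b).symm
        exact ⟨fun _ => (Fin.succ_ne_zero _), fun _ => trivial⟩
      · rw [kr, kr]
        have e1 : (bigTensor (n + 1) F).adj (.inr a) (.inr b) ↔
          (bigTensor n fun i => F i.succ).adj a b := Iff.rfl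
        rw [e1, h1]
        generalize e a = x at *
        generalize e b = y at *
        obtain ⟨i, x⟩ := x
        obtain ⟨j, y⟩ := y
        by_cases hij : i = j
        · subst hij
          exact (comp_same (P := cg (Fin n)) (F := fun i => F (Fin.succ i)) i x y).trans
            (comp_same (P := cg (Fin (n + 1))) (F := F) (Fin.succ i) x y).symm
        · refine (comp_ne (P := cg (Fin n)) (F := fun i => F (Fin.succ i)) hij x y).trans ?_
          have hij' : Fin.succ i ≠ Fin.succ j := fun h => hij (Fin.succ_injective _ h)
          refine Iff.trans ?_ (comp_ne (P := cg (Fin (n + 1))) (F := F) hij' x y).symm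
          exact ⟨fun _ => hij', fun _ => hij⟩
    · rintro (a | a)
      · rfl
      · rw [kr]
        exact h2 a

theorem cg_iso {ι κ : Type} [Fintype ι] [Fintype κ] (e : ι ≃ κ) (F : κ → LGraph) :
    ((cg ι).comp fun i => F (e i)).iso ((cg κ).comp F) := by
  refine ⟨⟨Equiv.sigmaCongrLeft (β := fun k => (F k).V) e, ?_, ?_⟩⟩
  · rintro ⟨i, x⟩ ⟨j, y⟩
    by_cases hij : i = j
    · subst hij
      exact (comp_same (P := cg ι) (F := fun i => F (e i)) i x y).trans
        (comp_same (P := cg κ) (F := F) (e i) x y).symm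
    · refine (comp_ne (P := cg ι) (F := fun i => F (e i)) hij x y).trans ?_
      have hij' : e i ≠ e j := fun h => hij (e.injective h)
      refine Iff.trans ?_ (comp_ne (P := cg κ) (F := F) hij' x y).symm
      exact ⟨fun _ => hij', fun _ => hij⟩
  · rintro ⟨i, x⟩
    rfl

theorem prem_iso {P : LGraph} {n : ℕ} (e : P.V ≃ Fin n) (F : Fin n → LGraph) :
    (bigTensor n F).iso ((cg P.V).comp fun v => F (e v)) :=
  iso_trans (bigTensor_iso n F) (iso_symm (cg_iso e F))

end SG
end

section
namespace SG
open LGraph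

variable {α : Type} {lab : α → Atom}

theorem pDn {P : LGraph} {M N : P.V → LGraph} (hP : P.Prime) (h4 : 4 ≤ Fintype.card P.V)
    (hM : ∀ v, Nonempty (M v).V) {X : SG α} {f : ((P.dual.comp M).par (P.comp N)).V → α}
    (r : Rep lab ((P.dual.comp M).par (P.comp N)) X f) :
    ∃ (Y : SG α) (g : ((cg P.V).comp fun v => (M v).par (N v)).V → α),
      Rep lab ((cg P.V).comp fun v => (M v).par (N v)) Y g ∧ Rule lab Y X := by
  classical
  obtain ⟨U, W, rU, rW, hd, e⟩ := r.unpar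
  let u : (v : P.V) → (M v).V → α := fun v a => f (Sum.inl ⟨v, a⟩)
  let w : (v : P.V) → (N v).V → α := fun v a => f (Sum.inr ⟨v, a⟩)
  choose m0 _ using fun v => (⟨Classical.choice (hM v), trivial⟩ : ∃ a : (M v).V, True)
  have uinj : ∀ v a v' a', u v a = u v' a' → (⟨v, a⟩ : Σ v : P.V, (M v).V) = ⟨v', a'⟩ := by
    intro v a v' a' h
    exact Sum.inl_injective (r.inj h)
  have winj : ∀ v a v' a', w v a = w v' a' → (⟨v, a⟩ : Σ v : P.V, (N v).V) = ⟨v', a'⟩ := by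
    intro v a v' a' h
    exact Sum.inr_injective (r.inj h)
  have uw : ∀ v a v' a', u v a ≠ w v' a' := by
    intro v a v' a' h
    exact Sum.inl_ne_inr (r.inj h)
  have uU : ∀ x, x ∈ U.V ↔ ∃ v a, u v a = x := by
    intro x
    rw [rU.mem]
    constructor
    · rintro ⟨⟨v, a⟩, h⟩
      exact ⟨v, a, h⟩
    · rintro ⟨v, a, h⟩
      exact ⟨⟨v, a⟩, h⟩
  have wW : ∀ x, x ∈ W.V ↔ ∃ v a, w v a = x := by
    intro x
    rw [rW.mem]
    constructor
    · rintro ⟨⟨v, a⟩, h⟩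
      exact ⟨v, a, h⟩
    · rintro ⟨v, a, h⟩
      exact ⟨⟨v, a⟩, h⟩
  have uU' : ∀ v a, u v a ∈ U.V := fun v a => (uU _).2 ⟨v, a, rfl⟩
  have wW' : ∀ v a, w v a ∈ W.V := fun v a => (wW _).2 ⟨v, a, rfl⟩
  have uW : ∀ v a, u v a ∉ W.V := fun v a => hd _ (uU' v a)
  have wU : ∀ v a, w v a ∉ U.V := fun v a h => hd _ h (wW' v a)
  have aU1 : ∀ v a b, U.adj (u v a) (u v b) ↔ (M v).adj a b := fun v a b =>
    (rU.adj ⟨v, a⟩ ⟨v, b⟩).symm.trans (comp_same (P := P.dual) v a b)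
  have aW1 : ∀ v a b, W.adj (w v a) (w v b) ↔ (N v).adj a b := fun v a b =>
    (rW.adj ⟨v, a⟩ ⟨v, b⟩).symm.trans (comp_same (P := P) v a b)
  have aU2 : ∀ v v' a b, v ≠ v' → (U.adj (u v a) (u v' b) ↔ ¬ P.adj v v') := by
    intro v v' a b hvv
    refine (rU.adj ⟨v, a⟩ ⟨v', b⟩).symm.trans ((comp_ne (P := P.dual) hvv a b).trans ?_)
    exact ⟨fun h => h.2, fun h => ⟨hvv, h⟩⟩
  have aW2 : ∀ v v' a b, v ≠ v' → (W.adj (w v a) (w v' b) ↔ P.adj v v') := fun v v' a b hvv =>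
    (rW.adj ⟨v, a⟩ ⟨v', b⟩).symm.trans (comp_ne (P := P) hvv a b)
  have hρ : Function.Injective (fun v => u v (m0 v)) := by
    intro v v' h
    exact congrArg Sigma.fst (uinj _ _ _ _ h)
  let h : α → α := Function.extend f (Sum.elim (fun s => u s.1 (m0 s.1)) (fun s => u s.1 (m0 s.1))) id
  have hu : ∀ v a, h (u v a) = u v (m0 v) := fun v a => r.inj.extend_apply _ _ (Sum.inl ⟨v, a⟩)
  have hw : ∀ v a, h (w v a) = u v (m0 v) := fun v a => r.inj.extend_apply _ _ (Sum.inr ⟨v, a⟩)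
  have hne : ∀ v v', u v (m0 v) ≠ u v' (m0 v') ↔ v ≠ v' := fun v v' => hρ.ne_iff
  refine ⟨pprem U W h, fun s => Sum.elim (u s.1) (w s.1) s.2, ⟨?_, ?_, ?_, ?_⟩, ?_⟩
  · rintro ⟨v, a | a⟩ ⟨v', b | b⟩ hab
    · cases uinj _ _ _ _ hab
      rfl
    · exact absurd hab (uw _ _ _ _)
    · exact absurd hab.symm (uw _ _ _ _)
    · cases winj _ _ _ _ hab
      rfl
  · intro x
    rw [mem_pprem, uU, wW]
    constructor
    · rintro (⟨v, a, h⟩ | ⟨v, a, h⟩)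
      · exact ⟨⟨v, .inl a⟩, h⟩
      · exact ⟨⟨v, .inr a⟩, h⟩
    · rintro ⟨⟨v, a | a⟩, h⟩
      · exact Or.inl ⟨v, a, h⟩
      · exact Or.inr ⟨v, a, h⟩
  · rintro ⟨v, a⟩ ⟨v', b⟩
    by_cases hvv : v = v'
    · subst hvv
      refine (comp_same (P := cg P.V) (F := fun v => (M v).par (N v)) v a b).trans ?_
      have n1 : ∀ x, h (Sum.elim (u v) (w v) x) = u v (m0 v) := by
        rintro (x | x)
        · exact hu _ _
        · exact hw _ _
      have n2 : (pprem U W h).adj (Sum.elim (u v) (w v) a) (Sum.elim (u v) (w v) b) ↔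
          (U.adj (Sum.elim (u v) (w v) a) (Sum.elim (u v) (w v) b) ∨
            W.adj (Sum.elim (u v) (w v) a) (Sum.elim (u v) (w v) b)) := by
        constructor
        · rintro (h' | h' | h')
          · exact Or.inl h'
          · exact Or.inr h'
          · exact absurd ((n1 a).trans (n1 b).symm) h'.1
        · rintro (h' | h')
          · exact Or.inl h'
          · exact Or.inr (Or.inl h')
      refine Iff.trans ?_ n2.symm
      rcases a with a | a <;> rcases b with b | b
      · refine Iff.trans (aU1 v a b).symm ⟨Or.inl, fun h => h.resolve_right fun h => uW _ _ (W.mem h)⟩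
      · exact ⟨fun h => h.elim, fun h => h.elim (fun h => wU _ _ (U.mem' h)) (fun h => uW _ _ (W.mem h))⟩
      · exact ⟨fun h => h.elim, fun h => h.elim (fun h => wU _ _ (U.mem h)) (fun h => uW _ _ (W.mem' h))⟩
      · refine Iff.trans (aW1 v a b).symm ⟨Or.inr, fun h => h.resolve_left fun h => wU _ _ (U.mem h)⟩
    · refine (comp_ne (P := cg P.V) (F := fun v => (M v).par (N v)) hvv a b).trans ?_
      refine ⟨fun _ => Or.inr (Or.inr ⟨?_, ?_, ?_⟩), fun _ => hvv⟩
      · have := (hne v v').2 hvv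
        rcases a with a | a <;> rcases b with b | b
        · exact ((hu v a).trans_ne this).trans_eq (hu v' b).symm
        · exact ((hu v a).trans_ne this).trans_eq (hw v' b).symm
        · exact ((hw v a).trans_ne this).trans_eq (hu v' b).symm
        · exact ((hw v a).trans_ne this).trans_eq (hw v' b).symm
      · rcases a with a | a
        · exact Or.inl (uU' _ _)
        · exact Or.inr (wW' _ _)
      · rcases b with a | a
        · exact Or.inl (uU' _ _)
        · exact Or.inr (wW' _ _)
  · rintro ⟨v, a | a⟩
    · exact r.lab (Sum.inl ⟨v, a⟩)
    · exact r.lab (Sum.inr ⟨v, a⟩)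
  · rw [e]
    refine Rule.p (img P _ hρ) U W h ?_ ?_ hd ?_ ?_ ?_ ?_ ?_
    · intro T hT hmod
      have hm : P.IsModule {v | u v (m0 v) ∈ T} := by
        have key : ∀ v, u v (m0 v) ∉ T → ∀ x, u x (m0 x) ∈ T → ∀ y, u y (m0 y) ∈ T →
            P.adj v x → P.adj v y := by
          intro v hv x hx y hy hvx
          exact (img_adj hρ v y).2 (hmod _ ⟨v, rfl⟩ hv _ ⟨x, rfl⟩ hx _ ⟨y, rfl⟩ hy
            ((img_adj hρ v x).1 hvx))
        intro v hv x hx y hy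
        exact ⟨key v hv x hx y hy, key v hv y hy x hx⟩
      rcases hP.2 _ hm with h0 | ⟨v, h0⟩ | h0
      · left
        intro x hx
        obtain ⟨v, rfl⟩ := hT x hx
        have : v ∈ {v | u v (m0 v) ∈ T} := hx
        rw [h0] at this
        exact this
      · right; left
        refine ⟨u v (m0 v), fun x hx => ?_⟩
        obtain ⟨v', rfl⟩ := hT x hx
        have : v' ∈ {v | u v (m0 v) ∈ T} := hx
        rw [h0] at this
        rw [show v' = v from this]
      · right; right
        rintro x ⟨v, rfl⟩
        have : v ∈ {v | u v (m0 v) ∈ T} := by rw [h0]; trivial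
        exact this
    · have : (img P _ hρ).V = Set.range (fun v => u v (m0 v)) := rfl
      rw [this, ← Set.image_univ, Set.ncard_image_of_injective _ hρ, Set.ncard_univ,
        Nat.card_eq_fintype_card]
      exact h4
    · intro x hx
      obtain ⟨v, a, rfl⟩ := (uU x).1 hx
      exact ⟨v, (hu v a).symm⟩
    · intro x hx
      obtain ⟨v, a, rfl⟩ := (wW x).1 hx
      exact ⟨v, (hw v a).symm⟩
    · rintro _ ⟨v, rfl⟩
      exact ⟨u v (m0 v), uU' _ _, hu _ _⟩
    · intro x y hx hy hxy
      obtain ⟨v, a, rfl⟩ := (uU x).1 hx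
      obtain ⟨v', b, rfl⟩ := (uU y).1 hy
      rw [hu, hu] at hxy ⊢
      rw [aU2 _ _ _ _ ((hne _ _).1 hxy)]
      exact not_congr (img_adj hρ v v')
    · intro x y hx hy hxy
      obtain ⟨v, a, rfl⟩ := (wW x).1 hx
      obtain ⟨v', b, rfl⟩ := (wW y).1 hy
      rw [hw, hw] at hxy ⊢
      rw [aW2 _ _ _ _ ((hne _ _).1 hxy)]
      exact img_adj hρ v v'

theorem rule_dn {p c : LGraph} (hr : GSRule p c) {X : SG α} {f : c.V → α} (r : Rep lab c X f) :
    ∃ (Y : SG α) (g : p.V → α), Rep lab p Y g ∧ Rule lab Y X := by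
  cases hr with
  | ai a =>
    have hX : X = pair (f (Sum.inl ())) (f (Sum.inr ())) := by
      apply ext'
      · intro x
        rw [r.mem, mem_pair]
        constructor
        · rintro ⟨(_ | _), rfl⟩
          · exact Or.inl rfl
          · exact Or.inr rfl
        · rintro (rfl | rfl)
          · exact ⟨_, rfl⟩
          · exact ⟨_, rfl⟩
      · intro x y
        rw [adj_pair]
        refine ⟨fun h => ?_, fun h => h.elim⟩
        obtain ⟨v, rfl⟩ := (r.mem x).1 (X.mem h)
        obtain ⟨w, rfl⟩ := (r.mem y).1 (X.mem' h)
        have := (r.adj v w).2 h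
        rcases v with v | v <;> rcases w with w | w <;> exact this
    refine ⟨emp, fun v => (v : Empty).elim, ⟨fun v => (v : Empty).elim, fun x => ?_,
      fun v => (v : Empty).elim, fun v => (v : Empty).elim⟩, ?_⟩
    · exact ⟨fun h => h.elim, fun ⟨v, _⟩ => (v : Empty).elim⟩
    · rw [hX]
      refine Rule.ai _ _ (fun h => ?_) ?_
      · have := r.inj h
        cases this
      · exact (r.lab (Sum.inl ())).trans (congrArg dualAtom (r.lab (Sum.inr ()))).symm
  | ss A B S hA hS =>
    obtain ⟨D, Y, rD, rY, hd, e⟩ := r.unpar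
    have hS' : ∀ v, v ∈ S ↔ f (Sum.inl v) ∈ {x | ∃ v, v ∈ S ∧ f (Sum.inl v) = x} := by
      intro v
      refine ⟨fun hv => ⟨v, hv, rfl⟩, ?_⟩
      rintro ⟨w, hw, e⟩
      rwa [← rD.inj e]
    refine ⟨_, _, rD.plug rY hd hS', ?_⟩
    rw [e]
    obtain ⟨a⟩ := hA
    obtain ⟨b, hb⟩ := Set.nonempty_iff_ne_empty.2 hS
    exact Rule.ss _ _ _ hd ⟨_, (rY.mem _).2 ⟨a, rfl⟩⟩ ⟨_, (rD.mem _).2 ⟨b, rfl⟩, b, hb, rfl⟩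
  | p n P e M N hP h4 hM =>
    have hc : 4 ≤ Fintype.card P.V := by
      rw [Fintype.card_congr e, Fintype.card_fin]
      exact h4
    obtain ⟨Y, g, rY, hY⟩ := pDn hP hc (fun v => hM (e v)) r
    obtain ⟨i⟩ := prem_iso e (fun i => (M i).par (N i))
    exact ⟨Y, _, rY.comp i, hY⟩

theorem deriv_dn {G : LGraph} (h : Deriv GSRule LGraph.empty G) :
    ∀ (X : SG α) (f : G.V → α), Rep lab G X f → Prov lab X := by
  induction h with
  | refl =>
    intro X f r
    have : X = emp := eq_emp (fun x hx => by
      obtain ⟨v, _⟩ := (r.mem x).1 hx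
      exact (v : Empty).elim)
    rw [this]
    exact Prov.emp
  | tail _ h2 ih =>
    intro X f r
    rcases h2 with ⟨⟨i⟩⟩ | ⟨C, R, p, c, hr, ⟨i⟩, h'⟩
    · exact ih X _ (r.comp i)
    · obtain ⟨j⟩ := iso_symm h'
      obtain ⟨D, Y, S, rD, rY, hd, hS, e⟩ := (r.comp j).unplug
      obtain ⟨Z, g, rZ, hZ⟩ := rule_dn hr rY
      have := rD.plug rZ (fun x hx h => hd x hx (hZ.sub x h)) hS
      refine Prov.drv (ih _ _ (this.comp i)) (Relation.ReflTransGen.single ?_)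
      exact ⟨D, S, Z, Y, hZ, hd, rfl, e⟩

/-- The labelled graph of a graph of the universe. -/
noncomputable def toL [Finite α] (lab : α → Atom) (X : SG α) : LGraph where
  V := {x // x ∈ X.V}
  fintype := Fintype.ofFinite _
  adj v w := X.adj v.1 w.1
  symm h := X.symm h
  irrefl v h := X.irrefl v.1 h
  label v := lab v.1

theorem rep_toL [Finite α] (X : SG α) : Rep lab (toL lab X) X (fun v => v.1) :=
  ⟨Subtype.val_injective, fun x => ⟨fun hx => ⟨⟨x, hx⟩, rfl⟩, fun ⟨v, hv⟩ => hv ▸ v.2⟩,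
    fun _ _ => Iff.rfl, fun _ => rfl⟩

theorem rep_compL [Finite α] {P X : SG α} {P' : LGraph} (k : P'.V ≃ {x // x ∈ P.V}) {h : α → α}
    (hX : ∀ x, x ∈ X.V → h x ∈ P.V) (F : P'.V → LGraph) (g : ∀ v, (F v).V → α)
    (hF : ∀ v, Rep lab (F v) (X.ind {x | h x = (k v).1}) (g v))
    (hadj : ∀ v w x y, v ≠ w → x ∈ X.V → y ∈ X.V → h x = (k v).1 → h y = (k w).1 →
      (P'.adj v w ↔ X.adj x y)) :
    Rep lab (P'.comp F) X (fun s => g s.1 s.2) := by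
  have hg : ∀ v a, g v a ∈ X.V ∧ h (g v a) = (k v).1 := fun v a => ((hF v).mem _).2 ⟨a, rfl⟩
  refine ⟨?_, ?_, ?_, ?_⟩
  · rintro ⟨v, a⟩ ⟨w, b⟩ (hab : g v a = g w b)
    have : v = w := by
      apply k.injective
      apply Subtype.ext
      rw [← (hg v a).2, ← (hg w b).2, hab]
    subst this
    rw [(hF v).inj hab]
  · intro x
    constructor
    · intro hx
      obtain ⟨v, hv⟩ := k.surjective ⟨h x, hX x hx⟩
      obtain ⟨a, ha⟩ := ((hF v).mem x).1 ⟨hx, show h x = (k v).1 by rw [hv]⟩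
      exact ⟨⟨v, a⟩, ha⟩
    · rintro ⟨⟨v, a⟩, rfl⟩
      exact (hg v a).1
  · rintro ⟨v, a⟩ ⟨w, b⟩
    by_cases hvw : v = w
    · subst hvw
      rw [comp_same, (hF v).adj]
      exact ⟨fun h => h.1, fun h => ⟨h, (hg v a).2, (hg v b).2⟩⟩
    · rw [comp_ne hvw]
      exact hadj v w _ _ hvw (hg v a).1 (hg w b).1 (hg v a).2 (hg w b).2
  · rintro ⟨v, a⟩
    exact (hF v).lab a

theorem rule_p' {P : LGraph} {M N : P.V → LGraph} (hP : P.Prime) (h4 : 4 ≤ Fintype.card P.V)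
    (hM : ∀ v, Nonempty (M v).V) : ∃ p', GSRule p' ((P.dual.comp M).par (P.comp N)) ∧
      p'.iso ((cg P.V).comp fun v => (M v).par (N v)) := by
  let e := Fintype.equivFin P.V
  obtain ⟨M', rfl⟩ : ∃ M' : Fin (Fintype.card P.V) → LGraph, M = fun v => M' (e v) :=
    ⟨fun i => M (e.symm i), by funext v; simp⟩
  obtain ⟨N', rfl⟩ : ∃ N' : Fin (Fintype.card P.V) → LGraph, N = fun v => N' (e v) :=
    ⟨fun i => N (e.symm i), by funext v; simp⟩
  refine ⟨_, GSRule.p _ P e M' N' hP h4 (fun i => ?_), prem_iso e (fun i => (M' i).par (N' i))⟩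
  obtain ⟨v, rfl⟩ := e.surjective i
  exact hM v

theorem rule_up [Finite α] {p c : SG α} (hr : Rule lab p c) :
    ∃ (p' c' : LGraph), GSRule p' c' ∧ (∃ g, Rep lab p' p g) ∧ ∃ g, Rep lab c' c g := by
  cases hr with
  | ai x y hxy hl =>
    refine ⟨_, _, GSRule.ai (lab y), ⟨fun v => (v : Empty).elim, ⟨fun v => (v : Empty).elim, fun x => ?_,
      fun v => (v : Empty).elim, fun v => (v : Empty).elim⟩⟩,
      Sum.elim (fun _ => x) (fun _ => y), ⟨?_, ?_, ?_, ?_⟩⟩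
    · exact ⟨fun h => h.elim, fun ⟨v, _⟩ => (v : Empty).elim⟩
    · rintro (v | v) (w | w) h
      · rfl
      · exact absurd h hxy
      · exact absurd h.symm hxy
      · rfl
    · intro z
      rw [mem_pair]
      constructor
      · rintro (rfl | rfl)
        · exact ⟨Sum.inl (), rfl⟩
        · exact ⟨Sum.inr (), rfl⟩
      · rintro ⟨(_ | _), h⟩
        · exact Or.inl h.symm
        · exact Or.inr h.symm
    · rintro (v | v) (w | w) <;> exact Iff.rfl
    · rintro (v | v)
      · exact hl
      · rfl
  | ss A B S hd hA hS =>
    obtain ⟨a, ha⟩ := hA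
    obtain ⟨b, hb, hbS⟩ := hS
    refine ⟨_, _, GSRule.ss (toL lab A) (toL lab B) {v | v.1 ∈ S} ⟨⟨a, ha⟩⟩ ?_,
      ⟨_, (rep_toL B).plug (rep_toL A) hd (fun v => Iff.rfl)⟩, ⟨_, (rep_toL B).par (rep_toL A) hd⟩⟩
    exact Set.nonempty_iff_ne_empty.1 ⟨⟨b, hb⟩, hbS⟩
  | p P X Y h hP h4 hd hX hY hXs cX cY =>
    have hcard : Fintype.card (toL lab P).V = P.V.ncard := by
      rw [← Nat.card_eq_fintype_card]
      exact Nat.card_coe_set_eq P.V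
    have hprime : (toL lab P).Prime := by
      refine ⟨by omega, fun T hT => ?_⟩
      have := hP {x | ∃ v ∈ T, v.1 = x} (by rintro _ ⟨v, _, rfl⟩; exact v.2) (by
        rintro v hv hvT _ - ⟨x, hx, rfl⟩ _ - ⟨y, hy, rfl⟩ hvx
        exact (hT ⟨v, hv⟩ (fun h => hvT ⟨_, h, rfl⟩) x hx y hy).1 hvx)
      rcases this with h0 | ⟨v, h0⟩ | h0
      · left
        exact Set.eq_empty_iff_forall_notMem.2 fun v hv => h0 v.1 ⟨v, hv, rfl⟩
      · rcases Set.eq_empty_or_nonempty T with h1 | ⟨w, hw⟩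
        · exact Or.inl h1
        · right; left
          refine ⟨w, Set.eq_singleton_iff_unique_mem.2 ⟨hw, fun x hx => ?_⟩⟩
          exact Subtype.ext ((h0 _ ⟨x, hx, rfl⟩).trans (h0 _ ⟨w, hw, rfl⟩).symm)
      · right; right
        refine Set.eq_univ_of_forall fun v => ?_
        obtain ⟨w, hw, e⟩ := h0 v.1 v.2
        rwa [← Subtype.ext e]
    let M : (toL lab P).V → LGraph := fun v => toL lab (X.ind {x | h x = v.1})
    let N : (toL lab P).V → LGraph := fun v => toL lab (Y.ind {x | h x = v.1})
    have hM : ∀ v, Nonempty (M v).V := by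
      intro v
      obtain ⟨x, hx, hxv⟩ := hXs v.1 v.2
      exact ⟨⟨x, hx, hxv⟩⟩
    obtain ⟨p', hrule, ⟨i⟩⟩ := rule_p' (N := N) hprime (by omega) hM
    refine ⟨_, _, hrule, ?_, ?_⟩
    · suffices hh : Rep lab ((cg (toL lab P).V).comp fun v => (M v).par (N v)) (X.pprem Y h)
          (fun s => Sum.elim (fun a => a.1) (fun a => a.1) s.2) from ⟨_, hh.comp i⟩
      refine rep_compL (P := P) (P' := cg (toL lab P).V) (h := h) (Equiv.refl _) ?_ (fun v => (M v).par (N v))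
        (fun v => Sum.elim (fun a => a.1) (fun a => a.1)) ?_ ?_
      · rintro x (hx | hx)
        · exact hX x hx
        · exact hY x hx
      · intro v
        have := (rep_toL (lab := lab) (X.ind {x | h x = v.1})).par
          (rep_toL (Y.ind {x | h x = v.1})) (fun x hx hy => hd x hx.1 hy.1)
        have e1 : (pprem X Y h).ind {x | h x = v.1} =
            (X.ind {x | h x = v.1}).par (Y.ind {x | h x = v.1}) := by
          apply ext'
          · intro x
            simp only [mem_ind, mem_par, mem_pprem]
            tauto
          · intro x y
            simp only [adj_ind, adj_par, adj_pprem, Set.mem_ofPred_eq]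
            grind
        exact e1 ▸ this
      · intro v w x y hvw hx hy hxv hyw
        refine ⟨fun _ => Or.inr (Or.inr ⟨?_, hx, hy⟩), fun _ => hvw⟩
        rw [hxv, hyw]
        exact fun h => hvw (Subtype.ext h)
    · refine ⟨_, Rep.par (C := (toL lab P).dual.comp M) (K := (toL lab P).comp N)
        (f := fun s => s.2.1) (g := fun s => s.2.1) ?_ ?_ hd⟩
      · refine rep_compL (P := P) (P' := (toL lab P).dual) (h := h) (Equiv.refl _) hX M
          (fun v a => a.1) (fun v => rep_toL _) ?_
        intro v w x y hvw hx hy hxv hyw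
        have hxv' : h x = v.1 := hxv
        have hyw' : h y = w.1 := hyw
        have hne : h x ≠ h y := by
          rw [hxv', hyw']
          exact fun h => hvw (Subtype.ext h)
        rw [cX x y hx hy hne, hxv', hyw']
        exact ⟨fun h => h.2, fun h => ⟨hvw, h⟩⟩
      · refine rep_compL (P := P) (P' := toL lab P) (h := h) (Equiv.refl _) hY N
          (fun v a => a.1) (fun v => rep_toL _) ?_
        intro v w x y hvw hx hy hxv hyw
        have hxv' : h x = v.1 := hxv
        have hyw' : h y = w.1 := hyw
        have hne : h x ≠ h y := by
          rw [hxv', hyw']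
          exact fun h => hvw (Subtype.ext h)
        rw [cY x y hx hy hne, hxv', hyw']
        exact Iff.rfl

theorem drv_up [Finite α] {X Y : SG α} (h : Drv lab X Y) :
    Deriv GSRule (toL lab X) (toL lab Y) := by
  induction h with
  | refl => exact Relation.ReflTransGen.refl
  | tail _ h2 ih =>
    refine ih.tail (Or.inr ?_)
    obtain ⟨C, R, p, c, hr, hd, rfl, rfl⟩ := h2
    obtain ⟨p', c', hr', ⟨g, rg⟩, g', rg'⟩ := rule_up hr
    refine ⟨toL lab C, {v | v.1 ∈ R}, p', c', hr', ?_, ?_⟩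
    · exact (rep_toL _).iso ((rep_toL C).plug rg (fun x hx h => hd x hx (hr.sub x h))
        (fun v => Iff.rfl))
    · exact (rep_toL _).iso ((rep_toL C).plug rg' hd (fun v => Iff.rfl))

theorem drv_up' [Finite α] {X Y : SG α} (h : Drv lab X Y) {G H : LGraph} {f : G.V → α}
    {g : H.V → α} (r : Rep lab G X f) (r' : Rep lab H Y g) : Deriv GSRule G H :=
  Relation.ReflTransGen.head (Or.inl (r.iso (rep_toL X)))
    ((drv_up h).tail (Or.inl ((rep_toL Y).iso r')))

theorem prov_up [Finite α] {Y : SG α} (h : Prov lab Y) {H : LGraph} {g : H.V → α}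
    (r' : Rep lab H Y g) : Provable GSRule H := by
  refine drv_up' (f := fun v : LGraph.empty.V => (v : Empty).elim) h ⟨fun v => (v : Empty).elim, fun x => ?_,
    fun v => (v : Empty).elim, fun v => (v : Empty).elim⟩ r'
  exact ⟨fun h => h.elim, fun ⟨v, _⟩ => (v : Empty).elim⟩

theorem final (G A B : LGraph) (h : Provable GSRule (G.par (A.tensor B))) :
    ∃ (C : LGraph) (R : Set C.V) (KA KB : LGraph),
      Deriv GSRule (C.plug R (KA.par KB)) G ∧
      Provable GSRule (KA.par A) ∧
      Provable GSRule (KB.par B) ∧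
      Provable GSRule C := by
  have hfin : Finite (G.par (A.tensor B)).V := inferInstance
  have r0 : Rep (G.par (A.tensor B)).label (G.par (A.tensor B))
      (img (G.par (A.tensor B)) id Function.injective_id) id := rep_img _ (fun _ => rfl)
  obtain ⟨X, Z, rX, rZ, hd, e⟩ := r0.unpar
  have hp := deriv_dn h _ _ r0
  rw [e] at hp
  obtain ⟨KA, KB, hK, ⟨C, R, hCK, hC, hdr⟩, pA, pB⟩ := tensorSplit
    (A := {x | ∃ a : A.V, x = Sum.inr (Sum.inl a)}) hp hd (by
      rintro x y hx hy ⟨a, rfl⟩ hyA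
      obtain ⟨v, rfl⟩ := (rZ.mem y).1 hy
      rcases v with b | b
      · exact absurd ⟨b, rfl⟩ hyA
      · exact (rZ.adj (Sum.inl a) (Sum.inr b)).1 trivial)
  have hsub : ∀ x, x ∈ (KA.par KB).V → x ∈ X.V := fun x hx => hdr.sub x (Or.inr hx)
  refine ⟨toL (G.par (A.tensor B)).label C, {v | v.1 ∈ R}, toL (G.par (A.tensor B)).label KA,
    toL (G.par (A.tensor B)).label KB, ?_, ?_, ?_, ?_⟩
  · exact drv_up' hdr ((rep_toL C).plug ((rep_toL KA).par (rep_toL KB) hK) hCK (fun v => Iff.rfl)) rX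
  · refine prov_up pA ((rep_toL KA).par (g := fun a => Sum.inr (Sum.inl a)) ?_
      (fun x hx h' => hd x (hsub x (Or.inl hx)) h'.1))
    refine ⟨fun a b hab => ?_, fun x => ?_, fun a b => ?_, fun a => rfl⟩
    · cases hab
      rfl
    · constructor
      · rintro ⟨_, a, rfl⟩
        exact ⟨a, rfl⟩
      · rintro ⟨a, rfl⟩
        exact ⟨(rZ.mem _).2 ⟨Sum.inl a, rfl⟩, a, rfl⟩
    · refine Iff.trans (rZ.adj (Sum.inl a) (Sum.inl b)) ?_
      exact ⟨fun h => ⟨h, ⟨a, rfl⟩, ⟨b, rfl⟩⟩, fun h => h.1⟩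
  · have hn : ∀ b : B.V, ¬ ∃ a : A.V, (Sum.inr (Sum.inr b) : G.V ⊕ (A.V ⊕ B.V)) =
        Sum.inr (Sum.inl a) := by
      rintro b ⟨a, h⟩
      cases h
    refine prov_up pB ((rep_toL KB).par (g := fun a => Sum.inr (Sum.inr a)) ?_
      (fun x hx h' => hd x (hsub x (Or.inr hx)) h'.1))
    refine ⟨fun a b hab => ?_, fun x => ?_, fun a b => ?_, fun a => rfl⟩
    · cases hab
      rfl
    · constructor
      · rintro ⟨hx, hx'⟩
        obtain ⟨v, rfl⟩ := (rZ.mem x).1 hx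
        rcases v with v | v
        · exact absurd ⟨v, rfl⟩ hx'
        · exact ⟨v, rfl⟩
      · rintro ⟨a, rfl⟩
        exact ⟨(rZ.mem _).2 ⟨Sum.inr a, rfl⟩, hn a⟩
    · refine Iff.trans (rZ.adj (Sum.inr a) (Sum.inr b)) ?_
      exact ⟨fun h => ⟨h, hn a, hn b⟩, fun h => h.1⟩
  · exact prov_up hC (rep_toL C)

end SG
end

/-- **Splitting for tensor.** If `G ⅋ (A ⊗ B)` is provable in GS,
then there exist a context `C[·]_R` and graphs `K_A`, `K_B` such that: there is a GS
derivation from `C[K_A ⅋ K_B]_R` to `G`; `K_A ⅋ A` is provable in GS; `K_B ⅋ B` is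
provable in GS; and the graph `C` is provable in GS. -/
theorem splitting_tensor (G A B : LGraph)
    (h : Provable GSRule (G.par (A.tensor B))) :
    ∃ (C : LGraph) (R : Set C.V) (KA KB : LGraph),
      Deriv GSRule (C.plug R (KA.par KB)) G ∧
      Provable GSRule (KA.par A) ∧
      Provable GSRule (KB.par B) ∧
      Provable GSRule C := by
  exact SG.final G A B h
end GSP
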